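/- Let d ≥ 2 be a squarefree integer, and let σ₁, σ₂ : ℤ[√d] → ℝ be the two ring embeddings determined by √d ↦ √d and √d ↦ −√d, inducing group homomorphisms SL(2, ℤ[√d]) → SL(2, ℝ) by applying them entrywise. Let Γ = {(σ₁(A), σ₂(A)) : A ∈ SL(2, ℤ[√d])}, a subgroup of SL(2, ℝ) × SL(2, ℝ). Then for every finite symmetric generating subset W of Γ with 1 ∈ W, every 1-cocycle over every unitary representation of Γ on a complex Hilbert space has sublinear growth with respect to the word length |·|_W. -/

import Mathlib

open scoped Pointwise

/-- The word length of `g` with respect to a generating set `Q` (symmetric, containing `1`):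
the least `n` such that `g` is a product of `n` elements of `Q`. -/
noncomputable def wordLength {G : Type*} [Group G] (Q : Set G) (g : G) : ℕ :=
  sInf {n : ℕ | g ∈ Q ^ n}

/-- A map `b : G → H` into a normed space has sublinear growth with respect to the word
length `|·|_Q` if for every `ε > 0` there is `N` with `‖b g‖ < ε * |g|_Q` whenever `|g|_Q > N`. -/
def HasSublinearGrowth {G : Type*} [Group G] {H : Type*} [NormedAddCommGroup H]
    (Q : Set G) (b : G → H) : Prop :=
  ∀ ε : ℝ, 0 < ε → ∃ N : ℕ, ∀ g : G, N < wordLength Q g →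
    ‖b g‖ < ε * (wordLength Q g : ℝ)

/-- The embedding `SL(2, ℤ[√d]) → SL(2, ℝ) × SL(2, ℝ)` given entrywise by the two real
embeddings `√d ↦ √d` and `√d ↦ -√d` of `ℤ[√d]`. -/
noncomputable def sl2GaloisEmbedding (d : ℤ) (hd : 0 ≤ d) :
    Matrix.SpecialLinearGroup (Fin 2) (ℤ√d) →*
      Matrix.SpecialLinearGroup (Fin 2) ℝ × Matrix.SpecialLinearGroup (Fin 2) ℝ :=
  (Matrix.SpecialLinearGroup.map (Zsqrtd.toReal hd)).prod
    (Matrix.SpecialLinearGroup.map ((Zsqrtd.toReal hd).comp (starRingEnd (ℤ√d))))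

namespace SL2Cocycle

open MeasureTheory UpperHalfPlane Matrix Metric
open scoped MatrixGroups ENNReal

section MassTransport

/-- Mass transport for a measure-preserving action of a countable group: integrating an invariant
function against a weight of total orbit mass at most `N` costs at most `N` times its integral
against a weight of total orbit mass one. -/
theorem lintegral_mul_le_of_tsum_le {Γ Y : Type*} [Group Γ] [Countable Γ] [MeasurableSpace Y]
    {μ : Measure Y} {T : Γ → Y → Y} (hT : ∀ γ, MeasurePreserving (T γ) μ μ)
    (hinv : ∀ γ y, T γ⁻¹ (T γ y) = y) {p q Φ : Y → ℝ≥0∞} (hp : Measurable p) (hq : Measurable q)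
    (hΦ : Measurable Φ) (hΦT : ∀ γ y, Φ (T γ y) = Φ y) (hp1 : ∀ y, ∑' γ, p (T γ y) = 1)
    {N : ℝ≥0∞} (hqN : ∀ y, ∑' γ, q (T γ y) ≤ N) :
    ∫⁻ y, q y * Φ y ∂μ ≤ N * ∫⁻ y, p y * Φ y ∂μ := by
  have hm : ∀ γ, Measurable (T γ) := fun γ => (hT γ).measurable
  calc ∫⁻ y, q y * Φ y ∂μ = ∫⁻ y, ∑' γ, p (T γ y) * (q y * Φ y) ∂μ := by
        simp_rw [ENNReal.tsum_mul_right, hp1, one_mul]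
    _ = ∑' γ, ∫⁻ y, p (T γ y) * (q y * Φ y) ∂μ :=
        lintegral_tsum fun γ => ((hp.comp (hm γ)).mul (hq.mul hΦ)).aemeasurable
    _ = ∑' γ, ∫⁻ y, p y * (q (T γ⁻¹ y) * Φ y) ∂μ := by
        congr 1 with γ
        have h := (hT γ).lintegral_comp (f := fun y => p y * (q (T γ⁻¹ y) * Φ y))
          (hp.mul ((hq.comp (hm _)).mul hΦ))
        simpa only [hinv, hΦT] using h
    _ = ∫⁻ y, ∑' γ, p y * (q (T γ⁻¹ y) * Φ y) ∂μ :=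
        (lintegral_tsum fun γ => (hp.mul ((hq.comp (hm _)).mul hΦ)).aemeasurable).symm
    _ ≤ ∫⁻ y, N * (p y * Φ y) ∂μ := by
        refine lintegral_mono fun y => ?_
        have h : ∑' γ, q (T γ⁻¹ y) ≤ N := by
          exact ((Equiv.inv Γ).tsum_eq fun γ => q (T γ y)).trans_le (hqN y)
        rw [ENNReal.tsum_mul_left, ENNReal.tsum_mul_right]
        calc p y * ((∑' γ, q (T γ⁻¹ y)) * Φ y) ≤ p y * (N * Φ y) := by gcongr
          _ = N * (p y * Φ y) := by ring
    _ = N * ∫⁻ y, p y * Φ y ∂μ := lintegral_const_mul _ (hp.mul hΦ)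

/-- Two weights of total orbit mass one give the same integral for invariant functions. -/
theorem lintegral_mul_eq_of_tsum_eq_one {Γ Y : Type*} [Group Γ] [Countable Γ] [MeasurableSpace Y]
    {μ : Measure Y} {T : Γ → Y → Y} (hT : ∀ γ, MeasurePreserving (T γ) μ μ)
    (hinv : ∀ γ y, T γ⁻¹ (T γ y) = y) {p q Φ : Y → ℝ≥0∞} (hp : Measurable p) (hq : Measurable q)
    (hΦ : Measurable Φ) (hΦT : ∀ γ y, Φ (T γ y) = Φ y) (hp1 : ∀ y, ∑' γ, p (T γ y) = 1)
    (hq1 : ∀ y, ∑' γ, q (T γ y) = 1) :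
    ∫⁻ y, p y * Φ y ∂μ = ∫⁻ y, q y * Φ y ∂μ := by
  apply le_antisymm
  · simpa using lintegral_mul_le_of_tsum_le hT hinv hq hp hΦ hΦT hq1 (fun y => (hp1 y).le)
  · simpa using lintegral_mul_le_of_tsum_le hT hinv hp hq hΦ hΦT hp1 (fun y => (hq1 y).le)

end MassTransport

section Variance

variable {H : Type*} [NormedAddCommGroup H] [InnerProductSpace ℝ H] [CompleteSpace H]

/-- Steiner's formula for the second moment of a bounded Hilbert space valued function. -/
theorem lintegral_enorm_sub_sq_eq {α : Type*} [MeasurableSpace α] {ν : Measure α}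
    [IsFiniteMeasure ν] {f : α → H} (hf : AEStronglyMeasurable f ν) {C : ℝ}
    (hC : ∀ᵐ x ∂ν, ‖f x‖ ≤ C) (v : H) :
    ∫⁻ x, ‖f x - v‖ₑ ^ 2 ∂ν
      = ∫⁻ x, ‖f x - ⨍ y, f y ∂ν‖ₑ ^ 2 ∂ν + ν Set.univ * ‖(⨍ y, f y ∂ν) - v‖ₑ ^ 2 := by
  set m := ⨍ y, f y ∂ν with hm
  have hfi : Integrable f ν := Integrable.of_bound hf C hC
  have hbd : ∀ u : H, Integrable (fun x => ‖f x - u‖ ^ 2) ν := by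
    intro u
    refine Integrable.of_bound (C := (C + ‖u‖) ^ 2)
      ((hf.sub aestronglyMeasurable_const).norm.pow 2) ?_
    filter_upwards [hC] with x hx
    rw [Real.norm_of_nonneg (by positivity)]
    gcongr
    exact (norm_sub_le _ _).trans (by gcongr)
  have hin : Integrable (fun x => (2 : ℝ) * inner ℝ (f x - m) (m - v)) ν :=
    ((hfi.sub (integrable_const m)).inner_const (m - v)).const_mul 2
  have key : ∫ x, ‖f x - v‖ ^ 2 ∂ν = ∫ x, ‖f x - m‖ ^ 2 ∂ν + ν.real Set.univ * ‖m - v‖ ^ 2 := by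
    have h1 : ∀ x, ‖f x - v‖ ^ 2
        = (‖f x - m‖ ^ 2 + 2 * inner ℝ (f x - m) (m - v)) + ‖m - v‖ ^ 2 := by
      intro x
      rw [← norm_add_sq_real, sub_add_sub_cancel]
    have h0 : ∫ x, inner ℝ (f x - m) (m - v) ∂ν = 0 := by
      rw [integral_congr_ae (ae_of_all _ fun x => real_inner_comm (m - v) (f x - m)),
        integral_inner (f := fun x => f x - m) (hfi.sub (integrable_const m)), hm]
      simp [integral_sub_average]
    simp_rw [h1]
    rw [integral_add (f := fun x => ‖f x - m‖ ^ 2 + 2 * inner ℝ (f x - m) (m - v))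
      ((hbd m).add hin) (integrable_const _), integral_add (hbd m) hin, integral_const_mul, h0]
    simp
  have conv : ∀ u : H, ∫⁻ x, ‖f x - u‖ₑ ^ 2 ∂ν = ENNReal.ofReal (∫ x, ‖f x - u‖ ^ 2 ∂ν) := by
    intro u
    rw [ofReal_integral_eq_lintegral_ofReal (hbd u) (ae_of_all _ fun x => by positivity)]
    congr 1 with x
    rw [ENNReal.ofReal_pow (norm_nonneg _), ofReal_norm]
  rw [conv v, conv m, key, ENNReal.ofReal_add (integral_nonneg fun x => by positivity)
    (by positivity), ENNReal.ofReal_mul (by positivity), ENNReal.ofReal_pow (norm_nonneg _),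
    ofReal_norm, ofReal_measureReal]

end Variance

section HyperbolicMeasure

instance smulInvariantMeasure_SL : SMulInvariantMeasure SL(2, ℝ) ℍ volume :=
  ⟨fun g _ hs => measure_preimage_smul_of_nullMeasurableSet (μ := (volume : Measure ℍ))
    hs.nullMeasurableSet (SpecialLinearGroup.mapGL ℝ g)⟩

theorem measure_ball_eq (z w : ℍ) (r : ℝ) : volume (ball z r) = volume (ball w r) := by
  obtain ⟨g, rfl⟩ := MulAction.exists_smul_eq SL(2, ℝ) w z
  rw [← Metric.smul_ball, measure_smul]

instance isOpenPosMeasure_volume : (volume : Measure ℍ).IsOpenPosMeasure := by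
  refine ⟨fun U hU hne h0 => ?_⟩
  rw [volume_eq_lintegral, lintegral_eq_zero_iff (by fun_prop)] at h0
  have hcoe : IsOpen (UpperHalfPlane.coe '' U) := isOpenEmbedding_coe.isOpenMap U hU
  have hpos := hcoe.measure_pos volume (hne.image _)
  rw [Filter.EventuallyEq, ae_restrict_iff' hcoe.measurableSet] at h0
  refine hpos.ne' (measure_mono_null (fun z hz => ?_) h0)
  obtain ⟨w, hw, rfl⟩ := hz
  have := w.im_ne_zero
  simp [hw, this]

end HyperbolicMeasure

section Kernel

open Classical in
/-- The indicator of the pairs of points of `ℍ` at distance less than `3`. -/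
noncomputable def ker (z w : ℍ) : ℝ≥0∞ := if dist z w < 3 then 1 else 0

theorem ker_comm (z w : ℍ) : ker z w = ker w z := by simp only [ker, dist_comm]

theorem ker_smul (g : SL(2, ℝ)) (z w : ℍ) : ker (g • z) (g • w) = ker z w := by
  simp only [ker, dist_smul]

@[fun_prop]
theorem measurable_ker {α : Type*} [MeasurableSpace α] {a b : α → ℍ} (ha : Measurable a)
    (hb : Measurable b) : Measurable fun x => ker (a x) (b x) :=
  Measurable.ite (measurableSet_lt (ha.dist hb) measurable_const) measurable_const
    measurable_const

theorem lintegral_ker_mul (z : ℍ) (F : ℍ → ℝ≥0∞) :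
    ∫⁻ w, ker z w * F w = ∫⁻ w in ball z 3, F w := by
  rw [← lintegral_indicator measurableSet_ball]
  congr 1 with w
  by_cases h : dist z w < 3
  · simp [ker, h, mem_ball, dist_comm w z]
  · simp [ker, h, mem_ball, dist_comm w z]

/-- The volume of a hyperbolic ball of radius `3`. -/
noncomputable def ballVol : ℝ≥0∞ := volume (ball UpperHalfPlane.I 3)

theorem ballVol_eq (z : ℍ) : volume (ball z 3) = ballVol := measure_ball_eq _ _ _

theorem ballVol_ne_zero : ballVol ≠ 0 := (measure_ball_pos _ _ (by norm_num)).ne'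

theorem ballVol_ne_top : ballVol ≠ ∞ := measure_ball_lt_top.ne

theorem measureReal_ball_pos' (z : ℍ) : 0 < volume.real (ball z 3) :=
  ENNReal.toReal_pos (measure_ball_pos _ _ (by norm_num)).ne' measure_ball_lt_top.ne

theorem lintegral_ker (z : ℍ) : ∫⁻ w, ker z w = ballVol := by
  simpa [ballVol_eq] using lintegral_ker_mul z (fun _ => 1)

end Kernel

theorem measurable_enorm_sub_sq {H : Type*} [NormedAddCommGroup H] {f g : ℍ × ℍ → H}
    (hf : StronglyMeasurable f) (hg : StronglyMeasurable g)
    {α : Type*} [MeasurableSpace α] {u v : α → ℍ × ℍ} (hu : Measurable u) (hv : Measurable v) :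
    Measurable fun x => ‖f (u x) - g (v x)‖ₑ ^ 2 :=
  (((hf.comp_measurable hu).sub (hg.comp_measurable hv)).enorm).pow_const 2

section Fields

variable {Γ : Type*} [Group Γ] {H : Type*} [NormedAddCommGroup H] [InnerProductSpace ℝ H]

/-- Strongly measurable maps `ℍ × ℍ → H`, bounded on bounded sets, which are equivariant for
the action of `Γ` on `ℍ × ℍ` through `ρ₁, ρ₂` and the affine action `v ↦ π γ v + b γ`. -/
structure IsField (ρ₁ ρ₂ : Γ →* SL(2, ℝ)) (π : Γ → H ≃ₗᵢ[ℝ] H) (b : Γ → H)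
    (f : ℍ × ℍ → H) : Prop where
  meas : StronglyMeasurable f
  bdd : ∀ r : ℝ, ∃ C : ℝ, ∀ z w : ℍ, dist z I ≤ r → dist w I ≤ r → ‖f (z, w)‖ ≤ C
  equiv : ∀ γ z w, f (ρ₁ γ • z, ρ₂ γ • w) = π γ (f (z, w)) + b γ

/-- The average of `f` over the ball of radius `3` in the second coordinate. -/
noncomputable def avg (f : ℍ × ℍ → H) (z : ℍ × ℍ) : H := ⨍ w in ball z.2 3, f (z.1, w)

variable {ρ₁ ρ₂ : Γ →* SL(2, ℝ)} {π : Γ → H ≃ₗᵢ[ℝ] H} {b : Γ → H} {f g : ℍ × ℍ → H}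

theorem IsField.sub (hf : IsField ρ₁ ρ₂ π b f) (hg : IsField ρ₁ ρ₂ π b g) :
    IsField ρ₁ ρ₂ π 0 (f - g) where
  meas := hf.meas.sub hg.meas
  bdd r := by
    obtain ⟨C, hC⟩ := hf.bdd r
    obtain ⟨D, hD⟩ := hg.bdd r
    exact ⟨C + D, fun z w hz hw =>
        (norm_sub_le _ _).trans (add_le_add (hC z w hz hw) (hD z w hz hw))⟩
  equiv γ z w := by simp [hf.equiv, hg.equiv]

theorem IsField.midpoint (hf : IsField ρ₁ ρ₂ π b f) (hg : IsField ρ₁ ρ₂ π b g) :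
    IsField ρ₁ ρ₂ π b ((2⁻¹ : ℝ) • (f + g)) where
  meas := (hf.meas.add hg.meas).const_smul _
  bdd r := by
    obtain ⟨C, hC⟩ := hf.bdd r
    obtain ⟨D, hD⟩ := hg.bdd r
    refine ⟨‖(2⁻¹ : ℝ)‖ * (C + D), fun z w hz hw => ?_⟩
    rw [Pi.smul_apply, norm_smul]
    gcongr
    exact (norm_add_le _ _).trans (add_le_add (hC z w hz hw) (hD z w hz hw))
  equiv γ z w := by
    simp only [Pi.smul_apply, Pi.add_apply, hf.equiv, hg.equiv, map_smul, map_add, smul_add]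
    have : b γ = (2⁻¹ : ℝ) • b γ + (2⁻¹ : ℝ) • b γ := by rw [← add_smul]; norm_num
    nth_rw 3 [this]
    abel

theorem IsField.bdd_ball (hf : IsField ρ₁ ρ₂ π b f) (z : ℍ) (w : ℍ) (r : ℝ) :
    ∃ C : ℝ, ∀ u ∈ ball z r, ∀ v ∈ ball w r, ‖f (u, v)‖ ≤ C := by
  obtain ⟨C, hC⟩ := hf.bdd (r + max (dist z I) (dist w I))
  refine ⟨C, fun u hu v hv => hC u v ?_ ?_⟩
  · have := dist_triangle u z I
    have := le_max_left (dist z I) (dist w I)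
    have := mem_ball.1 hu
    linarith
  · have := dist_triangle v w I
    have := le_max_right (dist z I) (dist w I)
    have := mem_ball.1 hv
    linarith

theorem IsField.integrableOn (hf : IsField ρ₁ ρ₂ π b f) (z w : ℍ) :
    IntegrableOn (fun v => f (z, v)) (ball w 3) := by
  obtain ⟨C, hC⟩ := hf.bdd_ball z w 3
  refine Measure.integrableOn_of_bounded (M := C) measure_ball_lt_top.ne
    (hf.meas.comp_measurable (by fun_prop)).aestronglyMeasurable ?_
  filter_upwards [ae_restrict_mem measurableSet_ball] with v hv
  exact hC z (mem_ball_self (by norm_num)) v hv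

theorem setAverage_ball_smul (g : SL(2, ℝ)) (z : ℍ) (F : ℍ → H) (r : ℝ) :
    ⨍ w in ball (g • z) r, F w = ⨍ w in ball z r, F (g • w) := by
  have h := (measurePreserving_smul g (volume : Measure ℍ)).setIntegral_preimage_emb
    (measurableEmbedding_const_smul g) F (ball (g • z) r)
  have hpre : (fun w => g • w) ⁻¹' (ball (g • z) r) = ball z r := by
    ext w; simp [mem_ball]
  rw [hpre] at h
  rw [setAverage_eq, setAverage_eq, h]
  congr 2
  simp only [measureReal_def]
  rw [measure_ball_eq (g • z) z]

variable [CompleteSpace H]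

theorem IsField.avg (hf : IsField ρ₁ ρ₂ π b f) : IsField ρ₁ ρ₂ π b (avg f) where
  meas := by
    have h : ∀ z : ℍ × ℍ, SL2Cocycle.avg f z
        = (ballVol.toReal)⁻¹ • ∫ w, (ker z.2 w).toReal • f (z.1, w) := by
      intro z
      rw [SL2Cocycle.avg, setAverage_eq, measureReal_def, ballVol_eq,
        ← integral_indicator measurableSet_ball]
      congr 2 with w
      by_cases h : dist z.2 w < 3
      · simp [ker, h, mem_ball, dist_comm w z.2]
      · simp [ker, h, mem_ball, dist_comm w z.2]
    rw [funext h]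
    refine StronglyMeasurable.const_smul (StronglyMeasurable.integral_prod_right
      (f := fun (z : ℍ × ℍ) (w : ℍ) => (ker z.2 w).toReal • f (z.1, w)) ?_) _
    have hk : Measurable fun p : (ℍ × ℍ) × ℍ => (ker p.1.2 p.2).toReal :=
      (measurable_ker (by fun_prop) (by fun_prop)).ennreal_toReal
    exact hk.stronglyMeasurable.smul (hf.meas.comp_measurable (by fun_prop))
  bdd r := by
    obtain ⟨C, hC⟩ := hf.bdd (r + 3)
    refine ⟨ C, fun z w hz hw => ?_⟩
    have hb : ∀ v ∈ ball w 3, ‖f (z, v)‖ ≤ C := fun v hv =>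
      hC z v (by linarith) (by
        have := dist_triangle v w I
        have := mem_ball.1 hv
        linarith)
    have hn := norm_setIntegral_le_of_norm_le_const (μ := volume) (f := fun v => f (z, v))
      (measure_ball_lt_top (x := w) (r := 3)) hb
    have hV : 0 < volume.real (ball w 3) := measureReal_ball_pos' w
    rw [SL2Cocycle.avg, setAverage_eq, norm_smul, norm_inv, Real.norm_of_nonneg hV.le]
    rwa [inv_mul_le_iff₀ hV, mul_comm]
  equiv γ z w := by
    have hV : 0 < volume.real (ball w 3) := measureReal_ball_pos' w
    simp only [SL2Cocycle.avg]
    rw [setAverage_ball_smul]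
    simp only [hf.equiv]
    rw [setAverage_eq, integral_add, setIntegral_const, smul_add, smul_smul,
      inv_mul_cancel₀ hV.ne', one_smul, setAverage_eq, map_smul]
    · congr 2
      exact (π γ).toContinuousLinearEquiv.integral_comp_comm _
    · exact (π γ).toContinuousLinearEquiv.toContinuousLinearMap.integrable_comp
        (hf.integrableOn z w)
    · exact integrableOn_const measure_ball_lt_top.ne

theorem IsField.lintegral_ker_sub_sq (hf : IsField ρ₁ ρ₂ π b f) (z : ℍ × ℍ) (v : H) :
    ∫⁻ w, ker z.2 w * ‖f (z.1, w) - v‖ₑ ^ 2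
      = (∫⁻ w, ker z.2 w * ‖f (z.1, w) - SL2Cocycle.avg f z‖ₑ ^ 2)
        + ballVol * ‖SL2Cocycle.avg f z - v‖ₑ ^ 2 := by
  obtain ⟨C, hC⟩ := hf.bdd_ball z.1 z.2 3
  have : IsFiniteMeasure (volume.restrict (ball z.2 3)) :=
    ⟨by simpa using measure_ball_lt_top⟩
  rw [lintegral_ker_mul, lintegral_ker_mul, lintegral_enorm_sub_sq_eq (C := C)
    (hf.integrableOn z.1 z.2).aestronglyMeasurable ?_ v]
  · simp [SL2Cocycle.avg, ballVol_eq]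
  · filter_upwards [ae_restrict_mem measurableSet_ball] with w hw
    exact hC _ (mem_ball_self (by norm_num)) w hw

theorem IsField.lintegral_ker_diff_sq (hf : IsField ρ₁ ρ₂ π b f) (z w z₂ : ℍ) :
    ∫⁻ w₂, ker z₂ w₂ * ‖f (w, w₂) - f (z, w₂)‖ₑ ^ 2
      = (∫⁻ w₂, ker z₂ w₂ * ‖(f (w, w₂) - f (z, w₂))
          - (SL2Cocycle.avg f (w, z₂) - SL2Cocycle.avg f (z, z₂))‖ₑ ^ 2)
        + ballVol * ‖SL2Cocycle.avg f (w, z₂) - SL2Cocycle.avg f (z, z₂)‖ₑ ^ 2 := by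
  obtain ⟨C, hC⟩ := hf.bdd_ball z z₂ 3
  obtain ⟨C', hC'⟩ := hf.bdd_ball w z₂ 3
  have : IsFiniteMeasure (volume.restrict (ball z₂ 3)) :=
    ⟨by simpa using measure_ball_lt_top⟩
  have hint := (hf.integrableOn w z₂).sub (hf.integrableOn z z₂)
  have h := lintegral_enorm_sub_sq_eq (C := C' + C) hint.aestronglyMeasurable ?_ 0
  · have hav : ⨍ y in ball z₂ 3, ((fun v => f (w, v)) - fun v => f (z, v)) y
        = SL2Cocycle.avg f (w, z₂) - SL2Cocycle.avg f (z, z₂) := by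
      simp only [SL2Cocycle.avg, setAverage_eq, ← smul_sub]
      congr 1
      exact integral_sub (hf.integrableOn w z₂) (hf.integrableOn z z₂)
    rw [hav] at h
    rw [lintegral_ker_mul, lintegral_ker_mul]
    simpa [ballVol_eq] using h
  · filter_upwards [ae_restrict_mem measurableSet_ball] with v hv
    exact (norm_sub_le _ _).trans (add_le_add (hC' _ (mem_ball_self (by norm_num)) v hv)
      (hC _ (mem_ball_self (by norm_num)) v hv))

end Fields

theorem ker_ne_top (z w : ℍ) : ker z w ≠ ∞ := by
  unfold ker
  split_ifs <;> simp

section Energy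

variable {Γ : Type*} [Group Γ] {H : Type*} [NormedAddCommGroup H] [InnerProductSpace ℝ H]
  {ρ₁ ρ₂ : Γ →* SL(2, ℝ)} {π : Γ → H ≃ₗᵢ[ℝ] H} {b : Γ → H} {f g : ℍ × ℍ → H}
  {φ : ℍ × ℍ → ℝ≥0∞}

theorem lintegral_prod_mk {F : (ℍ × ℍ) × ℍ → ℝ≥0∞} (hF : Measurable F) :
    ∫⁻ y, F y = ∫⁻ z : ℍ × ℍ, ∫⁻ w : ℍ, F (z, w) :=
  lintegral_prod _ hF.aemeasurable

theorem lintegral_swap_snd {F : (ℍ × ℍ) × ℍ → ℝ≥0∞} (hF : Measurable F) :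
    ∫⁻ z : ℍ × ℍ, ∫⁻ w : ℍ, F ((z.1, w), z.2) = ∫⁻ z : ℍ × ℍ, ∫⁻ w : ℍ, F (z, w) := by
  have h1 : Measurable fun z : ℍ × ℍ => ∫⁻ w : ℍ, F ((z.1, w), z.2) :=
    Measurable.lintegral_prod_right' (f := fun y : (ℍ × ℍ) × ℍ => F ((y.1.1, y.2), y.1.2))
      (hF.comp (by fun_prop))
  have h2 : Measurable fun z : ℍ × ℍ => ∫⁻ w : ℍ, F (z, w) := hF.lintegral_prod_right'
  have e1 : ∫⁻ z : ℍ × ℍ, ∫⁻ w : ℍ, F ((z.1, w), z.2)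
      = ∫⁻ x : ℍ, ∫⁻ y : ℍ, ∫⁻ w : ℍ, F ((x, w), y) := lintegral_prod _ h1.aemeasurable
  have e2 : ∫⁻ z : ℍ × ℍ, ∫⁻ w : ℍ, F (z, w)
      = ∫⁻ x : ℍ, ∫⁻ y : ℍ, ∫⁻ w : ℍ, F ((x, y), w) := lintegral_prod _ h2.aemeasurable
  rw [e1, e2]
  congr 1 with x
  have h3 : Measurable (Function.uncurry fun y w : ℍ => F ((x, w), y)) :=
    hF.comp (f := fun p : ℍ × ℍ => ((x, p.2), p.1)) (by fun_prop)
  exact lintegral_lintegral_swap h3.aemeasurable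

theorem lintegral_weight_add {φ A B : ℍ × ℍ → ℝ≥0∞} (hφ : Measurable φ) (hB : Measurable B) :
    (∫⁻ z, φ z * A z) + ballVol * ∫⁻ z, φ z * B z = ∫⁻ z, φ z * (A z + ballVol * B z) := by
  rw [← lintegral_const_mul' _ _ ballVol_ne_top,
    ← lintegral_add_right (g := fun z => ballVol * (φ z * B z)) _
      (Measurable.const_mul (hφ.mul hB) _)]
  congr 1 with z
  ring

theorem lintegral_weight_mul {φ A : ℍ × ℍ → ℝ≥0∞} :
    ∫⁻ z, φ z * (ballVol * A z) = ballVol * ∫⁻ z, φ z * A z := by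
  rw [← lintegral_const_mul' _ _ ballVol_ne_top]
  congr 1 with z
  ring

/-- A measurable weight on `ℍ × ℍ` of total mass one along every `Γ`-orbit. -/
structure IsWeight (ρ₁ ρ₂ : Γ →* SL(2, ℝ)) (φ : ℍ × ℍ → ℝ≥0∞) : Prop where
  meas : Measurable φ
  tsum_eq : ∀ z w, ∑' γ, φ (ρ₁ γ • z, ρ₂ γ • w) = 1

theorem IsWeight.lintegral_swap [Countable Γ] (hφ : IsWeight ρ₁ ρ₂ φ)
    {Φ : ℍ → ℍ → ℍ → ℝ≥0∞} (hΦ : Measurable fun p : (ℍ × ℍ) × ℍ => Φ p.1.1 p.1.2 p.2)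
    (hinv : ∀ γ z w v, Φ (ρ₁ γ • z) (ρ₂ γ • w) (ρ₂ γ • v) = Φ z w v) :
    ∫⁻ z, φ z * ∫⁻ w, Φ z.1 z.2 w = ∫⁻ z, φ z * ∫⁻ w, Φ z.1 w z.2 := by
  have hφm := hφ.meas
  let T : Γ → (ℍ × ℍ) × ℍ → (ℍ × ℍ) × ℍ :=
    fun γ p => ((ρ₁ γ • p.1.1, ρ₂ γ • p.1.2), ρ₂ γ • p.2)
  have hT : ∀ γ, MeasurePreserving (T γ) volume volume := fun γ =>
    ((measurePreserving_smul (ρ₁ γ) volume).prod (measurePreserving_smul (ρ₂ γ) volume)).prod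
      (measurePreserving_smul (ρ₂ γ) volume)
  have key := lintegral_mul_eq_of_tsum_eq_one (μ := volume) (T := T) hT
    (by intro γ y; simp [T]) (p := fun y => φ y.1) (q := fun y => φ (y.1.1, y.2))
    (Φ := fun p => Φ p.1.1 p.1.2 p.2) (by fun_prop) (by fun_prop) hΦ
    (fun γ y => hinv γ _ _ _) (fun y => hφ.tsum_eq _ _) (fun y => hφ.tsum_eq _ _)
  have m1 : Measurable fun y : (ℍ × ℍ) × ℍ => φ y.1 * Φ y.1.1 y.1.2 y.2 :=
    (hφm.comp measurable_fst).mul hΦ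
  have m2 : Measurable fun y : (ℍ × ℍ) × ℍ => φ (y.1.1, y.2) * Φ y.1.1 y.1.2 y.2 :=
    (hφm.comp (by fun_prop)).mul hΦ
  have e1 : ∫⁻ z, φ z * ∫⁻ w, Φ z.1 z.2 w
      = ∫⁻ y : (ℍ × ℍ) × ℍ, φ y.1 * Φ y.1.1 y.1.2 y.2 := by
    refine Eq.trans ?_ (lintegral_prod_mk m1).symm
    congr 1 with z
    exact (lintegral_const_mul _ (hΦ.comp (f := fun w : ℍ => (z, w)) (by fun_prop))).symm
  have e2 : ∫⁻ z, φ z * ∫⁻ w, Φ z.1 w z.2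
      = ∫⁻ y : (ℍ × ℍ) × ℍ, φ (y.1.1, y.2) * Φ y.1.1 y.1.2 y.2 := by
    refine Eq.trans ?_ ((lintegral_swap_snd m2).trans (lintegral_prod_mk m2).symm)
    congr 1 with z
    exact (lintegral_const_mul _
      (hΦ.comp (f := fun w : ℍ => ((z.1, w), z.2)) (by fun_prop))).symm
  rw [e1, e2]
  exact key

/-- The energy in the first coordinate. -/
noncomputable def energyFst (φ : ℍ × ℍ → ℝ≥0∞) (f : ℍ × ℍ → H) : ℝ≥0∞ :=
  ∫⁻ z, φ z * ∫⁻ w, ker z.1 w * ‖f (w, z.2) - f z‖ₑ ^ 2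

/-- The energy in the second coordinate. -/
noncomputable def energySnd (φ : ℍ × ℍ → ℝ≥0∞) (f : ℍ × ℍ → H) : ℝ≥0∞ :=
  ∫⁻ z, φ z * ∫⁻ w, ker z.2 w * ‖f (z.1, w) - f z‖ₑ ^ 2

/-- The mixed variance. -/
noncomputable def mixedVar (φ : ℍ × ℍ → ℝ≥0∞) (f : ℍ × ℍ → H) : ℝ≥0∞ :=
  ∫⁻ z, φ z * ∫⁻ w, ker z.1 w * ∫⁻ v, ker z.2 v *
    ‖(f (w, v) - f (z.1, v)) - (avg f (w, z.2) - avg f (z.1, z.2))‖ₑ ^ 2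

theorem IsField.enorm_sub (hf : IsField ρ₁ ρ₂ π b f) (hg : IsField ρ₁ ρ₂ π b g)
    (γ : Γ) (z w z' w' : ℍ) :
    ‖f (ρ₁ γ • z, ρ₂ γ • w) - g (ρ₁ γ • z', ρ₂ γ • w')‖ₑ = ‖f (z, w) - g (z', w')‖ₑ := by
  rw [hf.equiv, hg.equiv, add_sub_add_right_eq_sub, ← map_sub]
  exact (π γ).toLinearIsometry.enorm_map _

theorem lintegral_ker_smul (g : SL(2, ℝ)) (z : ℍ) (F : ℍ → ℝ≥0∞) :
    ∫⁻ w, ker (g • z) w * F w = ∫⁻ w, ker z w * F (g • w) := by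
  rw [← (measurePreserving_smul g (volume : Measure ℍ)).lintegral_comp_emb
    (measurableEmbedding_const_smul g)]
  simp only [ker_smul]

theorem IsField.avg_sub {b' : Γ → H} (hf : IsField ρ₁ ρ₂ π b f) (hg : IsField ρ₁ ρ₂ π b' g)
    (z : ℍ × ℍ) : SL2Cocycle.avg (f - g) z = SL2Cocycle.avg f z - SL2Cocycle.avg g z := by
  simp only [SL2Cocycle.avg, setAverage_eq, ← smul_sub]
  congr 1
  exact integral_sub (hf.integrableOn z.1 z.2) (hg.integrableOn z.1 z.2)

variable [CompleteSpace H] [Countable Γ]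

theorem IsField.mixedVar_add_energyFst_avg (hf : IsField ρ₁ ρ₂ π b f)
    (hφ : IsWeight ρ₁ ρ₂ φ) :
    mixedVar φ f + ballVol * energyFst φ (SL2Cocycle.avg f) = ballVol * energyFst φ f := by
  have hfm := hf.meas
  have ham := hf.avg.meas
  have hφm := hφ.meas
  have m1 : Measurable fun p : (ℍ × ℍ) × ℍ =>
      ∫⁻ w, ker p.1.1 w * (ker p.1.2 p.2 * ‖f (w, p.2) - f (p.1.1, p.2)‖ₑ ^ 2) :=
    Measurable.lintegral_prod_right' (f := fun q : ((ℍ × ℍ) × ℍ) × ℍ =>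
      ker q.1.1.1 q.2 * (ker q.1.1.2 q.1.2 * ‖f (q.2, q.1.2) - f (q.1.1.1, q.1.2)‖ₑ ^ 2))
      ((measurable_ker (by fun_prop) (by fun_prop)).mul
        ((measurable_ker (by fun_prop) (by fun_prop)).mul
          (measurable_enorm_sub_sq hfm hfm (by fun_prop) (by fun_prop))))
  have hswap := hφ.lintegral_swap
    (Φ := fun z w v => ∫⁻ u, ker z u * (ker w v * ‖f (u, v) - f (z, v)‖ₑ ^ 2)) m1 (by
      intro γ z w v
      rw [lintegral_ker_smul]
      simp only [ker_smul, hf.enorm_sub hf])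
  have mD : ∀ z : ℍ × ℍ, Measurable fun p : ℍ × ℍ =>
      ker z.1 p.1 * (ker z.2 p.2 * ‖f (p.1, p.2) - f (z.1, p.2)‖ₑ ^ 2) := fun z =>
    (measurable_ker (by fun_prop) (by fun_prop)).mul
        ((measurable_ker (by fun_prop) (by fun_prop)).mul
          (measurable_enorm_sub_sq hfm hfm (by fun_prop) (by fun_prop)))
  have hL : ∀ z : ℍ × ℍ,
      ∫⁻ v, ∫⁻ u, ker z.1 u * (ker z.2 v * ‖f (u, v) - f (z.1, v)‖ₑ ^ 2)
      = (∫⁻ u, ker z.1 u * ∫⁻ v, ker z.2 v *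
          ‖(f (u, v) - f (z.1, v))
            - (SL2Cocycle.avg f (u, z.2) - SL2Cocycle.avg f (z.1, z.2))‖ₑ ^ 2)
        + ballVol * ∫⁻ u, ker z.1 u *
          ‖SL2Cocycle.avg f (u, z.2) - SL2Cocycle.avg f (z.1, z.2)‖ₑ ^ 2 := by
    intro z
    have mA : Measurable fun u : ℍ =>
      ker z.1 u * ‖SL2Cocycle.avg f (u, z.2) - SL2Cocycle.avg f (z.1, z.2)‖ₑ ^ 2 :=
      (measurable_ker (by fun_prop) (by fun_prop)).mul
        (measurable_enorm_sub_sq ham ham (by fun_prop) (by fun_prop))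
    rw [lintegral_lintegral_swap (f := fun v u =>
        ker z.1 u * (ker z.2 v * ‖f (u, v) - f (z.1, v)‖ₑ ^ 2))
        ((mD z).comp measurable_swap).aemeasurable,
      ← lintegral_const_mul _ mA, ← lintegral_add_right _ (by fun_prop)]
    congr 1 with u
    rw [lintegral_const_mul' _ _ (ker_ne_top _ _),
      hf.lintegral_ker_diff_sq z.1 u z.2]
    ring
  have hR : ∀ z : ℍ × ℍ,
      ∫⁻ v, ∫⁻ u, ker z.1 u * (ker v z.2 * ‖f (u, z.2) - f (z.1, z.2)‖ₑ ^ 2)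
      = ballVol * ∫⁻ u, ker z.1 u * ‖f (u, z.2) - f z‖ₑ ^ 2 := by
    intro z
    have mB : Measurable fun u : ℍ => ker z.1 u * ‖f (u, z.2) - f (z.1, z.2)‖ₑ ^ 2 :=
      (measurable_ker (by fun_prop) (by fun_prop)).mul
        (measurable_enorm_sub_sq hfm hfm (by fun_prop) (by fun_prop))
    rw [← lintegral_ker z.2, ← lintegral_mul_const _ (by fun_prop)]
    congr 1 with v
    rw [ker_comm z.2 v, ← lintegral_const_mul _ mB]
    congr 1 with u
    ring
  simp_rw [hL, hR] at hswap
  have mC : Measurable fun z : ℍ × ℍ => ∫⁻ u, ker z.1 u *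
      ‖SL2Cocycle.avg f (u, z.2) - SL2Cocycle.avg f (z.1, z.2)‖ₑ ^ 2 :=
    Measurable.lintegral_prod_right' (f := fun q : (ℍ × ℍ) × ℍ =>
      ker q.1.1 q.2 * ‖SL2Cocycle.avg f (q.2, q.1.2)
        - SL2Cocycle.avg f (q.1.1, q.1.2)‖ₑ ^ 2)
      ((measurable_ker (by fun_prop) (by fun_prop)).mul
        (measurable_enorm_sub_sq ham ham (by fun_prop) (by fun_prop)))
  have mF : Measurable fun z : ℍ × ℍ => ∫⁻ u, ker z.1 u * ‖f (u, z.2) - f z‖ₑ ^ 2 :=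
    Measurable.lintegral_prod_right' (f := fun q : (ℍ × ℍ) × ℍ =>
      ker q.1.1 q.2 * ‖f (q.2, q.1.2) - f q.1‖ₑ ^ 2)
      ((measurable_ker (by fun_prop) (by fun_prop)).mul
        (measurable_enorm_sub_sq hfm hfm (by fun_prop) (by fun_prop)))
  rw [lintegral_weight_mul, ← lintegral_weight_add hφm mC] at hswap
  exact hswap

theorem IsField.energySnd_avg_le (hf : IsField ρ₁ ρ₂ π b f) (hφ : IsWeight ρ₁ ρ₂ φ) :
    energySnd φ (SL2Cocycle.avg f) ≤ energySnd φ f := by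
  set g := SL2Cocycle.avg f with hgdef
  have hg : IsField ρ₁ ρ₂ π b g := hf.avg
  set k := SL2Cocycle.avg g with hkdef
  have hk : IsField ρ₁ ρ₂ π b k := hg.avg
  have hfm := hf.meas
  have hgm := hg.meas
  have hkm := hk.meas
  have hφm := hφ.meas
  have mN : ∀ {p q : ℍ × ℍ → H}, StronglyMeasurable p → StronglyMeasurable q →
      Measurable fun z : ℍ × ℍ => ‖p z - q z‖ₑ ^ 2 := fun hp hq =>
    measurable_enorm_sub_sq hp hq measurable_id measurable_id
  -- energy of `f` in terms of the distance from `f` to its average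
  have h1 : energySnd φ f = (∫⁻ z, φ z * ∫⁻ w, ker z.2 w * ‖f (z.1, w) - g z‖ₑ ^ 2)
      + ballVol * ∫⁻ z, φ z * ‖g z - f z‖ₑ ^ 2 := by
    rw [lintegral_weight_add hφm (mN hgm hfm), energySnd]
    congr 1 with z
    rw [hf.lintegral_ker_sub_sq z (f z)]
  have h2 : energySnd φ g = (∫⁻ z, φ z * ∫⁻ w, ker z.2 w * ‖g (z.1, w) - k z‖ₑ ^ 2)
      + ballVol * ∫⁻ z, φ z * ‖k z - g z‖ₑ ^ 2 := by
    rw [lintegral_weight_add hφm (mN hkm hgm), energySnd]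
    congr 1 with z
    rw [hg.lintegral_ker_sub_sq z (g z)]
  have h3 : ∫⁻ z, φ z * ∫⁻ w, ker z.2 w * ‖f (z.1, w) - g z‖ₑ ^ 2
      = (∫⁻ z, φ z * ∫⁻ w, ker z.2 w * ‖g (z.1, w) - k z‖ₑ ^ 2)
        + ballVol * ∫⁻ z, φ z * ‖k z - f z‖ₑ ^ 2 := by
    have := hφ.lintegral_swap (Φ := fun z w v => ker w v * ‖f (z, v) - g (z, w)‖ₑ ^ 2)
      ((measurable_ker (by fun_prop) (by fun_prop)).mul
        (measurable_enorm_sub_sq hfm hgm (by fun_prop) (by fun_prop)))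
      (fun γ z w v => by simp only [ker_smul, hf.enorm_sub hg])
    rw [lintegral_weight_add hφm (mN hkm hfm)]
    refine this.trans ?_
    congr 1 with z
    have h := hg.lintegral_ker_sub_sq z (f z)
    have h' : ∫⁻ w, ker w z.2 * ‖f (z.1, z.2) - g (z.1, w)‖ₑ ^ 2
        = ∫⁻ w, ker z.2 w * ‖g (z.1, w) - f z‖ₑ ^ 2 := by
      congr 1 with w
      rw [ker_comm, enorm_sub_rev]
    rw [h', h]
  have h4 : ∫⁻ z, φ z * ‖k z - g z‖ₑ ^ 2 ≤ ∫⁻ z, φ z * ‖g z - f z‖ₑ ^ 2 := by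
    have hc := hg.sub hf
    have hcm := hc.meas
    have hav : ∀ z, SL2Cocycle.avg (g - f) z = k z - g z := by
      exact fun z => hg.avg_sub hf z
    have m0 : StronglyMeasurable (fun _ : ℍ × ℍ => (0 : H)) := stronglyMeasurable_const
    have hJ : ∀ z : ℍ × ℍ, ballVol * ‖k z - g z‖ₑ ^ 2
        ≤ ∫⁻ w, ker z.2 w * ‖(g - f) (z.1, w) - 0‖ₑ ^ 2 := by
      intro z
      rw [hc.lintegral_ker_sub_sq z 0, hav, sub_zero]
      exact le_add_self
    have hsw := hφ.lintegral_swap (Φ := fun z w v => ker w v * ‖(g - f) (z, v) - 0‖ₑ ^ 2)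
      ((measurable_ker (by fun_prop) (by fun_prop)).mul
        (measurable_enorm_sub_sq hcm m0 (v := fun _ => (I, I)) (by fun_prop) (by fun_prop)))
      (fun γ z w v => by
        simp only [ker_smul, hc.equiv, sub_zero, Pi.zero_apply, add_zero]
        congr 2
        exact (π γ).toLinearIsometry.enorm_map _)
    have hV := ballVol_ne_zero
    have hV' := ballVol_ne_top
    rw [← ENNReal.mul_le_mul_iff_right hV hV']
    calc ballVol * ∫⁻ z, φ z * ‖k z - g z‖ₑ ^ 2
        = ∫⁻ z, φ z * (ballVol * ‖k z - g z‖ₑ ^ 2) := lintegral_weight_mul.symm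
      _ ≤ ∫⁻ z, φ z * ∫⁻ w, ker z.2 w * ‖(g - f) (z.1, w) - 0‖ₑ ^ 2 := by
          gcongr with z
          exact hJ z
      _ = ∫⁻ z, φ z * ∫⁻ w, ker w z.2 * ‖(g - f) (z.1, z.2) - 0‖ₑ ^ 2 := hsw
      _ = ballVol * ∫⁻ z, φ z * ‖g z - f z‖ₑ ^ 2 := by
          rw [← lintegral_weight_mul]
          congr 1 with z
          simp_rw [ker_comm _ z.2]
          rw [lintegral_mul_const _ (by fun_prop), lintegral_ker, sub_zero]
          rfl
  rw [h1, h2, h3]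
  gcongr ?_ + ballVol * ?_
  exact le_self_add

end Energy

section Minimize

variable {Γ : Type*} [Group Γ] {H : Type*} [NormedAddCommGroup H] [InnerProductSpace ℝ H]
  {ρ₁ ρ₂ : Γ →* SL(2, ℝ)} {π : Γ → H ≃ₗᵢ[ℝ] H} {b : Γ → H} {f g : ℍ × ℍ → H}
  {φ : ℍ × ℍ → ℝ≥0∞}

/-- The total energy. -/
noncomputable def energy (φ : ℍ × ℍ → ℝ≥0∞) (f : ℍ × ℍ → H) : ℝ≥0∞ :=
  energyFst φ f + energySnd φ f

theorem enorm_parallelogram (a b : H) :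
    4 * ‖(2⁻¹ : ℝ) • (a + b)‖ₑ ^ 2 + ‖a - b‖ₑ ^ 2 = 2 * ‖a‖ₑ ^ 2 + 2 * ‖b‖ₑ ^ 2 := by
  have h := parallelogram_law_with_norm ℝ a b
  have e : ∀ v : H, ‖v‖ₑ = ENNReal.ofReal ‖v‖ := fun v => (ofReal_norm v).symm
  rw [e, e, e, e, norm_smul, show (4 : ℝ≥0∞) = ENNReal.ofReal 4 by simp,
    show (2 : ℝ≥0∞) = ENNReal.ofReal 2 by simp]
  simp only [← ENNReal.ofReal_pow (norm_nonneg _),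
    ← ENNReal.ofReal_pow (mul_nonneg (norm_nonneg (2⁻¹ : ℝ)) (norm_nonneg (a + b)))]
  rw [← ENNReal.ofReal_mul (by norm_num), ← ENNReal.ofReal_mul (by norm_num),
    ← ENNReal.ofReal_mul (by norm_num), ← ENNReal.ofReal_add (by positivity) (by positivity),
    ← ENNReal.ofReal_add (by positivity) (by positivity)]
  congr 1
  rw [show ‖(2⁻¹ : ℝ)‖ = 2⁻¹ by norm_num]
  linarith

theorem lintegral_parallelogram {φ : ℍ × ℍ → ℝ≥0∞} (hφ : Measurable φ) {k : ℍ × ℍ → ℍ → ℝ≥0∞}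
    (hk : Measurable fun p : (ℍ × ℍ) × ℍ => k p.1 p.2)
    {A B C D : ℍ × ℍ → ℍ → ℝ≥0∞} (hA : Measurable fun p : (ℍ × ℍ) × ℍ => A p.1 p.2)
    (hC : Measurable fun p : (ℍ × ℍ) × ℍ => C p.1 p.2)
    (hD : Measurable fun p : (ℍ × ℍ) × ℍ => D p.1 p.2)
    (h : ∀ z w, 4 * A z w + B z w = 2 * C z w + 2 * D z w) :
    4 * (∫⁻ z, φ z * ∫⁻ w, k z w * A z w) + (∫⁻ z, φ z * ∫⁻ w, k z w * B z w)
      = 2 * (∫⁻ z, φ z * ∫⁻ w, k z w * C z w) + 2 * (∫⁻ z, φ z * ∫⁻ w, k z w * D z w) := by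
  have m : ∀ {F : ℍ × ℍ → ℍ → ℝ≥0∞}, (Measurable fun p : (ℍ × ℍ) × ℍ => F p.1 p.2) →
      Measurable fun z => φ z * ∫⁻ w, k z w * F z w := fun {F} hF =>
    hφ.mul (Measurable.lintegral_prod_right' (f := fun p : (ℍ × ℍ) × ℍ => k p.1 p.2 * F p.1 p.2)
      (hk.mul hF))
  have m' : ∀ {F : ℍ × ℍ → ℍ → ℝ≥0∞}, (Measurable fun p : (ℍ × ℍ) × ℍ => F p.1 p.2) →
      ∀ z, Measurable fun w => k z w * F z w := fun {F} hF z =>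
    (hk.mul hF).comp (f := fun w : ℍ => (z, w)) (by fun_prop)
  rw [← lintegral_const_mul _ (m hA), ← lintegral_const_mul _ (m hC),
    ← lintegral_const_mul _ (m hD), ← lintegral_add_left ((m hA).const_mul _),
    ← lintegral_add_left ((m hC).const_mul _)]
  congr 1 with z
  have e : 4 * (∫⁻ w, k z w * A z w) + ∫⁻ w, k z w * B z w
      = 2 * (∫⁻ w, k z w * C z w) + 2 * ∫⁻ w, k z w * D z w := by
    rw [← lintegral_const_mul _ (m' hA z), ← lintegral_const_mul _ (m' hC z),
      ← lintegral_const_mul _ (m' hD z), ← lintegral_add_left ((m' hA z).const_mul _),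
      ← lintegral_add_left ((m' hC z).const_mul _)]
    congr 1 with w
    calc _ = k z w * (4 * A z w + B z w) := by ring
      _ = _ := by rw [h]; ring
  calc _ = φ z * (4 * (∫⁻ w, k z w * A z w) + ∫⁻ w, k z w * B z w) := by ring
    _ = _ := by rw [e]; ring

theorem energy_parallelogram (hφ : Measurable φ) (hf : StronglyMeasurable f)
    (hg : StronglyMeasurable g) :
    4 * energy φ ((2⁻¹ : ℝ) • (f + g)) + energy φ (f - g) = 2 * energy φ f + 2 * energy φ g := by
  have hm : StronglyMeasurable ((2⁻¹ : ℝ) • (f + g)) := (hf.add hg).const_smul _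
  have alg : ∀ z w, 4 * ‖((2⁻¹ : ℝ) • (f + g)) w - ((2⁻¹ : ℝ) • (f + g)) z‖ₑ ^ 2
      + ‖(f - g) w - (f - g) z‖ₑ ^ 2 = 2 * ‖f w - f z‖ₑ ^ 2 + 2 * ‖g w - g z‖ₑ ^ 2 := by
    intro z w
    have e1 : ((2⁻¹ : ℝ) • (f + g)) w - ((2⁻¹ : ℝ) • (f + g)) z
        = (2⁻¹ : ℝ) • ((f w - f z) + (g w - g z)) := by
      simp only [Pi.smul_apply, Pi.add_apply, ← smul_sub]
      congr 1
      abel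
    have e2 : (f - g) w - (f - g) z = (f w - f z) - (g w - g z) := by
      simp only [Pi.sub_apply]
      abel
    rw [← enorm_parallelogram, e1, e2]
  have h1 := lintegral_parallelogram hφ (k := fun z w => ker z.1 w)
    (measurable_ker (by fun_prop) (by fun_prop))
    (A := fun z w => ‖((2⁻¹ : ℝ) • (f + g)) (w, z.2) - ((2⁻¹ : ℝ) • (f + g)) z‖ₑ ^ 2)
    (B := fun z w => ‖(f - g) (w, z.2) - (f - g) z‖ₑ ^ 2)
    (C := fun z w => ‖f (w, z.2) - f z‖ₑ ^ 2) (D := fun z w => ‖g (w, z.2) - g z‖ₑ ^ 2)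
    (measurable_enorm_sub_sq hm hm (by fun_prop) (by fun_prop))
    (measurable_enorm_sub_sq hf hf (by fun_prop) (by fun_prop))
    (measurable_enorm_sub_sq hg hg (by fun_prop) (by fun_prop)) (fun z w => alg z _)
  have h2 := lintegral_parallelogram hφ (k := fun z w => ker z.2 w)
    (measurable_ker (by fun_prop) (by fun_prop))
    (A := fun z w => ‖((2⁻¹ : ℝ) • (f + g)) (z.1, w) - ((2⁻¹ : ℝ) • (f + g)) z‖ₑ ^ 2)
    (B := fun z w => ‖(f - g) (z.1, w) - (f - g) z‖ₑ ^ 2)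
    (C := fun z w => ‖f (z.1, w) - f z‖ₑ ^ 2) (D := fun z w => ‖g (z.1, w) - g z‖ₑ ^ 2)
    (measurable_enorm_sub_sq hm hm (by fun_prop) (by fun_prop))
    (measurable_enorm_sub_sq hf hf (by fun_prop) (by fun_prop))
    (measurable_enorm_sub_sq hg hg (by fun_prop) (by fun_prop)) (fun z w => alg z _)
  unfold energy energyFst energySnd
  rw [mul_add, add_add_add_comm]
  refine (congrArg₂ (· + ·) h1 h2).trans ?_
  ring

/-- A minimizing sequence for the energy is Cauchy for the energy and its mixed variances tend
to zero. -/
theorem exists_minimizing_sequence [CompleteSpace H] [Countable Γ] (hφ : IsWeight ρ₁ ρ₂ φ)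
    (hf : IsField ρ₁ ρ₂ π b f) (hE : energy φ f ≠ ∞) :
    ∃ F : ℕ → ℍ × ℍ → H, (∀ n, IsField ρ₁ ρ₂ π b (F n)) ∧
      (∀ n m : ℕ, energy φ (F n - F m) ≤ 2 * ((n + 1 : ℝ≥0∞)⁻¹ + (m + 1 : ℝ≥0∞)⁻¹)) ∧
      (∀ n : ℕ, mixedVar φ (F n) ≤ ballVol * (n + 1 : ℝ≥0∞)⁻¹) ∧
      ∃ B : ℝ≥0∞, B ≠ ∞ ∧ ∀ n, energy φ (F n) ≤ B := by
  set e : ℝ≥0∞ := ⨅ g : {g : ℍ × ℍ → H // IsField ρ₁ ρ₂ π b g}, energy φ g.1 with he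
  have hle : ∀ g, IsField ρ₁ ρ₂ π b g → e ≤ energy φ g := fun g hg =>
    iInf_le (fun g : {g : ℍ × ℍ → H // IsField ρ₁ ρ₂ π b g} => energy φ g.1) ⟨g, hg⟩
  have hetop : e ≠ ∞ := ne_top_of_le_ne_top hE (hle f hf)
  have hex : ∀ n : ℕ, ∃ g, IsField ρ₁ ρ₂ π b g ∧ energy φ g ≤ e + (n + 1 : ℝ≥0∞)⁻¹ := by
    intro n
    have hlt : e < e + (n + 1 : ℝ≥0∞)⁻¹ :=
      ENNReal.lt_add_right hetop (ENNReal.inv_ne_zero.2 (by finiteness))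
    obtain ⟨g, hg⟩ := iInf_lt_iff.1 hlt
    exact ⟨g.1, g.2, hg.le⟩
  choose F hF hFe using hex
  refine ⟨F, hF, fun n m => ?_, fun n => ?_, e + 1, by finiteness, fun n => ?_⟩
  · have h := energy_parallelogram hφ.meas (hF n).meas (hF m).meas
    have h4 : 4 * e ≠ ∞ := by finiteness
    refine (ENNReal.add_le_add_iff_left h4).1 ?_
    calc 4 * e + energy φ (F n - F m)
        ≤ 4 * energy φ ((2⁻¹ : ℝ) • (F n + F m)) + energy φ (F n - F m) := by
          gcongr
          exact hle _ ((hF n).midpoint (hF m))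
      _ = 2 * energy φ (F n) + 2 * energy φ (F m) := h
      _ ≤ 2 * (e + (n + 1 : ℝ≥0∞)⁻¹) + 2 * (e + (m + 1 : ℝ≥0∞)⁻¹) := by
          gcongr
          · exact hFe n
          · exact hFe m
      _ = _ := by ring
  · have h1 := (hF n).mixedVar_add_energyFst_avg hφ
    have h2 := (hF n).energySnd_avg_le hφ
    have h3 := hle _ (hF n).avg
    have hVe : ballVol * e ≠ ∞ := ENNReal.mul_ne_top ballVol_ne_top hetop
    refine (ENNReal.add_le_add_iff_left hVe).1 ?_
    calc ballVol * e + mixedVar φ (F n)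
        ≤ ballVol * energy φ (avg (F n)) + mixedVar φ (F n) := by gcongr
      _ = (mixedVar φ (F n) + ballVol * energyFst φ (avg (F n)))
          + ballVol * energySnd φ (avg (F n)) := by rw [energy]; ring
      _ ≤ ballVol * energyFst φ (F n) + ballVol * energySnd φ (F n) := by rw [h1]; gcongr
      _ = ballVol * energy φ (F n) := by rw [energy]; ring
      _ ≤ ballVol * (e + (n + 1 : ℝ≥0∞)⁻¹) := by gcongr; exact hFe n
      _ = _ := by ring
  · refine (hFe n).trans ?_
    gcongr
    exact ENNReal.inv_le_one.2 le_add_self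

end Minimize

section LocallyBounded

variable {H : Type*} [NormedAddCommGroup H] {p q : ℍ → H}

/-- Strongly measurable functions on `ℍ` which are bounded on bounded sets. -/
structure IsLocBdd (p : ℍ → H) : Prop where
  meas : StronglyMeasurable p
  bdd : ∀ r : ℝ, ∃ C : ℝ, ∀ z : ℍ, dist z I ≤ r → ‖p z‖ ≤ C

/-- The volume of a hyperbolic ball of radius `1`. -/
noncomputable def unitVol : ℝ≥0∞ := volume (ball UpperHalfPlane.I 1)

theorem unitVol_eq (z : ℍ) : volume (ball z 1) = unitVol := measure_ball_eq _ _ _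

theorem unitVol_ne_zero : unitVol ≠ 0 := (measure_ball_pos _ _ (by norm_num)).ne'

theorem unitVol_ne_top : unitVol ≠ ∞ := measure_ball_lt_top.ne

theorem IsLocBdd.sub (hp : IsLocBdd p) (hq : IsLocBdd q) : IsLocBdd (p - q) where
  meas := hp.meas.sub hq.meas
  bdd r := by
    obtain ⟨C, hC⟩ := hp.bdd r
    obtain ⟨D, hD⟩ := hq.bdd r
    exact ⟨C + D, fun z hz => (norm_sub_le _ _).trans (add_le_add (hC z hz) (hD z hz))⟩

theorem IsLocBdd.bdd_ball (hp : IsLocBdd p) (z : ℍ) (r : ℝ) :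
    ∃ C : ℝ, ∀ u ∈ ball z r, ‖p u‖ ≤ C := by
  obtain ⟨C, hC⟩ := hp.bdd (r + dist z I)
  refine ⟨C, fun u hu => hC u ?_⟩
  have := dist_triangle u z I
  have := mem_ball.1 hu
  linarith

theorem IsLocBdd.integrableOn (hp : IsLocBdd p) (z : ℍ) (r : ℝ) : IntegrableOn p (ball z r) := by
  obtain ⟨C, hC⟩ := hp.bdd_ball z r
  refine Measure.integrableOn_of_bounded (M := C) measure_ball_lt_top.ne
    hp.meas.aestronglyMeasurable ?_
  filter_upwards [ae_restrict_mem measurableSet_ball] with v hv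
  exact hC v hv

variable [InnerProductSpace ℝ H]

/-- The average of `p` over the unit ball around `z`. -/
noncomputable def ballAvg (p : ℍ → H) (z : ℍ) : H := ⨍ w in ball z 1, p w

theorem IsLocBdd.ballAvg_sub (hp : IsLocBdd p) (hq : IsLocBdd q) (z : ℍ) :
    ballAvg (p - q) z = ballAvg p z - ballAvg q z := by
  simp only [ballAvg, setAverage_eq, ← smul_sub]
  congr 1
  exact integral_sub (hp.integrableOn z 1) (hq.integrableOn z 1)

variable [CompleteSpace H]

theorem IsLocBdd.mul_enorm_ballAvg_sub_sq_le (hp : IsLocBdd p) (z : ℍ) (c : H) :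
    unitVol * ‖ballAvg p z - c‖ₑ ^ 2 ≤ ∫⁻ u in ball z 1, ‖p u - c‖ₑ ^ 2 := by
  obtain ⟨C, hC⟩ := hp.bdd_ball z 1
  have : IsFiniteMeasure (volume.restrict (ball z 1)) := ⟨by simpa using measure_ball_lt_top⟩
  rw [lintegral_enorm_sub_sq_eq (C := C) (hp.integrableOn z 1).aestronglyMeasurable ?_ c]
  · simp [ballAvg, unitVol_eq]
  · filter_upwards [ae_restrict_mem measurableSet_ball] with w hw
    exact hC w hw

theorem IsLocBdd.mul_enorm_ballAvg_sub_ballAvg_sq_le (hp : IsLocBdd p) (z w : ℍ) :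
    unitVol ^ 2 * ‖ballAvg p w - ballAvg p z‖ₑ ^ 2
      ≤ ∫⁻ v in ball z 1, ∫⁻ u in ball w 1, ‖p u - p v‖ₑ ^ 2 := by
  calc unitVol ^ 2 * ‖ballAvg p w - ballAvg p z‖ₑ ^ 2
      = unitVol * (unitVol * ‖ballAvg p z - ballAvg p w‖ₑ ^ 2) := by rw [enorm_sub_rev]; ring
    _ ≤ unitVol * ∫⁻ v in ball z 1, ‖p v - ballAvg p w‖ₑ ^ 2 := by
        gcongr
        exact hp.mul_enorm_ballAvg_sub_sq_le z _
    _ = ∫⁻ v in ball z 1, unitVol * ‖ballAvg p w - p v‖ₑ ^ 2 := by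
        rw [← lintegral_const_mul' _ _ unitVol_ne_top]
        simp_rw [enorm_sub_rev]
    _ ≤ _ := by
        gcongr with v
        exact hp.mul_enorm_ballAvg_sub_sq_le w _

end LocallyBounded

section Smooth

variable {Γ : Type*} [Group Γ] {H : Type*} [NormedAddCommGroup H] [InnerProductSpace ℝ H]
  {ρ₁ ρ₂ : Γ →* SL(2, ℝ)} {π : Γ → H ≃ₗᵢ[ℝ] H} {b : Γ → H} {f g : ℍ × ℍ → H}
  {φ : ℍ × ℍ → ℝ≥0∞}

/-- The iterated average of `f` over unit balls in both coordinates. -/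
noncomputable def smooth (f : ℍ × ℍ → H) (z : ℍ × ℍ) : H :=
  ballAvg (fun v => ballAvg (fun u => f (u, v)) z.1) z.2

theorem IsField.isLocBdd_fst (hf : IsField ρ₁ ρ₂ π b f) (v : ℍ) :
    IsLocBdd fun u => f (u, v) where
  meas := hf.meas.comp_measurable (by fun_prop)
  bdd r := by
    obtain ⟨C, hC⟩ := hf.bdd (max r (dist v I))
    exact ⟨C, fun z hz => hC z v (hz.trans (le_max_left _ _)) (le_max_right _ _)⟩

theorem IsField.isLocBdd_ballAvg [CompleteSpace H] (hf : IsField ρ₁ ρ₂ π b f) (z : ℍ) :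
    IsLocBdd fun v => ballAvg (fun u => f (u, v)) z where
  meas := by
    simp only [ballAvg, setAverage_eq]
    refine StronglyMeasurable.const_smul (StronglyMeasurable.integral_prod_right
      (f := fun v u : ℍ => f (u, v)) (ν := volume.restrict (ball z 1)) ?_) _
    exact hf.meas.comp_measurable measurable_swap
  bdd r := by
    obtain ⟨C, hC⟩ := hf.bdd (max r (dist z I + 1))
    refine ⟨C, fun v hv => ?_⟩
    have hb : ∀ u ∈ ball z 1, ‖f (u, v)‖ ≤ C := fun u hu =>
      hC u v (le_trans (by
        have := dist_triangle u z I
        have := mem_ball.1 hu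
        linarith) (le_max_right _ _)) (hv.trans (le_max_left _ _))
    have hn := norm_setIntegral_le_of_norm_le_const (μ := volume) (f := fun u => f (u, v))
      (measure_ball_lt_top (x := z) (r := 1)) hb
    have hV : 0 < volume.real (ball z 1) :=
      ENNReal.toReal_pos (measure_ball_pos _ _ (by norm_num)).ne' measure_ball_lt_top.ne
    rw [ballAvg, setAverage_eq, norm_smul, norm_inv, Real.norm_of_nonneg hV.le]
    rwa [inv_mul_le_iff₀ hV, mul_comm]

theorem IsField.smooth_sub [CompleteSpace H] {b' : Γ → H} (hf : IsField ρ₁ ρ₂ π b f)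
    (hg : IsField ρ₁ ρ₂ π b' g) (z : ℍ × ℍ) : smooth (f - g) z = smooth f z - smooth g z := by
  have h : (fun v => ballAvg (fun u => (f - g) (u, v)) z.1)
      = (fun v => ballAvg (fun u => f (u, v)) z.1) - fun v => ballAvg (fun u => g (u, v)) z.1 := by
    ext v
    exact (hf.isLocBdd_fst v).ballAvg_sub (hg.isLocBdd_fst v) z.1
  rw [smooth, h, (hf.isLocBdd_ballAvg z.1).ballAvg_sub (hg.isLocBdd_ballAvg z.1)]
  rfl

theorem ballAvg_smul_affine [CompleteSpace H] (g : SL(2, ℝ)) (A : H ≃ₗᵢ[ℝ] H) (c : H)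
    {p q : ℍ → H} (hp : IsLocBdd p) (h : ∀ z, q (g • z) = A (p z) + c) (z : ℍ) :
    ballAvg q (g • z) = A (ballAvg p z) + c := by
  have hV : 0 < volume.real (ball z 1) :=
    ENNReal.toReal_pos (measure_ball_pos _ _ (by norm_num)).ne' measure_ball_lt_top.ne
  simp only [ballAvg]
  rw [setAverage_ball_smul]
  simp only [h]
  rw [setAverage_eq, integral_add, setIntegral_const, smul_add, smul_smul,
    inv_mul_cancel₀ hV.ne', one_smul, setAverage_eq, map_smul]
  · congr 2
    exact A.toContinuousLinearEquiv.integral_comp_comm _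
  · exact A.toContinuousLinearEquiv.toContinuousLinearMap.integrable_comp (hp.integrableOn z 1)
  · exact integrableOn_const measure_ball_lt_top.ne

theorem IsField.smooth_equiv [CompleteSpace H] (hf : IsField ρ₁ ρ₂ π b f) (γ : Γ) (z w : ℍ) :
    smooth f (ρ₁ γ • z, ρ₂ γ • w) = π γ (smooth f (z, w)) + b γ := by
  refine ballAvg_smul_affine (ρ₂ γ) (π γ) (b γ) (hf.isLocBdd_ballAvg z) (fun v => ?_) w
  exact ballAvg_smul_affine (ρ₁ γ) (π γ) (b γ) (hf.isLocBdd_fst v) (fun u => hf.equiv γ u v) z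

/-- Properness of the action of `Γ` on `ℍ × ℍ`. -/
def IsProper (ρ₁ ρ₂ : Γ →* SL(2, ℝ)) : Prop :=
  ∀ r : ℝ, {γ | ∃ z w : ℍ, dist z I ≤ r ∧ dist w I ≤ r ∧ dist (ρ₁ γ • z) I ≤ r ∧
    dist (ρ₂ γ • w) I ≤ r}.Finite

theorem IsProper.exists_lintegral_le [Countable Γ] (hρ : IsProper ρ₁ ρ₂)
    (hφ : IsWeight ρ₁ ρ₂ φ) (r : ℝ) :
    ∃ N : ℝ≥0∞, N ≠ ∞ ∧ ∀ G : ℍ × ℍ → ℝ≥0∞, Measurable G →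
      (∀ γ z w, G (ρ₁ γ • z, ρ₂ γ • w) = G (z, w)) →
      ∫⁻ z in closedBall I r ×ˢ closedBall I r, G z ≤ N * ∫⁻ z, φ z * G z := by
  classical
  set S := (hρ r).toFinset with hS
  set Q : Set (ℍ × ℍ) := closedBall I r ×ˢ closedBall I r with hQ
  have hQm : MeasurableSet Q := measurableSet_closedBall.prod measurableSet_closedBall
  refine ⟨S.card, by finiteness, fun G hG hGinv => ?_⟩
  let T : Γ → ℍ × ℍ → ℍ × ℍ := fun γ p => (ρ₁ γ • p.1, ρ₂ γ • p.2)
  have hcount : ∀ y, ∑' γ, Q.indicator (fun _ => (1 : ℝ≥0∞)) (T γ y) ≤ S.card := by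
    intro y
    by_cases hne : ∃ γ₀, T γ₀ y ∈ Q
    · obtain ⟨γ₀, h₀⟩ := hne
      calc ∑' γ, Q.indicator (fun _ => (1 : ℝ≥0∞)) (T γ y)
          = ∑' δ, Q.indicator (fun _ => (1 : ℝ≥0∞)) (T (δ * γ₀) y) :=
            ((Equiv.mulRight γ₀).tsum_eq fun γ => Q.indicator (fun _ => (1 : ℝ≥0∞)) (T γ y)).symm
        _ ≤ ∑' δ, if δ ∈ S then 1 else 0 := by
            refine ENNReal.tsum_le_tsum fun δ => ?_
            by_cases hδ : T (δ * γ₀) y ∈ Q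
            · have : δ ∈ S := by
                rw [hS, Set.Finite.mem_toFinset]
                refine ⟨ρ₁ γ₀ • y.1, ρ₂ γ₀ • y.2, h₀.1, h₀.2, ?_, ?_⟩
                · have := hδ.1
                  simpa [T, mul_smul] using this
                · have := hδ.2
                  simpa [T, mul_smul] using this
              simp [this, hδ]
            · simp [hδ]
        _ = S.card := by
            rw [tsum_eq_sum (s := S) (fun δ hδ => by simp [hδ])]
            simp
    · push Not at hne
      simp [hne]
  have h := lintegral_mul_le_of_tsum_le (μ := (volume : Measure (ℍ × ℍ))) (T := T)
    (fun γ => (measurePreserving_smul (ρ₁ γ) volume).prod (measurePreserving_smul (ρ₂ γ) volume))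
    (by intro γ y; simp [T]) hφ.meas (q := Q.indicator fun _ => 1)
    (measurable_const.indicator hQm) hG (fun γ y => hGinv γ y.1 y.2)
    (fun y => hφ.tsum_eq _ _) hcount
  refine le_trans (le_of_eq ?_) h
  rw [← lintegral_indicator hQm]
  congr 1 with z
  by_cases hz : z ∈ Q <;> simp [hz]

end Smooth

section Increments

theorem enorm_sub_sq_le {H : Type*} [NormedAddCommGroup H] (x y z : H) :
    ‖x - y‖ₑ ^ 2 ≤ 2 * ‖x - z‖ₑ ^ 2 + 2 * ‖y - z‖ₑ ^ 2 := by
  have h : ‖x - y‖ ^ 2 ≤ 2 * ‖x - z‖ ^ 2 + 2 * ‖y - z‖ ^ 2 := by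
    have := norm_sub_le (x - z) (y - z)
    rw [sub_sub_sub_cancel_right] at this
    nlinarith [sq_nonneg (‖x - z‖ - ‖y - z‖), norm_nonneg (x - y)]
  simp only [← ofReal_norm, ← ENNReal.ofReal_pow (norm_nonneg _)]
  rw [← ENNReal.ofReal_ofNat, ← ENNReal.ofReal_mul (by norm_num),
    ← ENNReal.ofReal_mul (by norm_num), ← ENNReal.ofReal_add (by positivity) (by positivity)]
  exact ENNReal.ofReal_le_ofReal h

variable {Γ : Type*} [Group Γ] {H : Type*} [NormedAddCommGroup H] [InnerProductSpace ℝ H]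
  {ρ₁ ρ₂ : Γ →* SL(2, ℝ)} {π : Γ → H ≃ₗᵢ[ℝ] H} {b : Γ → H} {f g : ℍ × ℍ → H}
  {φ : ℍ × ℍ → ℝ≥0∞}

theorem setLIntegral_ball_le_ker {z w a : ℍ} (hw : dist w z < 1) (ha : a ∈ ball z 1)
    (F : ℍ → ℝ≥0∞) : ∫⁻ u in ball w 1, F u ≤ ∫⁻ u, ker a u * F u := by
  rw [lintegral_ker_mul]
  refine lintegral_mono_set fun u hu => ?_
  rw [mem_ball] at *
  have h1 := dist_triangle4 u w z a
  rw [dist_comm z a] at h1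
  linarith

theorem setLIntegral_prod_closedBall {G : ℍ × ℍ → ℝ≥0∞} (hG : Measurable G) {z w : ℍ} {r : ℝ}
    (hz : dist z I ≤ r) (hw : dist w I ≤ r) :
    ∫⁻ v in ball w 1, ∫⁻ a in ball z 1, G (a, v)
      ≤ ∫⁻ y in closedBall I (r + 1) ×ˢ closedBall I (r + 1), G y := by
  calc ∫⁻ v in ball w 1, ∫⁻ a in ball z 1, G (a, v)
      = ∫⁻ y in ball z 1 ×ˢ ball w 1, G y := by
        rw [Measure.volume_eq_prod, ← Measure.prod_restrict, lintegral_prod_symm' _ hG]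
    _ ≤ _ := by
        refine lintegral_mono_set (Set.prod_mono ?_ ?_)
        · exact (ball_subset_ball' (by linarith)).trans ball_subset_closedBall
        · exact (ball_subset_ball' (by linarith)).trans ball_subset_closedBall

theorem IsField.measurable_density_fst (hf : IsField ρ₁ ρ₂ π b f) :
    Measurable fun z : ℍ × ℍ => ∫⁻ u, ker z.1 u * ‖f (u, z.2) - f z‖ₑ ^ 2 :=
  Measurable.lintegral_prod_right' (f := fun q : (ℍ × ℍ) × ℍ =>
      ker q.1.1 q.2 * ‖f (q.2, q.1.2) - f q.1‖ₑ ^ 2)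
      ((measurable_ker (by fun_prop) (by fun_prop)).mul
        (measurable_enorm_sub_sq hf.meas hf.meas (by fun_prop) (by fun_prop)))

theorem IsField.measurable_density_snd (hf : IsField ρ₁ ρ₂ π b f) :
    Measurable fun z : ℍ × ℍ => ∫⁻ u, ker z.2 u * ‖f (z.1, u) - f z‖ₑ ^ 2 :=
  Measurable.lintegral_prod_right' (f := fun q : (ℍ × ℍ) × ℍ =>
      ker q.1.2 q.2 * ‖f (q.1.1, q.2) - f q.1‖ₑ ^ 2)
      ((measurable_ker (by fun_prop) (by fun_prop)).mul
        (measurable_enorm_sub_sq hf.meas hf.meas (by fun_prop) (by fun_prop)))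

variable [CompleteSpace H]

theorem IsField.smooth_sub_fst_le (hf : IsField ρ₁ ρ₂ π b f) {z w : ℍ} (hw : dist w z < 1)
    (c : ℍ) : unitVol ^ 3 * ‖smooth f (w, c) - smooth f (z, c)‖ₑ ^ 2
      ≤ ∫⁻ v in ball c 1, ∫⁻ a in ball z 1, ∫⁻ u, ker a u * ‖f (u, v) - f (a, v)‖ₑ ^ 2 := by
  have h1 := ((hf.isLocBdd_ballAvg w).sub (hf.isLocBdd_ballAvg z)).mul_enorm_ballAvg_sub_sq_le c 0
  rw [(hf.isLocBdd_ballAvg w).ballAvg_sub (hf.isLocBdd_ballAvg z)] at h1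
  simp only [sub_zero, Pi.sub_apply] at h1
  calc unitVol ^ 3 * ‖smooth f (w, c) - smooth f (z, c)‖ₑ ^ 2
      = unitVol ^ 2 * (unitVol * ‖smooth f (w, c) - smooth f (z, c)‖ₑ ^ 2) := by ring
    _ ≤ unitVol ^ 2 * _ := mul_le_mul_right h1 _
    _ = ∫⁻ v in ball c 1, unitVol ^ 2 *
          ‖ballAvg (fun u => f (u, v)) w - ballAvg (fun u => f (u, v)) z‖ₑ ^ 2 := by
        rw [lintegral_const_mul' _ _ (ENNReal.pow_ne_top unitVol_ne_top)]
    _ ≤ ∫⁻ v in ball c 1, ∫⁻ a in ball z 1, ∫⁻ u in ball w 1, ‖f (u, v) - f (a, v)‖ₑ ^ 2 :=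
        lintegral_mono fun v => (hf.isLocBdd_fst v).mul_enorm_ballAvg_sub_ballAvg_sq_le z w
    _ ≤ _ := lintegral_mono fun v => setLIntegral_mono' measurableSet_ball fun a ha =>
        setLIntegral_ball_le_ker hw ha _

theorem IsField.smooth_sub_snd_le (hf : IsField ρ₁ ρ₂ π b f) {z w : ℍ} (hw : dist w z < 1)
    (c : ℍ) : unitVol ^ 3 * ‖smooth f (c, w) - smooth f (c, z)‖ₑ ^ 2
      ≤ ∫⁻ v in ball z 1, ∫⁻ a in ball c 1, ∫⁻ u, ker v u * ‖f (a, u) - f (a, v)‖ₑ ^ 2 := by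
  have hfm := hf.meas
  have h1 := (hf.isLocBdd_ballAvg c).mul_enorm_ballAvg_sub_ballAvg_sq_le z w
  have h2 : ∀ u v : ℍ, unitVol *
      ‖ballAvg (fun a => f (a, u)) c - ballAvg (fun a => f (a, v)) c‖ₑ ^ 2
      ≤ ∫⁻ a in ball c 1, ‖f (a, u) - f (a, v)‖ₑ ^ 2 := by
    intro u v
    have h := ((hf.isLocBdd_fst u).sub (hf.isLocBdd_fst v)).mul_enorm_ballAvg_sub_sq_le c 0
    rw [(hf.isLocBdd_fst u).ballAvg_sub (hf.isLocBdd_fst v)] at h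
    simpa only [sub_zero, Pi.sub_apply] using h
  calc unitVol ^ 3 * ‖smooth f (c, w) - smooth f (c, z)‖ₑ ^ 2
      = unitVol * (unitVol ^ 2 * ‖smooth f (c, w) - smooth f (c, z)‖ₑ ^ 2) := by ring
    _ ≤ unitVol * _ := mul_le_mul_right h1 _
    _ = ∫⁻ v in ball z 1, ∫⁻ u in ball w 1, unitVol *
          ‖ballAvg (fun a => f (a, u)) c - ballAvg (fun a => f (a, v)) c‖ₑ ^ 2 := by
        simp_rw [lintegral_const_mul' _ _ unitVol_ne_top]
    _ ≤ ∫⁻ v in ball z 1, ∫⁻ u in ball w 1, ∫⁻ a in ball c 1, ‖f (a, u) - f (a, v)‖ₑ ^ 2 :=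
        lintegral_mono fun v => lintegral_mono fun u => h2 u v
    _ = ∫⁻ v in ball z 1, ∫⁻ a in ball c 1, ∫⁻ u in ball w 1, ‖f (a, u) - f (a, v)‖ₑ ^ 2 := by
        congr 1 with v
        refine lintegral_lintegral_swap (f := fun u a => ‖f (a, u) - f (a, v)‖ₑ ^ 2)
          (Measurable.aemeasurable ?_)
        exact measurable_enorm_sub_sq hfm hfm (u := fun p : ℍ × ℍ => (p.2, p.1))
          (v := fun p : ℍ × ℍ => (p.2, v)) (by fun_prop) (by fun_prop)
    _ ≤ _ := setLIntegral_mono' measurableSet_ball fun v hv => lintegral_mono fun a =>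
        setLIntegral_ball_le_ker hw hv _

/-- The integrand of `mixedVar`. -/
noncomputable def mixedDensity (f : ℍ × ℍ → H) (z : ℍ × ℍ) : ℝ≥0∞ :=
  ∫⁻ w, ker z.1 w * ∫⁻ v, ker z.2 v *
    ‖(f (w, v) - f (z.1, v)) - (avg f (w, z.2) - avg f (z.1, z.2))‖ₑ ^ 2

theorem IsField.measurable_mixedDensity (hf : IsField ρ₁ ρ₂ π b f) :
    Measurable (mixedDensity f) := by
  have hfm := hf.meas
  have ham := hf.avg.meas
  have hD : Measurable fun p : (((ℍ × ℍ) × ℍ) × ℍ) =>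
      ‖(f (p.1.2, p.2) - f (p.1.1.1, p.2))
        - (SL2Cocycle.avg f (p.1.2, p.1.1.2) - SL2Cocycle.avg f (p.1.1.1, p.1.1.2))‖ₑ ^ 2 :=
    (((hfm.comp_measurable (g := fun p : (((ℍ × ℍ) × ℍ) × ℍ) => (p.1.2, p.2)) (by fun_prop)).sub
      (hfm.comp_measurable (g := fun p : (((ℍ × ℍ) × ℍ) × ℍ) => (p.1.1.1, p.2))
        (by fun_prop))).sub
      ((ham.comp_measurable (g := fun p : (((ℍ × ℍ) × ℍ) × ℍ) => (p.1.2, p.1.1.2))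
        (by fun_prop)).sub
      (ham.comp_measurable (g := fun p : (((ℍ × ℍ) × ℍ) × ℍ) => (p.1.1.1, p.1.1.2))
        (by fun_prop)))).enorm.pow_const 2
  refine Measurable.lintegral_prod_right' (f := fun q : (ℍ × ℍ) × ℍ =>
    ker q.1.1 q.2 * ∫⁻ v, ker q.1.2 v * ‖(f (q.2, v) - f (q.1.1, v))
      - (SL2Cocycle.avg f (q.2, q.1.2) - SL2Cocycle.avg f (q.1.1, q.1.2))‖ₑ ^ 2) ?_
  refine (measurable_ker (by fun_prop) (by fun_prop)).mul ?_
  exact Measurable.lintegral_prod_right' (f := fun p : (((ℍ × ℍ) × ℍ) × ℍ) =>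
      ker p.1.1.2 p.2 * ‖(f (p.1.2, p.2) - f (p.1.1.1, p.2))
        - (SL2Cocycle.avg f (p.1.2, p.1.1.2) - SL2Cocycle.avg f (p.1.1.1, p.1.1.2))‖ₑ ^ 2)
      ((measurable_ker (by fun_prop) (by fun_prop)).mul hD)

theorem IsField.smooth_sub_sub_avg_le (hf : IsField ρ₁ ρ₂ π b f) {z w z' w' c : ℍ}
    (hw : dist w z < 1) (hw' : dist w' z' < 1) (hc : c ∈ ball z' 1) :
    unitVol ^ 3 * ‖(smooth f (w, w') - smooth f (z, w')) -
      (ballAvg (fun u => SL2Cocycle.avg f (u, c)) w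
        - ballAvg (fun u => SL2Cocycle.avg f (u, c)) z)‖ₑ ^ 2
      ≤ ∫⁻ a in ball z 1, mixedDensity f (a, c) := by
  have hfm := hf.meas
  have ham := hf.avg.meas
  set e := ballAvg (fun u => SL2Cocycle.avg f (u, c)) w
    - ballAvg (fun u => SL2Cocycle.avg f (u, c)) z with he
  have h1 := ((hf.isLocBdd_ballAvg w).sub (hf.isLocBdd_ballAvg z)).mul_enorm_ballAvg_sub_sq_le w' e
  rw [(hf.isLocBdd_ballAvg w).ballAvg_sub (hf.isLocBdd_ballAvg z)] at h1
  simp only [Pi.sub_apply] at h1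
  have h2 : ∀ v : ℍ, unitVol ^ 2 *
      ‖(ballAvg (fun a => f (a, v)) w - ballAvg (fun a => f (a, v)) z) - e‖ₑ ^ 2
      ≤ ∫⁻ a in ball z 1, ∫⁻ u in ball w 1, ‖(f (u, v) - f (a, v))
        - (SL2Cocycle.avg f (u, c) - SL2Cocycle.avg f (a, c))‖ₑ ^ 2 := by
    intro v
    have h := ((hf.isLocBdd_fst v).sub
      (hf.avg.isLocBdd_fst c)).mul_enorm_ballAvg_sub_ballAvg_sq_le z w
    rw [(hf.isLocBdd_fst v).ballAvg_sub (hf.avg.isLocBdd_fst c),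
      (hf.isLocBdd_fst v).ballAvg_sub (hf.avg.isLocBdd_fst c), sub_sub_sub_comm] at h
    simpa only [Pi.sub_apply, sub_sub_sub_comm] using h
  have hD : Measurable fun p : ((ℍ × ℍ) × ℍ) =>
      ‖(f (p.2, p.1.1) - f (p.1.2, p.1.1))
        - (SL2Cocycle.avg f (p.2, c) - SL2Cocycle.avg f (p.1.2, c))‖ₑ ^ 2 :=
    (((hfm.comp_measurable (g := fun p : ((ℍ × ℍ) × ℍ) => (p.2, p.1.1)) (by fun_prop)).sub
      (hfm.comp_measurable (g := fun p : ((ℍ × ℍ) × ℍ) => (p.1.2, p.1.1))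
        (by fun_prop))).sub
      ((ham.comp_measurable (g := fun p : ((ℍ × ℍ) × ℍ) => (p.2, c))
        (by fun_prop)).sub
      (ham.comp_measurable (g := fun p : ((ℍ × ℍ) × ℍ) => (p.1.2, c))
        (by fun_prop)))).enorm.pow_const 2
  calc unitVol ^ 3 * ‖(smooth f (w, w') - smooth f (z, w')) - e‖ₑ ^ 2
      = unitVol ^ 2 * (unitVol * ‖(smooth f (w, w') - smooth f (z, w')) - e‖ₑ ^ 2) := by ring
    _ ≤ unitVol ^ 2 * _ := mul_le_mul_right h1 _
    _ = ∫⁻ v in ball w' 1, unitVol ^ 2 *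
          ‖(ballAvg (fun a => f (a, v)) w - ballAvg (fun a => f (a, v)) z) - e‖ₑ ^ 2 := by
        rw [lintegral_const_mul' _ _ (ENNReal.pow_ne_top unitVol_ne_top)]
    _ ≤ ∫⁻ v in ball w' 1, ∫⁻ a in ball z 1, ∫⁻ u in ball w 1, ‖(f (u, v) - f (a, v))
        - (SL2Cocycle.avg f (u, c) - SL2Cocycle.avg f (a, c))‖ₑ ^ 2 :=
        lintegral_mono h2
    _ = ∫⁻ a in ball z 1, ∫⁻ u in ball w 1, ∫⁻ v in ball w' 1, ‖(f (u, v) - f (a, v))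
        - (SL2Cocycle.avg f (u, c) - SL2Cocycle.avg f (a, c))‖ₑ ^ 2 := by
        rw [lintegral_lintegral_swap]
        · congr 1 with a
          refine lintegral_lintegral_swap (Measurable.aemeasurable ?_)
          exact hD.comp (f := fun p : ℍ × ℍ => ((p.1, a), p.2)) (by fun_prop)
        · exact (Measurable.lintegral_prod_right' (ν := volume.restrict (ball w 1)) hD).aemeasurable
    _ ≤ _ := setLIntegral_mono' measurableSet_ball fun a ha => by
        refine (setLIntegral_ball_le_ker hw ha _).trans (lintegral_mono fun u => ?_)
        exact mul_le_mul_right (setLIntegral_ball_le_ker hw' hc _) _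

theorem IsField.smooth_mixed_le (hf : IsField ρ₁ ρ₂ π b f) {z w z' w' : ℍ}
    (hw : dist w z < 1) (hw' : dist w' z' < 1) :
    unitVol ^ 4 * ‖(smooth f (w, w') - smooth f (z, w')) -
      (smooth f (w, z') - smooth f (z, z'))‖ₑ ^ 2
      ≤ 4 * ∫⁻ c in ball z' 1, ∫⁻ a in ball z 1, mixedDensity f (a, c) := by
  set X := smooth f (w, w') - smooth f (z, w')
  set Y := smooth f (w, z') - smooth f (z, z')
  calc unitVol ^ 4 * ‖X - Y‖ₑ ^ 2 = ∫⁻ c in ball z' 1, unitVol ^ 3 * ‖X - Y‖ₑ ^ 2 := by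
        rw [setLIntegral_const, unitVol_eq]
        ring
    _ ≤ ∫⁻ c in ball z' 1, 4 * ∫⁻ a in ball z 1, mixedDensity f (a, c) := by
        refine setLIntegral_mono' measurableSet_ball fun c hc => ?_
        have h1 := hf.smooth_sub_sub_avg_le hw hw' hc
        have h2 := hf.smooth_sub_sub_avg_le (w' := z') hw (by simp) hc
        set e := ballAvg (fun u => SL2Cocycle.avg f (u, c)) w
          - ballAvg (fun u => SL2Cocycle.avg f (u, c)) z
        set J := ∫⁻ a in ball z 1, mixedDensity f (a, c)
        calc unitVol ^ 3 * ‖X - Y‖ₑ ^ 2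
            ≤ unitVol ^ 3 * (2 * ‖X - e‖ₑ ^ 2 + 2 * ‖Y - e‖ₑ ^ 2) :=
              mul_le_mul_right (enorm_sub_sq_le X Y e) _
          _ = 2 * (unitVol ^ 3 * ‖X - e‖ₑ ^ 2) + 2 * (unitVol ^ 3 * ‖Y - e‖ₑ ^ 2) := by ring
          _ ≤ 2 * J + 2 * J := by gcongr
          _ = 4 * J := by ring
    _ = _ := lintegral_const_mul' _ _ (by norm_num)

end Increments

section Limit

open Filter Topology

theorem forall_rel_of_dist_lt_one {X : Type*} [PseudoMetricSpace X] [PreconnectedSpace X]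
    (P : X → X → Prop) (h : ∀ x y, dist y x < 1 → P x y)
    (ht : ∀ x y z, P x y → P y z → P x z) (x y : X) : P x y :=
  PreconnectedSpace.induction₂' P
    (fun x => by
      filter_upwards [ball_mem_nhds x one_pos] with y hy
      exact ⟨h x y hy, h y x (by rwa [dist_comm])⟩)
    ⟨ht⟩ x y

theorem exists_splitting_of_increments {X H : Type*} [PseudoMetricSpace X] [ProperSpace X]
    [PreconnectedSpace X] [NormedAddCommGroup H] [CompleteSpace H] (o : X) (h : ℕ → X × X → H)
    (hC : ∀ p q, dist q p < 1 → CauchySeq fun n => h n q - h n p)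
    (hB : ∀ r : ℝ, ∃ B : ℝ, ∀ n p q, dist p (o, o) ≤ r → dist q p < 1 → ‖h n q - h n p‖ ≤ B)
    (hM : ∀ z w z' w', dist w z < 1 → dist w' z' < 1 → Tendsto
      (fun n => (h n (w, w') - h n (z, w')) - (h n (w, z') - h n (z, z'))) atTop (𝓝 0)) :
    ∃ F₁ F₂ : X → H, (∀ r : ℝ, ∃ C, ∀ z, dist z o ≤ r → ‖F₁ z‖ ≤ C) ∧
      (∀ r : ℝ, ∃ C, ∀ z, dist z o ≤ r → ‖F₂ z‖ ≤ C) ∧ F₁ o = 0 ∧ F₂ o = 0 ∧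
      ∀ z w, Tendsto (fun n => h n (z, w) - h n (o, o)) atTop (𝓝 (F₁ z + F₂ w)) := by
  have hC' : ∀ p q, CauchySeq fun n => h n q - h n p :=
    forall_rel_of_dist_lt_one _ hC
      (fun x y z h1 h2 => by simpa [Pi.add_def] using h2.add h1)
  choose F hF using fun p => cauchySeq_tendsto_of_complete (hC' (o, o) p)
  have hFsub : ∀ p q, Tendsto (fun n => h n q - h n p) atTop (𝓝 (F q - F p)) := fun p q => by
    simpa using (hF q).sub (hF p)
  have hF0 : F (o, o) = 0 := by
    have h1 := hF (o, o)
    simp only [sub_self] at h1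
    exact tendsto_nhds_unique h1 tendsto_const_nhds
  have hFB : ∀ r : ℝ, ∃ C : ℝ, ∀ p, dist p (o, o) ≤ r → ‖F p‖ ≤ C := by
    intro r
    obtain ⟨B, hB⟩ := hB r
    refine (isCompact_closedBall (o, o) r).induction_on
      (p := fun s => ∃ C : ℝ, ∀ p ∈ s, ‖F p‖ ≤ C) ⟨0, by simp⟩
      (fun s t hst ⟨C, hC⟩ => ⟨C, fun p hp => hC p (hst hp)⟩) ?_ ?_
    · rintro s t ⟨C, hC⟩ ⟨D, hD⟩
      exact ⟨max C D, fun p hp => hp.elim (fun h => (hC p h).trans (le_max_left _ _))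
        (fun h => (hD p h).trans (le_max_right _ _))⟩
    · intro p hp
      refine ⟨ball p 1, mem_nhdsWithin_of_mem_nhds (ball_mem_nhds p one_pos), ‖F p‖ + B,
        fun q hq => ?_⟩
      have h1 : ‖F q - F p‖ ≤ B :=
        le_of_tendsto (hFsub p q).norm (Eventually.of_forall fun n => hB n p q hp hq)
      have h2 := norm_add_le (F p) (F q - F p)
      rw [add_sub_cancel] at h2
      linarith
  have hmix : ∀ z w z' w', F (w, w') - F (z, w') = F (w, z') - F (z, z') := by
    intro z w
    refine forall_rel_of_dist_lt_one (X := X)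
      (fun z w => ∀ z' w', F (w, w') - F (z, w') = F (w, z') - F (z, z')) ?_ ?_ z w
    · intro z w hw
      refine forall_rel_of_dist_lt_one (X := X) _ (fun z' w' hw' => ?_)
        (fun _ _ _ h1 h2 => h2.trans h1)
      exact sub_eq_zero.1 (tendsto_nhds_unique
        ((hFsub (z, w') (w, w')).sub (hFsub (z, z') (w, z'))) (hM z w z' w' hw hw'))
    · intro x y z h1 h2 z' w'
      have := congr_arg₂ (· + ·) (h1 z' w') (h2 z' w')
      simpa using this
  refine ⟨fun z => F (z, o), fun w => F (o, w), fun r => ?_, fun r => ?_, hF0, hF0, fun z w => ?_⟩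
  · obtain ⟨C, hC⟩ := hFB (max r 0)
    exact ⟨C, fun z hz => hC (z, o) (by simpa [Prod.dist_eq] using Or.inl hz)⟩
  · obtain ⟨C, hC⟩ := hFB (max r 0)
    exact ⟨C, fun z hz => hC (o, z) (by simpa [Prod.dist_eq] using Or.inl hz)⟩
  · have h1 := hmix o z o w
    rw [hF0, sub_zero, sub_eq_iff_eq_add] at h1
    rw [← h1]
    exact hF (z, w)

variable {Γ : Type*} [Group Γ] {H : Type*} [NormedAddCommGroup H] [InnerProductSpace ℝ H]
  {ρ₁ ρ₂ : Γ →* SL(2, ℝ)} {π : Γ → H ≃ₗᵢ[ℝ] H} {b : Γ → H} {f g : ℍ × ℍ → H}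
  {φ : ℍ × ℍ → ℝ≥0∞}

theorem IsField.density_fst_smul (hf : IsField ρ₁ ρ₂ π b f) (γ : Γ) (z w : ℍ) :
    ∫⁻ u, ker (ρ₁ γ • z) u * ‖f (u, ρ₂ γ • w) - f (ρ₁ γ • z, ρ₂ γ • w)‖ₑ ^ 2
      = ∫⁻ u, ker z u * ‖f (u, w) - f (z, w)‖ₑ ^ 2 := by
  rw [lintegral_ker_smul]
  simp only [hf.enorm_sub hf]

theorem IsField.density_snd_smul (hf : IsField ρ₁ ρ₂ π b f) (γ : Γ) (z w : ℍ) :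
    ∫⁻ u, ker (ρ₂ γ • w) u * ‖f (ρ₁ γ • z, u) - f (ρ₁ γ • z, ρ₂ γ • w)‖ₑ ^ 2
      = ∫⁻ u, ker w u * ‖f (z, u) - f (z, w)‖ₑ ^ 2 := by
  rw [lintegral_ker_smul]
  simp only [hf.enorm_sub hf]

variable [CompleteSpace H]

theorem IsField.mixedDensity_smul (hf : IsField ρ₁ ρ₂ π b f) (γ : Γ) (z w : ℍ) :
    mixedDensity f (ρ₁ γ • z, ρ₂ γ • w) = mixedDensity f (z, w) := by
  simp only [mixedDensity]
  rw [lintegral_ker_smul]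
  simp only [lintegral_ker_smul]
  congr! 6 with u v
  rw [hf.equiv, hf.equiv, hf.avg.equiv, hf.avg.equiv, add_sub_add_right_eq_sub,
    add_sub_add_right_eq_sub, ← map_sub, ← map_sub, ← map_sub]
  congr 1
  exact (π γ).toLinearIsometry.enorm_map _

variable [Countable Γ]

/-- Uniform control of the increments of `smooth f` on bounded sets by the energies of `f`. -/
theorem exists_smooth_increment_le (hρ : IsProper ρ₁ ρ₂) (hφ : IsWeight ρ₁ ρ₂ φ) (r : ℝ) :
    ∃ N : ℝ≥0∞, N ≠ ∞ ∧ ∀ {b : Γ → H} {f : ℍ × ℍ → H}, IsField ρ₁ ρ₂ π b f →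
      ∀ z z' w w', dist z I ≤ r → dist z' I ≤ r → dist w z < 1 → dist w' z' < 1 →
      ‖smooth f (w, z') - smooth f (z, z')‖ₑ ^ 2 ≤ N * energyFst φ f ∧
      ‖smooth f (z, w') - smooth f (z, z')‖ₑ ^ 2 ≤ N * energySnd φ f ∧
      ‖(smooth f (w, w') - smooth f (z, w')) - (smooth f (w, z') - smooth f (z, z'))‖ₑ ^ 2
        ≤ N * mixedVar φ f := by
  obtain ⟨N, hN, hint⟩ := hρ.exists_lintegral_le hφ (r + 1)
  set U := unitVol
  have hU0 : U ≠ 0 := unitVol_ne_zero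
  have hUt : U ≠ ∞ := unitVol_ne_top
  have key : ∀ {k : ℕ} {x y : ℝ≥0∞}, U ^ k * x ≤ y → x ≤ (U ^ k)⁻¹ * y := by
    intro k x y h
    rw [mul_comm, ← div_eq_mul_inv]
    rw [ENNReal.le_div_iff_mul_le (.inl (pow_ne_zero _ hU0)) (.inl (ENNReal.pow_ne_top hUt)),
      mul_comm]
    exact h
  have hinv : ∀ k : ℕ, (U ^ k)⁻¹ ≠ ∞ := fun k => by simp [hU0]
  refine ⟨(U ^ 3)⁻¹ * N + (U ^ 4)⁻¹ * (4 * N), by finiteness [hinv 3, hinv 4], ?_⟩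
  intro b f hf z z' w w' hz hz' hw hw'
  refine ⟨?_, ?_, ?_⟩
  · have h1 := (hf.smooth_sub_fst_le hw z').trans
      ((setLIntegral_prod_closedBall hf.measurable_density_fst hz hz').trans
        (hint _ hf.measurable_density_fst hf.density_fst_smul))
    calc _ ≤ _ := key h1
      _ = (U ^ 3)⁻¹ * N * energyFst φ f := by rw [mul_assoc]; rfl
      _ ≤ _ := by gcongr; exact le_self_add
  · have h1 := (hf.smooth_sub_snd_le hw' z).trans
      ((setLIntegral_prod_closedBall hf.measurable_density_snd hz hz').trans
        (hint _ hf.measurable_density_snd hf.density_snd_smul))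
    calc _ ≤ _ := key h1
      _ = (U ^ 3)⁻¹ * N * energySnd φ f := by rw [mul_assoc]; rfl
      _ ≤ _ := by gcongr; exact le_self_add
  · have h1 := (hf.smooth_mixed_le hw hw').trans
      (mul_le_mul_right ((setLIntegral_prod_closedBall hf.measurable_mixedDensity hz hz').trans
        (hint _ hf.measurable_mixedDensity hf.mixedDensity_smul)) 4)
    calc _ ≤ _ := key h1
      _ = (U ^ 4)⁻¹ * (4 * N) * mixedVar φ f := by simp only [mul_assoc]; rfl
      _ ≤ _ := by gcongr; exact le_add_self

/-- A cocycle with a field of finite energy is, up to almost coboundaries, a sum of two cocycles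
each factoring through one coordinate. -/
theorem exists_split_limit (hρ : IsProper ρ₁ ρ₂) (hφ : IsWeight ρ₁ ρ₂ φ)
    (hf : IsField ρ₁ ρ₂ π b f) (hE : energy φ f ≠ ∞) :
    ∃ (F₁ F₂ : ℍ → H) (v : ℕ → H), (∀ r : ℝ, ∃ C, ∀ z, dist z I ≤ r → ‖F₁ z‖ ≤ C) ∧
      (∀ r : ℝ, ∃ C, ∀ z, dist z I ≤ r → ‖F₂ z‖ ≤ C) ∧
      (∀ γ z w, F₁ (ρ₁ γ • z) + F₂ (ρ₂ γ • w)
        = π γ (F₁ z + F₂ w) + (F₁ (ρ₁ γ • I) + F₂ (ρ₂ γ • I))) ∧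
      ∀ γ, Tendsto (fun n => b γ + π γ (v n) - v n) atTop
        (𝓝 (F₁ (ρ₁ γ • I) + F₂ (ρ₂ γ • I))) := by
  obtain ⟨f, hf, hsub, hmix, B, hB, hle⟩ := exists_minimizing_sequence hφ hf hE
  have hroot : ∀ {x : H} {y : ℝ}, ‖x‖ₑ ^ 2 ≤ ENNReal.ofReal y → 0 ≤ y → ‖x‖ ≤ √y := by
    intro x y h hy
    refine Real.le_sqrt_of_sq_le ?_
    rw [← ofReal_norm, ← ENNReal.ofReal_pow (norm_nonneg _)] at h
    exact (ENNReal.ofReal_le_ofReal_iff hy).1 h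
  have hstep : ∀ {p q : ℍ × ℍ} {k : ℍ × ℍ → H} {y : ℝ≥0∞} , dist q p < 1 → y ≠ ∞ →
      ‖k (q.1, p.2) - k (p.1, p.2)‖ₑ ^ 2 ≤ y → ‖k (q.1, q.2) - k (q.1, p.2)‖ₑ ^ 2 ≤ y →
      ‖k q - k p‖ ≤ 2 * √ y.toReal := by
    intro p q k y hqp hy h1 h2
    rw [← ENNReal.ofReal_toReal hy] at h1 h2
    have h3 := hroot h1 ENNReal.toReal_nonneg
    have h4 := hroot h2 ENNReal.toReal_nonneg
    calc ‖k q - k p‖ = ‖(k (q.1, q.2) - k (q.1, p.2)) + (k (q.1, p.2) - k (p.1, p.2))‖ := by simp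
      _ ≤ _ := norm_add_le _ _
      _ ≤ _ := by linarith
  have hinc : ∀ r : ℝ, ∃ N : ℝ≥0∞, N ≠ ∞ ∧ ∀ {b : Γ → H} {k : ℍ × ℍ → H},
      IsField ρ₁ ρ₂ π b k → energy φ k ≠ ∞ → ∀ p q, dist p (I, I) ≤ r → dist q p < 1 →
      ‖smooth k q - smooth k p‖ ≤ 2 * √ (N * energy φ k).toReal := by
    intro r
    obtain ⟨N, hN, hinc⟩ := exists_smooth_increment_le (H := H) (π := π) hρ hφ (r + 1)
    refine ⟨N, hN, fun {b k} hk hkE p q hp hq => ?_⟩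
    rw [Prod.dist_eq, max_le_iff] at hp
    have hq' := hq
    rw [Prod.dist_eq, max_lt_iff] at hq'
    have hq1 : dist q.1 I ≤ r + 1 := (dist_triangle q.1 p.1 I).trans (by linarith [hp.1, hq'.1])
    refine hstep hq (ENNReal.mul_ne_top hN hkE) ?_ ?_
    · refine (hinc hk p.1 p.2 q.1 q.2 (by linarith [hp.1]) (by linarith [hp.2]) hq'.1
        hq'.2).1.trans ?_
      gcongr
      exact le_self_add
    · refine (hinc hk q.1 p.2 q.1 q.2 hq1 (by linarith [hp.2]) (by simp) hq'.2).2.1.trans ?_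
      gcongr
      exact le_add_self
  have hdelta : Tendsto (fun m : ℕ × ℕ => 2 * ((m.1 + 1 : ℝ≥0∞)⁻¹ + (m.2 + 1 : ℝ≥0∞)⁻¹))
      atTop (𝓝 0) := by
    have h0 : Tendsto (fun n : ℕ => (n + 1 : ℝ≥0∞)⁻¹) atTop (𝓝 0) := by
      have := (tendsto_add_atTop_iff_nat 1).2 ENNReal.tendsto_inv_nat_nhds_zero
      simpa using this
    rw [← prod_atTop_atTop_eq]
    have := ENNReal.Tendsto.const_mul (a := 2) ((h0.comp tendsto_fst).add (h0.comp tendsto_snd))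
      (.inr (by norm_num))
    simpa using this
  refine (exists_splitting_of_increments UpperHalfPlane.I (fun n => smooth (f n)) ?_ ?_ ?_).elim
    fun F₁ h => h.elim fun F₂ h => ?_
  rotate_left 3
  · obtain ⟨hF₁, hF₂, h₁0, h₂0, hlim⟩ := h
    have hlimγ : ∀ γ, Tendsto (fun n => b γ + π γ (smooth (f n) (I, I)) - smooth (f n) (I, I))
        atTop (𝓝 (F₁ (ρ₁ γ • I) + F₂ (ρ₂ γ • I))) := by
      intro γ
      refine (hlim (ρ₁ γ • I) (ρ₂ γ • I)).congr fun n => ?_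
      rw [(hf n).smooth_equiv, add_comm (b γ)]
    refine ⟨F₁, F₂, fun n => smooth (f n) (I, I), hF₁, hF₂, fun γ z w => ?_, hlimγ⟩
    refine tendsto_nhds_unique (hlim (ρ₁ γ • z) (ρ₂ γ • w)) ?_
    refine ((((π γ).continuous.tendsto _).comp (hlim z w)).add (hlimγ γ)).congr fun n => ?_
    simp only [Function.comp, (hf n).smooth_equiv, map_sub]
    abel
  · intro p q hq
    obtain ⟨N, hN, hinc⟩ := hinc (dist p (I, I))
    rw [cauchySeq_iff_tendsto_dist_atTop_0]
    have hlim0 : Tendsto (fun m : ℕ × ℕ => 2 * √ (N * (2 * ((m.1 + 1 : ℝ≥0∞)⁻¹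
        + (m.2 + 1 : ℝ≥0∞)⁻¹))).toReal) atTop (𝓝 0) := by
      have h1 := ENNReal.Tendsto.const_mul hdelta (.inr hN)
      rw [mul_zero] at h1
      have h2 := ((ENNReal.tendsto_toReal ENNReal.zero_ne_top).comp h1).sqrt.const_mul 2
      simpa using h2
    refine squeeze_zero (fun _ => dist_nonneg) (fun m => ?_) hlim0
    have hfin : (2 : ℝ≥0∞) * ((m.1 + 1 : ℝ≥0∞)⁻¹ + (m.2 + 1 : ℝ≥0∞)⁻¹) ≠ ∞ := by
      refine ENNReal.mul_ne_top (by norm_num) (ENNReal.add_ne_top.2 ⟨?_, ?_⟩) <;> simp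
    have h1 := hinc ((hf m.1).sub (hf m.2)) (ne_top_of_le_ne_top hfin (hsub _ _)) p q le_rfl hq
    rw [(hf m.1).smooth_sub (hf m.2), (hf m.1).smooth_sub (hf m.2), sub_sub_sub_comm] at h1
    rw [dist_eq_norm]
    refine h1.trans ?_
    gcongr
    · exact ENNReal.mul_ne_top hN hfin
    · exact hsub _ _
  · intro r
    obtain ⟨N, hN, hinc⟩ := hinc r
    refine ⟨2 * √ (N * B).toReal, fun n p q hp hq => ?_⟩
    refine (hinc (hf n) (ne_top_of_le_ne_top hB (hle n)) p q hp hq).trans ?_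
    gcongr
    · exact ENNReal.mul_ne_top hN hB
    · exact hle n
  · intro z w z' w' hw hw'
    obtain ⟨N, hN, hinc⟩ := exists_smooth_increment_le (H := H) (π := π) hρ hφ
      (max (dist z I) (dist z' I))
    have h0 : Tendsto (fun n : ℕ => √ (N * (ballVol * (n + 1 : ℝ≥0∞)⁻¹)).toReal) atTop (𝓝 0) := by
      have h0 : Tendsto (fun n : ℕ => (n + 1 : ℝ≥0∞)⁻¹) atTop (𝓝 0) := by
        have := (tendsto_add_atTop_iff_nat 1).2 ENNReal.tendsto_inv_nat_nhds_zero
        simpa using this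
      have h1 := ENNReal.Tendsto.const_mul (ENNReal.Tendsto.const_mul h0 (.inr ballVol_ne_top))
        (.inr hN)
      rw [mul_zero, mul_zero] at h1
      have h2 := ((ENNReal.tendsto_toReal ENNReal.zero_ne_top).comp h1).sqrt
      simpa using h2
    refine squeeze_zero_norm (fun n => ?_) h0
    have h1 := (hinc (hf n) z z' w w' (le_max_left _ _) (le_max_right _ _) hw hw').2.2
    refine hroot ?_ ENNReal.toReal_nonneg
    rw [ENNReal.ofReal_toReal (ENNReal.mul_ne_top hN (ENNReal.mul_ne_top ballVol_ne_top (by simp)))]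
    exact h1.trans (mul_le_mul_right (hmix n) _)

end Limit

section Moebius

theorem im_smul_eq (g : SL(2, ℝ)) (z : ℍ) :
    (g • z).im = z.im / ((g 1 0 * z.re + g 1 1) ^ 2 + (g 1 0 * z.im) ^ 2) := by
  have hdet : g 0 0 * g 1 1 - g 0 1 * g 1 0 = 1 := by rw [← det_fin_two, g.det_coe]
  rw [← coe_im, coe_specialLinearGroup_apply, Complex.div_im]
  simp only [Complex.normSq_apply]
  simp
  rw [← sub_div]
  congr 1
  · linear_combination z.im * hdet
  · ring

theorem smul_denom_pos (g : SL(2, ℝ)) (z : ℍ) :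
    0 < (g 1 0 * z.re + g 1 1) ^ 2 + (g 1 0 * z.im) ^ 2 := by
  have h := (g • z).im_pos
  rw [im_smul_eq] at h
  exact (div_pos_iff_of_pos_left z.im_pos).1 h

theorem re_smul_eq (g : SL(2, ℝ)) (z : ℍ) :
    (g • z).re = ((g 0 0 * z.re + g 0 1) * (g 1 0 * z.re + g 1 1) + g 0 0 * g 1 0 * z.im ^ 2)
      / ((g 1 0 * z.re + g 1 1) ^ 2 + (g 1 0 * z.im) ^ 2) := by
  rw [← coe_re, coe_specialLinearGroup_apply, Complex.div_re]
  simp only [Complex.normSq_apply]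
  simp
  ring

/-- The point `x + iy` of the upper half-plane (for `y > 0`). -/
noncomputable def pt (x y : ℝ) : ℍ :=
  ⟨⟨x, if 0 < y then y else 1⟩, by
    change (0 : ℝ) < if 0 < y then y else 1
    split_ifs with h
    exacts [h, one_pos]⟩

theorem pt_re (x y : ℝ) : (pt x y).re = x := rfl

theorem pt_im (x : ℝ) {y : ℝ} (hy : 0 < y) : (pt x y).im = y := by
  change (if 0 < y then y else 1) = y
  rw [if_pos hy]

theorem pt_zero_one : pt 0 1 = UpperHalfPlane.I :=
  ext_re_im (by simp [pt_re]) (by simp [pt_im])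

theorem pt_re_im (z : ℍ) : pt z.re z.im = z := ext_re_im (pt_re _ _) (pt_im _ z.im_pos)

theorem det_fin_two' {R : Type*} [CommRing R] (g : SL(2, R)) :
    g 0 0 * g 1 1 - g 0 1 * g 1 0 = 1 := by
  rw [← det_fin_two, g.det_coe]

theorem dist_pt_le (x x' : ℝ) {y : ℝ} (hy : 0 < y) : dist (pt x y) (pt x' y) ≤ |x - x'| / y := by
  refine (dist_le_dist_coe_div_sqrt _ _).trans (le_of_eq ?_)
  rw [pt_im _ hy, pt_im _ hy, Real.sqrt_mul_self hy.le, Complex.dist_eq]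
  congr 1
  have : (pt x y : ℂ) - pt x' y = ((x - x' : ℝ) : ℂ) := by
    apply Complex.ext
    · simp [pt_re]
    · simp [pt_im _ hy]
  rw [this, Complex.norm_real, Real.norm_eq_abs]

theorem dist_pt_pt (x : ℝ) {y y' : ℝ} (hy : 0 < y) (hy' : 0 < y') :
    dist (pt x y) (pt x y') = |Real.log y - Real.log y'| := by
  rw [dist_of_re_eq (by simp [pt_re]), pt_im _ hy, pt_im _ hy', Real.dist_eq]

end Moebius

section Growth

variable {H : Type*} [NormedAddCommGroup H] {F : ℍ → H} {C : ℝ}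

/-- `F` is coarsely continuous and its increments are coarsely invariant under `SL(2, ℝ)`. -/
structure IsCoarselyInvariant (F : ℍ → H) (C : ℝ) : Prop where
  near : ∀ z w, dist z w ≤ 1 → ‖F z - F w‖ ≤ C
  smul : ∀ (g : SL(2, ℝ)) (z w : ℍ), ‖F (g • z) - F (g • w)‖ ≤ ‖F z - F w‖ + C

theorem exists_smul_pt (a : ℝ) (ha : 0 < a) (t : ℝ) :
    ∃ g : SL(2, ℝ), ∀ x y : ℝ, 0 < y → g • pt x y = pt (a * x + t) (a * y) := by
  have hs : √a ≠ 0 := (Real.sqrt_pos.2 ha).ne'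
  have h2 : √a * √a = a := Real.mul_self_sqrt ha.le
  let g : SL(2, ℝ) := ⟨!![√a, t / √a; 0, (√a)⁻¹], by simp [det_fin_two, hs]⟩
  have g00 : g 0 0 = √a := rfl
  have g01 : g 0 1 = t / √a := rfl
  have g10 : g 1 0 = 0 := rfl
  have g11 : g 1 1 = (√a)⁻¹ := rfl
  refine ⟨g, fun x y hy => ext_re_im ?_ ?_⟩
  · rw [re_smul_eq, pt_re, pt_re, g00, g01, g10, g11]
    field_simp
    rw [Real.sq_sqrt ha.le]
    simp [mul_comm]
  · rw [im_smul_eq, pt_re, pt_im _ hy, pt_im _ (by positivity), g10, g11]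
    field_simp
    rw [Real.sq_sqrt ha.le]
    simp

theorem IsCoarselyInvariant.affine (hF : IsCoarselyInvariant F C) {a : ℝ} (ha : 0 < a) (t : ℝ)
    {x y x' y' : ℝ} (hy : 0 < y) (hy' : 0 < y') :
    ‖F (pt (a * x + t) (a * y)) - F (pt (a * x' + t) (a * y'))‖
      ≤ ‖F (pt x y) - F (pt x' y')‖ + C := by
  obtain ⟨g, hg⟩ := exists_smul_pt a ha t
  rw [← hg x y hy, ← hg x' y' hy']
  exact hF.smul g _ _

theorem IsCoarselyInvariant.nonneg (hF : IsCoarselyInvariant F C) : 0 ≤ C := by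
  simpa using hF.near UpperHalfPlane.I UpperHalfPlane.I (by simp)

/-- Going from `y + i` to `i / (1 + y²)` by the inversion. -/
theorem IsCoarselyInvariant.le_of_inversion (hF : IsCoarselyInvariant F C) {y : ℝ} (hy : 1 ≤ y) :
    ‖F (pt 0 1) - F (pt 0 (y ^ 2))‖ ≤ ‖F (pt 0 1) - F (pt y 1)‖ + 5 * C := by
  have hy0 : 0 < y := by linarith
  let g : SL(2, ℝ) := ⟨!![0, -1; 1, 0], by simp [det_fin_two]⟩
  have g00 : g 0 0 = 0 := rfl
  have g01 : g 0 1 = -1 := rfl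
  have g10 : g 1 0 = 1 := rfl
  have g11 : g 1 1 = 0 := rfl
  have e1 : g • pt 0 1 = pt 0 1 := by
    refine ext_re_im ?_ ?_
    · rw [re_smul_eq, pt_re, g00, g01, g10, g11]; simp
    · rw [im_smul_eq, pt_re, pt_im _ one_pos, g10, g11]; simp
  have e2 : g • pt y 1 = pt (-y / (1 + y ^ 2)) (1 / (1 + y ^ 2)) := by
    refine ext_re_im ?_ ?_
    · rw [re_smul_eq, pt_re, pt_re, pt_im _ one_pos, g00, g01, g10, g11]; field_simp; ring
    · rw [im_smul_eq, pt_re, pt_im _ one_pos, pt_im _ (by positivity), g10, g11]; field_simp; ring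
  have h1 := hF.smul g (pt 0 1) (pt y 1)
  rw [e1, e2] at h1
  have h2 := hF.affine (a := 1) one_pos (y / (1 + y ^ 2)) (x := 0) (y := 1)
    (x' := -y / (1 + y ^ 2)) (y' := 1 / (1 + y ^ 2)) one_pos (by positivity)
  have e3 : 1 * (-y / (1 + y ^ 2)) + y / (1 + y ^ 2) = 0 := by ring
  rw [e3] at h2
  simp only [mul_zero, zero_add, one_mul] at h2
  have h3 : ‖F (pt 0 1) - F (pt (y / (1 + y ^ 2)) 1)‖ ≤ C := by
    refine hF.near _ _ ((dist_pt_le _ _ one_pos).trans ?_)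
    rw [div_one, zero_sub, abs_neg, abs_of_nonneg (by positivity), div_le_one (by positivity)]
    nlinarith
  have h4 := hF.affine (a := 1 + y ^ 2) (by positivity) 0 (x := 0) (y := 1)
    (x' := 0) (y' := 1 / (1 + y ^ 2)) one_pos (by positivity)
  rw [mul_one_div_cancel (by positivity)] at h4
  simp only [mul_zero, zero_add, mul_one] at h4
  have h5 : ‖F (pt 0 (1 + y ^ 2)) - F (pt 0 (y ^ 2))‖ ≤ C := by
    refine hF.near _ _ ?_
    rw [dist_pt_pt _ (by positivity) (by positivity), ← Real.log_div (by positivity)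
      (by positivity)]
    have h6 : 1 ≤ (1 + y ^ 2) / y ^ 2 := by rw [le_div_iff₀ (by positivity)]; linarith
    rw [abs_of_nonneg (Real.log_nonneg h6)]
    have h7 := Real.log_le_sub_one_of_pos (lt_of_lt_of_le one_pos h6)
    have h8 : (1 + y ^ 2) / y ^ 2 ≤ 2 := by rw [div_le_iff₀ (by positivity)]; nlinarith
    linarith
  have t1 := norm_sub_le_norm_sub_add_norm_sub (F (pt 0 1)) (F (pt (y / (1 + y ^ 2)) 1))
    (F (pt 0 (1 / (1 + y ^ 2))))
  have t2 := norm_sub_le_norm_sub_add_norm_sub (F (pt 0 1)) (F (pt 0 (1 + y ^ 2)))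
    (F (pt 0 (y ^ 2)))
  rw [norm_sub_rev (F (pt 0 1)) (F (pt 0 (1 + y ^ 2)))] at t2
  linarith

theorem star_inequality {H : Type*} [NormedAddCommGroup H] [InnerProductSpace ℝ H]
    {p₀ p₁ p₂ c : H} {m R : ℝ} (hm : 0 ≤ m) (h01 : m ≤ ‖p₀ - p₁‖) (h12 : m ≤ ‖p₁ - p₂‖)
    (h02 : m ≤ ‖p₀ - p₂‖) (h0 : ‖p₀ - c‖ ≤ R) (h1 : ‖p₁ - c‖ ≤ R) (h2 : ‖p₂ - c‖ ≤ R) :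
    m ≤ √3 * R := by
  have hR : 0 ≤ R := (norm_nonneg _).trans h0
  have key : ‖p₀ - p₁‖ ^ 2 + ‖p₁ - p₂‖ ^ 2 + ‖p₀ - p₂‖ ^ 2 + ‖(p₀ - c) + (p₁ - c) + (p₂ - c)‖ ^ 2
      = 3 * (‖p₀ - c‖ ^ 2 + ‖p₁ - c‖ ^ 2 + ‖p₂ - c‖ ^ 2) := by
    rw [← sub_sub_sub_cancel_right p₀ p₁ c, ← sub_sub_sub_cancel_right p₁ p₂ c,
      ← sub_sub_sub_cancel_right p₀ p₂ c]
    simp only [← real_inner_self_eq_norm_sq, inner_add_left, inner_add_right, inner_sub_left,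
      inner_sub_right, real_inner_comm]
    ring
  have hsq : m ^ 2 ≤ 3 * R ^ 2 := by
    have a1 := pow_le_pow_left₀ hm h01 2
    have a2 := pow_le_pow_left₀ hm h12 2
    have a3 := pow_le_pow_left₀ hm h02 2
    have b0 := pow_le_pow_left₀ (norm_nonneg _) h0 2
    have b1 := pow_le_pow_left₀ (norm_nonneg _) h1 2
    have b2 := pow_le_pow_left₀ (norm_nonneg _) h2 2
    have := sq_nonneg ‖(p₀ - c) + (p₁ - c) + (p₂ - c)‖
    linarith
  refine abs_le_of_sq_le_sq' ?_ (by positivity) |>.2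
  rw [mul_pow, Real.sq_sqrt (by norm_num)]
  exact hsq

theorem IsCoarselyInvariant.parabolic_le {H : Type*} [NormedAddCommGroup H]
    [InnerProductSpace ℝ H] {F : ℍ → H} (hF : IsCoarselyInvariant F C) :
    ∃ K : ℝ, ∀ y, 0 < y → ‖F (pt 0 1) - F (pt y 1)‖ ≤ √3 * ‖F (pt 0 1) - F (pt 0 y)‖ + K := by
  have hC := hF.nonneg
  set B := ‖F (pt 1 1) - F (pt 0 1)‖ + ‖F (pt 2 1) - F (pt 0 1)‖ with hB
  refine ⟨√3 * (B + 2 * C) + 3 * C, fun y hy => ?_⟩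
  set N := ‖F (pt 0 1) - F (pt y 1)‖ with hN
  set A := ‖F (pt 0 1) - F (pt 0 y)‖ with hA
  rcases le_total N (3 * C) with hNC | hNC
  · have : 0 ≤ √3 * A + √3 * (B + 2 * C) := by positivity
    linarith
  have hstep : ∀ t : ℝ, N - 3 * C ≤ ‖F (pt t 1) - F (pt (t + y) 1)‖ := by
    intro t
    have h := hF.affine (a := 1) one_pos (-t) (x := t) (y := 1) (x' := t + y) (y' := 1)
      one_pos one_pos
    have e1 : 1 * t + -t = 0 := by ring
    have e2 : 1 * (t + y) + -t = y := by ring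
    rw [e1, e2, mul_one] at h
    linarith
  have hdouble : N - 3 * C ≤ ‖F (pt 0 1) - F (pt (2 * y) 1)‖ := by
    have h := hF.affine (a := 1 / 2) (by norm_num) 0 (x := 0) (y := 1) (x' := 2 * y) (y' := 1)
      one_pos one_pos
    have e1 : 1 / 2 * (2 * y) + 0 = y := by ring
    rw [e1, mul_one, mul_zero, zero_add] at h
    have hn : ∀ x : ℝ, ‖F (pt x 1) - F (pt x (1 / 2))‖ ≤ C := by
      intro x
      refine hF.near _ _ ?_
      rw [dist_pt_pt _ one_pos (by norm_num), Real.log_one, Real.log_div (by norm_num)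
        (by norm_num), Real.log_one]
      simp only [zero_sub, neg_neg]
      rw [abs_of_nonneg (Real.log_nonneg (by norm_num))]
      linarith [Real.log_two_lt_d9]
    have t1 := norm_sub_le_norm_sub_add_norm_sub (F (pt 0 1)) (F (pt 0 (1 / 2))) (F (pt y 1))
    have t2 := norm_sub_le_norm_sub_add_norm_sub (F (pt 0 (1 / 2))) (F (pt y (1 / 2)))
      (F (pt y 1))
    rw [norm_sub_rev (F (pt y (1 / 2)))] at t2
    linarith [hn 0, hn y]
  have hcenter : ∀ j : ℝ, ‖F (pt j 1) - F (pt 0 1)‖ ≤ B →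
      ‖F (pt (y * j) 1) - F (pt 0 y)‖ ≤ A + (B + 2 * C) := by
    intro j hj
    have h1 := hF.affine (a := 1) one_pos (y * j) (x := 0) (y := 1) (x' := 0) (y' := y) one_pos hy
    have h2 := hF.affine (a := y) hy 0 (x := j) (y := 1) (x' := 0) (y' := 1) one_pos one_pos
    simp only [mul_one, mul_zero, zero_add, add_zero, one_mul] at h1 h2
    have t1 := norm_sub_le_norm_sub_add_norm_sub (F (pt (y * j) 1)) (F (pt (y * j) y))
      (F (pt 0 y))
    linarith
  have hstar := star_inequality (p₀ := F (pt 0 1)) (p₁ := F (pt y 1)) (p₂ := F (pt (2 * y) 1))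
    (c := F (pt 0 y)) (m := N - 3 * C) (R := A + (B + 2 * C)) (by linarith)
    (by simpa using hstep 0) (by simpa [two_mul] using hstep y) hdouble
    (by simpa using hcenter 0 (by simp [hB]; positivity))
    (by simpa using hcenter 1 (by rw [hB]; linarith [norm_nonneg (F (pt 2 1) - F (pt 0 1))]))
    (by simpa [mul_comm] using
      hcenter 2 (by rw [hB]; linarith [norm_nonneg (F (pt 1 1) - F (pt 0 1))]))
  linarith

/-- A function which roughly at most multiplies by `√3` upon doubling, is sublinear. -/
theorem sublinear_of_doubling {θ : ℝ → ℝ} {C K : ℝ} (h0 : ∀ r, 0 ≤ r → θ r ≤ C * (r + 1))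
    (h : ∀ r, 0 ≤ r → θ (2 * r) ≤ √3 * θ r + K) :
    ∀ ε > 0, ∃ M, ∀ r, 0 ≤ r → θ r ≤ ε * r + M := by
  have hn : ∀ n : ℕ, ∃ M, ∀ r, 0 ≤ r → θ r ≤ |C| * (√3 / 2) ^ n * r + M := by
    intro n
    induction n with
    | zero =>
      refine ⟨|C|, fun r hr => (h0 r hr).trans ?_⟩
      have : C * (r + 1) ≤ |C| * (r + 1) := by gcongr; exact le_abs_self C
      simpa [mul_add] using this
    | succ n ih =>
      obtain ⟨M, hM⟩ := ih
      refine ⟨√3 * M + K, fun r hr => ?_⟩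
      have h1 := h (r / 2) (by positivity)
      rw [mul_div_cancel₀ _ two_ne_zero] at h1
      have h2 := mul_le_mul_of_nonneg_left (hM (r / 2) (by positivity)) (Real.sqrt_nonneg 3)
      calc θ r ≤ _ := h1
        _ ≤ √3 * (|C| * (√3 / 2) ^ n * (r / 2) + M) + K := by linarith
        _ = _ := by ring
  intro ε hε
  have hlt : √3 / 2 < 1 := by
    rw [div_lt_one two_pos, Real.sqrt_lt' two_pos]
    norm_num
  have ht := (tendsto_pow_atTop_nhds_zero_of_lt_one (by positivity) hlt).const_mul |C|
  rw [mul_zero] at ht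
  obtain ⟨n, hn'⟩ := (ht.eventually (ge_mem_nhds hε)).exists
  obtain ⟨M, hM⟩ := hn n
  exact ⟨M, fun r hr => (hM r hr).trans (by gcongr)⟩

theorem IsCoarselyInvariant.vertical_le {H : Type*} [NormedAddCommGroup H]
    [InnerProductSpace ℝ H] {F : ℍ → H} (hF : IsCoarselyInvariant F C) :
    ∀ ε > 0, ∃ M, ∀ r, 0 ≤ r → ‖F (pt 0 1) - F (pt 0 (Real.exp r))‖ ≤ ε * r + M := by
  obtain ⟨K, hK⟩ := hF.parabolic_le
  have hC := hF.nonneg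
  refine sublinear_of_doubling (C := C) (K := K + 5 * C) ?_ ?_
  · have hn : ∀ n : ℕ, ∀ r : ℝ, 0 ≤ r → r ≤ n →
        ‖F (pt 0 1) - F (pt 0 (Real.exp r))‖ ≤ C * n := by
      intro n
      induction n with
      | zero =>
        intro r hr hr'
        have : r = 0 := le_antisymm (by simpa using hr') hr
        simp [this]
      | succ n ih =>
        intro r hr hr'
        push_cast at hr' ⊢
        have h1 := ih (max (r - 1) 0) (le_max_right _ _) (by simp; linarith)
        have h2 : ‖F (pt 0 (Real.exp (max (r - 1) 0))) - F (pt 0 (Real.exp r))‖ ≤ C := by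
          refine hF.near _ _ ?_
          rw [dist_pt_pt _ (Real.exp_pos _) (Real.exp_pos _), Real.log_exp, Real.log_exp, abs_le]
          rcases max_cases (r - 1) 0 with ⟨h, _⟩ | ⟨h, _⟩ <;> rw [h] <;> constructor <;> linarith
        have := norm_sub_le_norm_sub_add_norm_sub (F (pt 0 1))
          (F (pt 0 (Real.exp (max (r - 1) 0)))) (F (pt 0 (Real.exp r)))
        linarith
    intro r hr
    have h1 := hn ⌈r⌉₊ r hr (Nat.le_ceil r)
    have h2 := Nat.ceil_lt_add_one hr
    exact h1.trans (by gcongr)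
  · intro r hr
    have h1 := hF.le_of_inversion (Real.one_le_exp hr)
    have h2 := hK _ (Real.exp_pos r)
    rw [← Real.exp_nat_mul] at h1
    push_cast at h1
    linarith

theorem IsCoarselyInvariant.sublinear {H : Type*} [NormedAddCommGroup H]
    [InnerProductSpace ℝ H] {F : ℍ → H} (hF : IsCoarselyInvariant F C) :
    ∀ ε > 0, ∃ M, ∀ (g : SL(2, ℝ)) (r : ℝ), 0 ≤ r → (∀ i j, |g i j| ≤ Real.exp r) →
      ‖F (g • UpperHalfPlane.I) - F UpperHalfPlane.I‖ ≤ ε * r + M := by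
  intro ε hε
  obtain ⟨K, hK⟩ := hF.parabolic_le
  have hC := hF.nonneg
  obtain ⟨M, hM⟩ := hF.vertical_le (ε / 8) (by positivity)
  have hM0 : 0 ≤ M := by simpa using hM 0 le_rfl
  have h3 : √3 ≤ 2 := Real.sqrt_le_iff.2 (by norm_num)
  have hA : ∀ y r : ℝ, 0 < y → |Real.log y| ≤ r →
      ‖F (pt 0 1) - F (pt 0 y)‖ ≤ ε / 8 * r + M + C := by
    intro y r hy hr
    rw [abs_le] at hr
    rcases le_total 0 (Real.log y) with h | h
    · have := hM _ h
      rw [Real.exp_log hy] at this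
      have : ε / 8 * Real.log y ≤ ε / 8 * r := by gcongr; exact hr.2
      linarith
    · have h1 := hM (-Real.log y) (by linarith)
      rw [Real.exp_neg, Real.exp_log hy] at h1
      have h2 := hF.affine (a := y) hy 0 (x := 0) (y := 1) (x' := 0) (y' := y⁻¹)
        one_pos (by positivity)
      rw [mul_inv_cancel₀ hy.ne', mul_zero, mul_one, add_zero, norm_sub_rev] at h2
      have : ε / 8 * (-Real.log y) ≤ ε / 8 * r := by gcongr; linarith
      linarith
  have hN : ∀ x r : ℝ, 0 ≤ r → |x| ≤ Real.exp r →
      ‖F (pt 0 1) - F (pt x 1)‖ ≤ 2 * (ε / 8 * r + M + C) + |K| + 2 * C := by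
    have hpos : ∀ x r : ℝ, 0 ≤ x → 0 ≤ r → |x| ≤ Real.exp r →
        ‖F (pt 0 1) - F (pt x 1)‖ ≤ 2 * (ε / 8 * r + M + C) + |K| + C := by
      intro x r hx0 hr hx
      have hnn : 0 ≤ ε / 8 * r + M + C := by positivity
      rcases le_total x 1 with h | h
      · have : ‖F (pt 0 1) - F (pt x 1)‖ ≤ C := by
          refine hF.near _ _ ((dist_pt_le _ _ one_pos).trans ?_)
          rw [zero_sub, abs_neg, abs_of_nonneg hx0, div_one]
          exact h
        have := abs_nonneg K
        linarith
      · rw [abs_of_nonneg hx0] at hx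
        have h1 := hK x (by linarith)
        have h2 := hA x r (by linarith) (by
          rw [abs_of_nonneg (Real.log_nonneg h)]
          exact (Real.log_le_iff_le_exp (by linarith)).2 hx)
        have h4 : √3 * ‖F (pt 0 1) - F (pt 0 x)‖ ≤ 2 * (ε / 8 * r + M + C) := by gcongr
        have := le_abs_self K
        linarith
    intro x r hr hx
    rcases le_total 0 x with h | h
    · linarith [hpos x r h hr hx]
    · have h1 := hpos (-x) r (by linarith) hr (by rwa [abs_neg])
      have h2 := hF.affine (a := 1) one_pos x (x := 0) (y := 1) (x' := -x) (y' := 1)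
        one_pos one_pos
      simp only [mul_zero, zero_add, mul_one, one_mul, neg_add_cancel] at h2
      rw [norm_sub_rev (F (pt x 1))] at h2
      linarith
  refine ⟨ε / 8 + M + C + (2 * (ε / 8 + M + C) + |K| + 2 * C) + C, fun g r hr hg => ?_⟩
  set E := Real.exp r with hE
  have hE1 : 1 ≤ E := Real.one_le_exp hr
  have hdet := det_fin_two' g
  set a := g 0 0
  set b := g 0 1
  set c := g 1 0
  set d := g 1 1
  have ha := abs_le.1 (hg 0 0)
  have hb := abs_le.1 (hg 0 1)
  have hc := abs_le.1 (hg 1 0)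
  have hd := abs_le.1 (hg 1 1)
  have sq : ∀ {x : ℝ}, -E ≤ x ∧ x ≤ E → x ^ 2 ≤ E ^ 2 := fun h =>
    sq_le_sq' h.1 h.2
  have hD : (g 1 0 * UpperHalfPlane.I.re + g 1 1) ^ 2 + (g 1 0 * UpperHalfPlane.I.im) ^ 2
      = c ^ 2 + d ^ 2 := by
    simp only [I_re, I_im]
    ring
  have hDpos : 0 < c ^ 2 + d ^ 2 := hD ▸ smul_denom_pos g UpperHalfPlane.I
  have hDle : c ^ 2 + d ^ 2 ≤ 2 * E ^ 2 := by linarith [sq hc, sq hd]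
  have hDge : 1 ≤ 2 * E ^ 2 * (c ^ 2 + d ^ 2) := by
    have h1 : (1 : ℝ) ≤ (a ^ 2 + b ^ 2) * (c ^ 2 + d ^ 2) := by
      nlinarith [sq_nonneg (a * c + b * d), hdet]
    have h2 : a ^ 2 + b ^ 2 ≤ 2 * E ^ 2 := by linarith [sq ha, sq hb]
    exact h1.trans (by gcongr)
  have hexp : 2 * E ^ 2 ≤ Real.exp (2 * r + 1) := by
    rw [Real.exp_add, two_mul r, Real.exp_add, ← hE]
    nlinarith [Real.add_one_le_exp 1, sq_nonneg E]
  set η := 1 / (c ^ 2 + d ^ 2) with hη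
  have hηpos : 0 < η := by positivity
  set x := (a * c + b * d) with hx
  have hgI : g • UpperHalfPlane.I = pt (η * x) (η * 1) := by
    refine ext_re_im ?_ ?_
    · rw [re_smul_eq, pt_re, hD]
      simp only [I_re, I_im]
      rw [hη, hx]
      ring
    · rw [im_smul_eq, mul_one, pt_im _ hηpos, hD, I_im]
  have hlog : |Real.log η| ≤ 2 * r + 1 := by
    rw [hη, one_div, Real.log_inv, abs_neg, abs_le]
    constructor
    · rw [neg_le, ← Real.log_inv]
      refine (Real.log_le_iff_le_exp (by positivity)).2 (le_trans ?_ hexp)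
      rw [inv_le_iff_one_le_mul₀ hDpos]
      exact hDge
    · exact (Real.log_le_iff_le_exp hDpos).2 (hDle.trans hexp)
  have hxle : |x| ≤ Real.exp (2 * r + 1) := by
    refine le_trans ?_ hexp
    rw [hx, abs_le]
    constructor <;> nlinarith [sq ha, sq hb, sq hc, sq hd, sq_nonneg (a - c), sq_nonneg (a + c),
      sq_nonneg (b - d), sq_nonneg (b + d)]
  have k1 := hA η (2 * r + 1) hηpos hlog
  have k2 := hN x (2 * r + 1) (by linarith) hxle
  have k3 := hF.affine (a := η) hηpos 0 (x := 0) (y := 1) (x' := x) (y' := 1) one_pos one_pos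
  simp only [mul_zero, mul_one, add_zero] at k3
  rw [hgI, ← pt_zero_one, norm_sub_rev, mul_one]
  have t := norm_sub_le_norm_sub_add_norm_sub (F (pt 0 1)) (F (pt 0 η)) (F (pt (η * x) η))
  have : 0 ≤ ε * r := by positivity
  linarith

end Growth

section Density

/-- The upper unipotent matrix with entry `s`. -/
def upper {R : Type*} [CommRing R] (s : R) : SL(2, R) := ⟨!![1, s; 0, 1], by simp [det_fin_two]⟩

/-- The inversion matrix. -/
def inversion (R : Type*) [CommRing R] : SL(2, R) := ⟨!![0, -1; 1, 0], by simp [det_fin_two]⟩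

theorem coe_upper {R : Type*} [CommRing R] (s : R) : (upper s).1 = !![1, s; 0, 1] := rfl

theorem coe_inversion (R : Type*) [CommRing R] : (inversion R).1 = !![0, -1; 1, 0] := rfl

theorem continuous_upper : Continuous (upper : ℝ → SL(2, ℝ)) := by
  refine Continuous.subtype_mk ?_ _
  refine continuous_matrix fun i j => ?_
  fin_cases i <;> fin_cases j <;> simp <;> fun_prop

theorem eq_upper_mul (g : SL(2, ℝ)) (hc : g 1 0 ≠ 0) :
    g = upper ((g 0 0 - 1) / g 1 0) * (inversion ℝ * upper (-g 1 0) * (inversion ℝ)⁻¹) *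
      upper ((g 1 1 - 1) / g 1 0) := by
  have hdet := det_fin_two' g
  apply Subtype.ext
  rw [Matrix.SpecialLinearGroup.coe_mul, Matrix.SpecialLinearGroup.coe_mul,
      Matrix.SpecialLinearGroup.coe_mul,
    Matrix.SpecialLinearGroup.coe_mul, Matrix.SpecialLinearGroup.coe_inv, coe_upper, coe_upper,
        coe_upper,
    coe_inversion]
  ext i j
  fin_cases i <;> fin_cases j <;> simp [adjugate_fin_two] <;> field_simp <;> ring_nf
  linear_combination -hdet

theorem closure_eq_top_of_upper_mem (T : Subgroup SL(2, ℝ)) (hu : ∀ s, upper s ∈ T)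
    (hw : inversion ℝ ∈ T) : T = ⊤ := by
  have key : ∀ g : SL(2, ℝ), g 1 0 ≠ 0 → g ∈ T := fun g hc => by
    rw [eq_upper_mul g hc]
    exact T.mul_mem (T.mul_mem (hu _) (T.mul_mem (T.mul_mem hw (hu _)) (T.inv_mem hw))) (hu _)
  refine eq_top_iff.2 fun g _ => ?_
  by_cases hc : g 1 0 = 0
  · refine (T.mul_mem_cancel_left hw).1 (key _ ?_)
    have hdet := det_fin_two' g
    intro h
    rw [Matrix.SpecialLinearGroup.coe_mul, coe_inversion] at h
    have : g 0 0 = 0 := by simpa [Matrix.mul_apply, Fin.sum_univ_two] using h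
    simp [hc, this] at hdet
  · exact key g hc

theorem exists_dist_smul_lt {Γ : Type*} [Group Γ] {ρ : Γ →* SL(2, ℝ)}
    (hu : ∀ s, upper s ∈ closure (Set.range fun γ => ρ γ))
    (hw : inversion ℝ ∈ Set.range fun γ => ρ γ)
    (g : SL(2, ℝ)) (z w : ℍ) : ∃ γ, dist (ρ γ • z) (g • z) < 1 ∧ dist (ρ γ • w) (g • w) < 1 := by
  have htop : ρ.range.topologicalClosure = ⊤ :=
    closure_eq_top_of_upper_mem _ hu (subset_closure hw)
  have hg : g ∈ closure (Set.range fun γ => ρ γ) := by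
    have : g ∈ ρ.range.topologicalClosure := htop ▸ Subgroup.mem_top g
    exact this
  have hopen : IsOpen {h : SL(2, ℝ) | dist (h • z) (g • z) < 1 ∧ dist (h • w) (g • w) < 1} := by
    have hc (z : ℍ) : Continuous fun h : SL(2, ℝ) => dist (h • z) (g • z) := by fun_prop
    exact (isOpen_lt (hc z) continuous_const).inter (isOpen_lt (hc w) continuous_const)
  obtain ⟨_, h, ⟨γ, rfl⟩⟩ := mem_closure_iff.1 hg _ hopen (by simp)
  exact ⟨γ, h⟩

theorem exists_isCoarselyInvariant {Γ H : Type*} [Group Γ] [NormedAddCommGroup H]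
    {ρ : Γ →* SL(2, ℝ)}
    {F : ℍ → H} (hd : ∀ (g : SL(2, ℝ)) (z w : ℍ),
      ∃ γ, dist (ρ γ • z) (g • z) < 1 ∧ dist (ρ γ • w) (g • w) < 1)
    (hb : ∀ r, ∃ C, ∀ z, dist z UpperHalfPlane.I ≤ r → ‖F z‖ ≤ C)
    (hinv : ∀ γ z w, ‖F (ρ γ • z) - F (ρ γ • w)‖ = ‖F z - F w‖) :
    ∃ C, IsCoarselyInvariant F C := by
  obtain ⟨C, hC⟩ := hb 2
  have near : ∀ z w, dist z w ≤ 1 → ‖F z - F w‖ ≤ 2 * C := by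
    intro z w hzw
    obtain ⟨g, hg⟩ := MulAction.exists_smul_eq SL(2, ℝ) z UpperHalfPlane.I
    obtain ⟨γ, h1, h2⟩ := hd g z w
    have h3 : dist (g • w) (g • z) ≤ 1 := by rwa [dist_smul, dist_comm]
    rw [hg] at h1 h3
    have h4 := dist_triangle (ρ γ • w) (g • w) UpperHalfPlane.I
    rw [← hinv γ]
    have := norm_sub_le (F (ρ γ • z)) (F (ρ γ • w))
    have := hC (ρ γ • z) (by linarith)
    have := hC (ρ γ • w) (by linarith)
    linarith
  have h0 : 0 ≤ C := (norm_nonneg _).trans (hC UpperHalfPlane.I (by simp))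
  refine ⟨4 * C, fun z w h => (near z w h).trans (by linarith), fun g z w => ?_⟩
  obtain ⟨γ, h1, h2⟩ := hd g z w
  have h3 := near _ _ h1.le
  have h4 := near _ _ h2.le
  rw [← hinv γ z w]
  have e : F (g • z) - F (g • w) = (F (ρ γ • z) - F (ρ γ • w)) - (F (ρ γ • z) - F (g • z))
      + (F (ρ γ • w) - F (g • w)) := by abel
  rw [e]
  have := norm_add_le ((F (ρ γ • z) - F (ρ γ • w)) - (F (ρ γ • z) - F (g • z)))
    (F (ρ γ • w) - F (g • w))
  have := norm_sub_le (F (ρ γ • z) - F (ρ γ • w)) (F (ρ γ • z) - F (g • z))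
  linarith

end Density

section Reduction

variable {Γ H : Type*} [Group Γ] [NormedAddCommGroup H] {ρ₁ ρ₂ : Γ →* SL(2, ℝ)}

/-- The diagonal action on pairs of points of the upper half-plane. -/
noncomputable def act (ρ₁ ρ₂ : Γ →* SL(2, ℝ)) (γ : Γ) (z : ℍ × ℍ) : ℍ × ℍ :=
  (ρ₁ γ • z.1, ρ₂ γ • z.2)

theorem act_mul (γ δ : Γ) (z : ℍ × ℍ) : act ρ₁ ρ₂ (γ * δ) z = act ρ₁ ρ₂ γ (act ρ₁ ρ₂ δ z) := by
  simp [act, mul_smul]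

theorem act_one (z : ℍ × ℍ) : act ρ₁ ρ₂ 1 z = z := by
  simp [act]

theorem act_inv_act (γ : Γ) (z : ℍ × ℍ) : act ρ₁ ρ₂ γ⁻¹ (act ρ₁ ρ₂ γ z) = z := by
  rw [← act_mul, inv_mul_cancel, act_one]

theorem dist_act (γ : Γ) (z w : ℍ × ℍ) : dist (act ρ₁ ρ₂ γ z) (act ρ₁ ρ₂ γ w) = dist z w := by
  simp [act, Prod.dist_eq, dist_smul]

theorem measurable_act (γ : Γ) : Measurable (act ρ₁ ρ₂ γ) := by
  have h (g : SL(2, ℝ)) : Measurable fun z : ℍ => g • z := measurable_const_smul g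
  exact ((h _).comp measurable_fst).prodMk ((h _).comp measurable_snd)

/-- Every orbit meets `𝓢`, only finitely many times, and the cocycle `b` is controlled by a
square-integrable function `h` on the elements moving `𝓢` close to itself. -/
structure IsReducedBy (ρ₁ ρ₂ : Γ →* SL(2, ℝ)) (b : Γ → H) (𝓢 : Set (ℍ × ℍ)) (h : ℍ × ℍ → ℝ) :
    Prop where
  meas : MeasurableSet 𝓢
  exists_mem : ∀ z, ∃ γ, act ρ₁ ρ₂ γ z ∈ 𝓢
  nonneg : ∀ z, 0 ≤ h z
  finite : ∀ z, {γ | act ρ₁ ρ₂ γ z ∈ 𝓢}.Finite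
  norm_le : ∀ r, ∃ C, ∀ z ∈ 𝓢, ∀ w, dist w z ≤ r → ∀ δ, act ρ₁ ρ₂ δ⁻¹ w ∈ 𝓢 → ‖b δ‖ ≤ C * h z
  lintegral_ne_top : ∫⁻ z in 𝓢, ENNReal.ofReal (h z) ^ 2 ≠ ∞

/-- The normalized indicator of `𝓢`. -/
noncomputable def weight (ρ₁ ρ₂ : Γ →* SL(2, ℝ)) (𝓢 : Set (ℍ × ℍ)) (z : ℍ × ℍ) : ℝ≥0∞ :=
  𝓢.indicator 1 z * (∑' γ, 𝓢.indicator 1 (act ρ₁ ρ₂ γ z))⁻¹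

/-- The average of `b γ` over the `γ` with `γ⁻¹ z ∈ 𝓢`. -/
noncomputable def orbitMean [NormedSpace ℝ H] (ρ₁ ρ₂ : Γ →* SL(2, ℝ)) (b : Γ → H)
    (𝓢 : Set (ℍ × ℍ)) (z : ℍ × ℍ) : H :=
  ∑' γ, (weight ρ₁ ρ₂ 𝓢 (act ρ₁ ρ₂ γ⁻¹ z)).toReal • b γ

variable {b : Γ → H} {𝓢 : Set (ℍ × ℍ)} {h : ℍ × ℍ → ℝ}

theorem weight_le (z : ℍ × ℍ) : weight ρ₁ ρ₂ 𝓢 z ≤ 𝓢.indicator 1 z := by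
  by_cases hz : z ∈ 𝓢
  · have h1 : 𝓢.indicator 1 (act ρ₁ ρ₂ 1 z) ≤
        ∑' γ, 𝓢.indicator (1 : ℍ × ℍ → ℝ≥0∞) (act ρ₁ ρ₂ γ z) :=
      ENNReal.le_tsum (1 : Γ)
    rw [act_one, Set.indicator_of_mem hz] at h1
    rw [weight, Set.indicator_of_mem hz]
    simpa using h1
  · simp [weight, hz]

theorem mem_of_weight_ne_zero {z : ℍ × ℍ} (hz : weight ρ₁ ρ₂ 𝓢 z ≠ 0) : z ∈ 𝓢 := by
  by_contra h
  simp [weight, h] at hz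

theorem measurable_weight [Countable Γ] (hm : MeasurableSet 𝓢) : Measurable (weight ρ₁ ρ₂ 𝓢) := by
  have h1 : Measurable (𝓢.indicator (1 : ℍ × ℍ → ℝ≥0∞)) := measurable_one.indicator hm
  exact h1.mul (Measurable.tsum fun γ => h1.comp (measurable_act γ)).inv

theorem IsReducedBy.isWeight [Countable Γ] (hS : IsReducedBy ρ₁ ρ₂ b 𝓢 h) :
    IsWeight ρ₁ ρ₂ (weight ρ₁ ρ₂ 𝓢) := by
  refine ⟨measurable_weight hS.meas, fun z w => ?_⟩
  set N : ℝ≥0∞ := ∑' γ, 𝓢.indicator 1 (act ρ₁ ρ₂ γ (z, w)) with hN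
  have hinv : ∀ γ, ∑' γ', 𝓢.indicator (1 : ℍ × ℍ → ℝ≥0∞) (act ρ₁ ρ₂ γ' (act ρ₁ ρ₂ γ (z, w))) = N :=
    fun γ => by
      simp only [← act_mul]
      exact (Equiv.mulRight γ).tsum_eq fun γ' =>
        𝓢.indicator (1 : ℍ × ℍ → ℝ≥0∞) (act ρ₁ ρ₂ γ' (z, w))
  have h0 : N ≠ 0 := by
    obtain ⟨γ, hγ⟩ := hS.exists_mem (z, w)
    intro h0
    have := ENNReal.tsum_eq_zero.1 h0 γ
    simp [hγ] at this
  have htop : N ≠ ∞ := by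
    rw [hN, tsum_eq_sum (s := (hS.finite (z, w)).toFinset) fun γ hγ => ?_]
    · refine ENNReal.sum_ne_top.2 fun γ _ => ?_
      by_cases hγ : act ρ₁ ρ₂ γ (z, w) ∈ 𝓢 <;> simp [hγ]
    · exact Set.indicator_of_notMem (by simpa using hγ) _
  have e : ∀ γ, weight ρ₁ ρ₂ 𝓢 (ρ₁ γ • z, ρ₂ γ • w)
      = 𝓢.indicator 1 (act ρ₁ ρ₂ γ (z, w)) * N⁻¹ := fun γ => by
    rw [← hinv γ]; rfl
  simp only [e]
  rw [ENNReal.tsum_mul_right, ← hN, ENNReal.mul_inv_cancel h0 htop]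

theorem IsReducedBy.finite_inv (hS : IsReducedBy ρ₁ ρ₂ b 𝓢 h) (z : ℍ × ℍ) :
    {γ : Γ | act ρ₁ ρ₂ γ⁻¹ z ∈ 𝓢}.Finite :=
  Set.Finite.preimage (s := {γ | act ρ₁ ρ₂ γ z ∈ 𝓢}) inv_injective.injOn (hS.finite z)

theorem IsReducedBy.hasSum_weight [Countable Γ] (hS : IsReducedBy ρ₁ ρ₂ b 𝓢 h) (z : ℍ × ℍ) :
    HasSum (fun γ => (weight ρ₁ ρ₂ 𝓢 (act ρ₁ ρ₂ γ⁻¹ z)).toReal) 1 := by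
  have h1 : ∑' γ, weight ρ₁ ρ₂ 𝓢 (act ρ₁ ρ₂ γ⁻¹ z) = 1 := by
    rw [← hS.isWeight.tsum_eq z.1 z.2]
    exact (Equiv.inv Γ).tsum_eq fun γ => weight ρ₁ ρ₂ 𝓢 (act ρ₁ ρ₂ γ z)
  have h2 := ENNReal.hasSum_toReal (h1.trans_ne ENNReal.one_ne_top)
  rw [← ENNReal.tsum_toReal_eq fun γ => ?_, h1] at h2
  · simpa using h2
  · exact ENNReal.ne_top_of_tsum_ne_top (h1.trans_ne ENNReal.one_ne_top) γ

variable [NormedSpace ℝ H]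

theorem IsReducedBy.hasSum_orbitMean (hS : IsReducedBy ρ₁ ρ₂ b 𝓢 h) (z : ℍ × ℍ) :
    HasSum (fun γ => (weight ρ₁ ρ₂ 𝓢 (act ρ₁ ρ₂ γ⁻¹ z)).toReal • b γ)
      (orbitMean ρ₁ ρ₂ b 𝓢 z) := by
  refine (summable_of_ne_finset_zero (s := (hS.finite_inv z).toFinset) fun γ hγ => ?_).hasSum
  have : act ρ₁ ρ₂ γ⁻¹ z ∉ 𝓢 := by simpa using hγ
  simp [weight, this]

theorem IsReducedBy.norm_orbitMean_le [Countable Γ] (hS : IsReducedBy ρ₁ ρ₂ b 𝓢 h) {z : ℍ × ℍ}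
    {K : ℝ} (hK : ∀ γ, act ρ₁ ρ₂ γ⁻¹ z ∈ 𝓢 → ‖b γ‖ ≤ K) : ‖orbitMean ρ₁ ρ₂ b 𝓢 z‖ ≤ K := by
  have h1 := (hS.hasSum_weight z).mul_right K
  rw [one_mul] at h1
  refine (hS.hasSum_orbitMean z).norm_le_of_bounded h1 fun γ => ?_
  rw [norm_smul, Real.norm_of_nonneg ENNReal.toReal_nonneg]
  by_cases h0 : weight ρ₁ ρ₂ 𝓢 (act ρ₁ ρ₂ γ⁻¹ z) = 0
  · simp [h0]
  · exact mul_le_mul_of_nonneg_left (hK γ (mem_of_weight_ne_zero h0)) ENNReal.toReal_nonneg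

theorem IsReducedBy.stronglyMeasurable_orbitMean [Countable Γ] (hS : IsReducedBy ρ₁ ρ₂ b 𝓢 h) :
    StronglyMeasurable (orbitMean ρ₁ ρ₂ b 𝓢) := by
  have hw : ∀ γ, StronglyMeasurable fun z =>
      (weight ρ₁ ρ₂ 𝓢 (act ρ₁ ρ₂ γ⁻¹ z)).toReal • b γ := fun γ =>
    (((measurable_weight hS.meas).comp (measurable_act γ⁻¹)).ennreal_toReal
      |>.stronglyMeasurable).smul_const _
  refine stronglyMeasurable_of_tendsto Filter.atTop
    (f := fun (s : Finset Γ) z => ∑ γ ∈ s, (weight ρ₁ ρ₂ 𝓢 (act ρ₁ ρ₂ γ⁻¹ z)).toReal • b γ)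
    (fun s => ?_) (tendsto_pi_nhds.2 fun z => hS.hasSum_orbitMean z)
  exact Finset.stronglyMeasurable_fun_sum s fun γ _ => hw γ

theorem IsReducedBy.isField {H : Type*} [NormedAddCommGroup H] [InnerProductSpace ℝ H]
    {b : Γ → H} {π : Γ → H ≃ₗᵢ[ℝ] H} [Countable Γ] (hb : ∀ γ δ, b (γ * δ) = b γ + π γ (b δ))
    (hS : IsReducedBy ρ₁ ρ₂ b 𝓢 h) : IsField ρ₁ ρ₂ π b (orbitMean ρ₁ ρ₂ b 𝓢) := by
  refine ⟨hS.stronglyMeasurable_orbitMean, fun r => ?_, fun γ z w => ?_⟩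
  · obtain ⟨C, hC⟩ := hS.norm_le r
    obtain ⟨γ₀, h₀⟩ := hS.exists_mem (UpperHalfPlane.I, UpperHalfPlane.I)
    refine ⟨C * h (act ρ₁ ρ₂ γ₀ (UpperHalfPlane.I, UpperHalfPlane.I)) + ‖b γ₀‖,
      fun z w hz hw => hS.norm_orbitMean_le fun γ hγ => ?_⟩
    have h1 := hC _ h₀ (act ρ₁ ρ₂ γ₀ (z, w)) (by rw [dist_act]; exact max_le hz hw) (γ₀ * γ)
      (by rwa [_root_.mul_inv_rev, act_mul, act_inv_act])
    rw [hb] at h1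
    have h2 := norm_sub_le (b γ₀ + π γ₀ (b γ)) (b γ₀)
    rw [add_sub_cancel_left, LinearIsometryEquiv.norm_map] at h2
    linarith
  · have h1 := hS.hasSum_orbitMean (act ρ₁ ρ₂ γ (z, w))
    rw [← (Equiv.mulLeft γ).hasSum_iff] at h1
    refine h1.unique ?_
    have h2 := ((hS.hasSum_orbitMean (z, w)).map (π γ).toLinearEquiv.toLinearMap
      (π γ).continuous).add ((hS.hasSum_weight (z, w)).smul_const (b γ))
    rw [one_smul] at h2
    have e : (π γ).toLinearEquiv.toLinearMap (orbitMean ρ₁ ρ₂ b 𝓢 (z, w))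
        = π γ (orbitMean ρ₁ ρ₂ b 𝓢 (z, w)) := rfl
    rw [e] at h2
    convert h2 using 1
    funext δ
    simp only [Function.comp_apply, Equiv.coe_mulLeft, _root_.mul_inv_rev, act_mul, act_inv_act, hb]
    rw [smul_add, add_comm]
    simp

theorem IsReducedBy.energy_ne_top {H : Type*} [NormedAddCommGroup H] [InnerProductSpace ℝ H]
    {b : Γ → H} [Countable Γ] (hS : IsReducedBy ρ₁ ρ₂ b 𝓢 h) :
    energy (weight ρ₁ ρ₂ 𝓢) (orbitMean ρ₁ ρ₂ b 𝓢) ≠ ∞ := by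
  obtain ⟨C, hC⟩ := hS.norm_le 3
  have hdiff : ∀ z ∈ 𝓢, ∀ w, dist w z ≤ 3 →
      ‖orbitMean ρ₁ ρ₂ b 𝓢 w - orbitMean ρ₁ ρ₂ b 𝓢 z‖ₑ ^ 2
        ≤ ENNReal.ofReal (2 * |C|) ^ 2 * ENNReal.ofReal (h z) ^ 2 := by
    intro z hz w hw
    have h1 := hS.norm_orbitMean_le (z := w) (K := C * h z) fun γ hγ => hC z hz w hw γ hγ
    have h2 := hS.norm_orbitMean_le (z := z) (K := C * h z)
      fun γ hγ => hC z hz z (by simp) γ hγ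
    rw [← mul_pow, ← ofReal_norm, ← ENNReal.ofReal_mul (by positivity)]
    gcongr
    have h3 := norm_sub_le (orbitMean ρ₁ ρ₂ b 𝓢 w) (orbitMean ρ₁ ρ₂ b 𝓢 z)
    have h4 := mul_le_mul_of_nonneg_right (le_abs_self C) (hS.nonneg z)
    linarith
  have hbound : ∀ (z : ℍ × ℍ) (x : ℍ) (u : ℍ → ℍ × ℍ), (∀ w, dist x w < 3 → dist (u w) z ≤ 3) →
      weight ρ₁ ρ₂ 𝓢 z * ∫⁻ w, ker x w *
        ‖orbitMean ρ₁ ρ₂ b 𝓢 (u w) - orbitMean ρ₁ ρ₂ b 𝓢 z‖ₑ ^ 2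
      ≤ 𝓢.indicator (fun z => (ENNReal.ofReal (2 * |C|) ^ 2 * ballVol)
        * ENNReal.ofReal (h z) ^ 2) z := by
    intro z x u hu
    by_cases hz : z ∈ 𝓢
    · rw [Set.indicator_of_mem hz]
      have h1 : weight ρ₁ ρ₂ 𝓢 z ≤ 1 := by
        simpa [hz] using weight_le (ρ₁ := ρ₁) (ρ₂ := ρ₂) (𝓢 := 𝓢) z
      refine (mul_le_of_le_one_left' h1).trans ?_
      calc ∫⁻ w, ker x w * ‖orbitMean ρ₁ ρ₂ b 𝓢 (u w) - orbitMean ρ₁ ρ₂ b 𝓢 z‖ₑ ^ 2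
          ≤ ∫⁻ w, ker x w * (ENNReal.ofReal (2 * |C|) ^ 2 * ENNReal.ofReal (h z) ^ 2) := by
            refine lintegral_mono fun w => ?_
            by_cases hw : dist x w < 3
            · exact mul_le_mul_right (hdiff z hz _ (hu w hw)) _
            · simp [ker, hw]
        _ = _ := by
            rw [lintegral_mul_const _ (by fun_prop), lintegral_ker]
            ring
    · have : weight ρ₁ ρ₂ 𝓢 z = 0 := by simp [weight, hz]
      simp [this]
  have hfin : ∫⁻ z, 𝓢.indicator (fun z => (ENNReal.ofReal (2 * |C|) ^ 2 * ballVol)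
      * ENNReal.ofReal (h z) ^ 2) z ≠ ∞ := by
    rw [lintegral_indicator hS.meas, lintegral_const_mul']
    · exact ENNReal.mul_ne_top (ENNReal.mul_ne_top (by finiteness) ballVol_ne_top)
        hS.lintegral_ne_top
    · exact ENNReal.mul_ne_top (by finiteness) ballVol_ne_top
  refine ENNReal.add_ne_top.2 ⟨ne_top_of_le_ne_top hfin (lintegral_mono fun z => ?_),
    ne_top_of_le_ne_top hfin (lintegral_mono fun z => ?_)⟩
  · refine hbound z z.1 (fun w => (w, z.2)) fun w hw => ?_
    rw [Prod.dist_eq, dist_self, dist_comm]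
    exact max_le hw.le (by norm_num)
  · refine hbound z z.2 (fun w => (z.1, w)) fun w hw => ?_
    rw [Prod.dist_eq, dist_self, dist_comm]
    exact max_le (by norm_num) hw.le

end Reduction

section WordLength

variable {G : Type*} [Group G] {W : Set G}

theorem mem_pow_wordLength (hW : W⁻¹ = W) (hgen : Subgroup.closure W = ⊤) (g : G) :
    g ∈ W ^ wordLength W g := by
  refine Nat.sInf_mem (s := {n : ℕ | g ∈ W ^ n}) ?_
  have hg : g ∈ Subgroup.closure W := hgen ▸ Subgroup.mem_top g
  induction hg using Subgroup.closure_induction with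
  | mem x hx => exact ⟨1, by simpa using hx⟩
  | one => exact ⟨0, by simp⟩
  | mul x y _ _ hx hy =>
    obtain ⟨m, hm⟩ := hx
    obtain ⟨n, hn⟩ := hy
    exact ⟨m + n, by rw [Set.mem_ofPred_eq, pow_add]; exact Set.mul_mem_mul hm hn⟩
  | inv x _ hx =>
    obtain ⟨n, hn⟩ := hx
    refine ⟨n, ?_⟩
    rw [Set.mem_ofPred_eq, ← hW, inv_pow, Set.inv_mem_inv]
    exact hn

theorem exists_abs_le_exp (hW : W.Finite) (ρ : G →* SL(2, ℝ)) :
    ∃ L : ℝ, 0 ≤ L ∧ ∀ n : ℕ, ∀ g ∈ W ^ n, ∀ i j, |(ρ g) i j| ≤ Real.exp (L * n) := by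
  obtain ⟨B, hB⟩ : ∃ B : ℝ, ∀ g ∈ W, ∀ i j, |(ρ g) i j| ≤ B := by
    obtain ⟨B, hB⟩ := (hW.image fun g => ∑ i, ∑ j, |(ρ g) i j|).bddAbove
    refine ⟨B, fun g hg i j => le_trans ?_ (hB ⟨g, hg, rfl⟩)⟩
    refine le_trans ?_ (Finset.single_le_sum (f := fun i => ∑ j, |(ρ g) i j|)
      (fun i _ => Finset.sum_nonneg fun j _ => abs_nonneg _) (Finset.mem_univ i))
    exact Finset.single_le_sum (f := fun j => |(ρ g) i j|) (fun j _ => abs_nonneg _)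
      (Finset.mem_univ j)
  have hL : 2 * B ≤ Real.exp |2 * B| := (le_abs_self _).trans (by
    linarith [Real.add_one_le_exp |2 * B|])
  refine ⟨|2 * B|, abs_nonneg _, fun n => ?_⟩
  induction n with
  | zero =>
    intro g hg i j
    have : g = 1 := by simpa using hg
    subst this
    fin_cases i <;> fin_cases j <;> simp
  | succ n ih =>
    intro g hg i j
    rw [pow_succ] at hg
    obtain ⟨x, hx, y, hy, rfl⟩ := hg
    have e : (ρ (x * y)) i j = (ρ x) i 0 * (ρ y) 0 j + (ρ x) i 1 * (ρ y) 1 j := by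
      rw [map_mul, Matrix.SpecialLinearGroup.coe_mul, Matrix.mul_apply, Fin.sum_univ_two]
    have hmul : ∀ k, |(ρ x) i k * (ρ y) k j| ≤ Real.exp (|2 * B| * n) * B := fun k => by
      rw [abs_mul]
      exact mul_le_mul (ih x hx i k) (hB y hy k j) (abs_nonneg _) (Real.exp_pos _).le
    calc |(ρ (x * y)) i j| ≤ Real.exp (|2 * B| * n) * B + Real.exp (|2 * B| * n) * B := by
          rw [e]; exact (abs_add_le _ _).trans (add_le_add (hmul 0) (hmul 1))
      _ = Real.exp (|2 * B| * n) * (2 * B) := by ring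
      _ ≤ Real.exp (|2 * B| * n) * Real.exp |2 * B| := by gcongr
      _ = _ := by rw [← Real.exp_add]; push_cast; ring_nf

theorem norm_le_of_mem_pow {H : Type*} [NormedAddCommGroup H] [InnerProductSpace ℝ H]
    {π : G → H ≃ₗᵢ[ℝ] H} {c : G → H} (hc : ∀ g h, c (g * h) = c g + π g (c h)) {ε : ℝ}
    (hε : ∀ w ∈ W, ‖c w‖ ≤ ε) (n : ℕ) : ∀ g ∈ W ^ n, ‖c g‖ ≤ ε * n := by
  induction n with
  | zero =>
    intro g hg
    have : g = 1 := by simpa using hg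
    subst this
    have h1 := hc 1 1
    rw [mul_one, left_eq_add, map_eq_zero_iff _ (π 1).injective] at h1
    simp [h1]
  | succ n ih =>
    intro g hg
    rw [pow_succ] at hg
    obtain ⟨x, hx, y, hy, rfl⟩ := hg
    dsimp only
    rw [hc]
    refine (norm_add_le _ _).trans ?_
    rw [LinearIsometryEquiv.norm_map]
    push_cast
    linarith [ih x hx, hε y hy]

end WordLength

section Assembly

variable {Γ H : Type*} [Group Γ] [NormedAddCommGroup H] [InnerProductSpace ℝ H]
  {ρ₁ ρ₂ : Γ →* SL(2, ℝ)} {π : Γ → H ≃ₗᵢ[ℝ] H} {b : Γ → H}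

theorem hasSublinearGrowth_of_isReducedBy [CompleteSpace H] [Countable Γ]
    (hρ : IsProper ρ₁ ρ₂)
    (hd₁ : ∀ (g : SL(2, ℝ)) (z w : ℍ), ∃ γ,
      dist (ρ₁ γ • z) (g • z) < 1 ∧ dist (ρ₁ γ • w) (g • w) < 1)
    (hd₂ : ∀ (g : SL(2, ℝ)) (z w : ℍ), ∃ γ,
      dist (ρ₂ γ • z) (g • z) < 1 ∧ dist (ρ₂ γ • w) (g • w) < 1)
    (hπ : ∀ γ δ x, π (γ * δ) x = π γ (π δ x)) (hb : ∀ γ δ, b (γ * δ) = b γ + π γ (b δ))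
    {𝓢 : Set (ℍ × ℍ)} {h : ℍ × ℍ → ℝ} (hS : IsReducedBy ρ₁ ρ₂ b 𝓢 h)
    {W : Set Γ} (hWfin : W.Finite) (hWsymm : W⁻¹ = W) (hWgen : Subgroup.closure W = ⊤) :
    HasSublinearGrowth W b := by
  obtain ⟨F₁, F₂, v, hF₁, hF₂, hrel, hlim⟩ :=
    exists_split_limit hρ hS.isWeight (hS.isField hb) hS.energy_ne_top
  obtain ⟨C₁, hC₁⟩ := exists_isCoarselyInvariant hd₁ hF₁ fun γ z w => by
    rw [← LinearIsometryEquiv.norm_map (π γ) (F₁ z - F₁ w)]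
    congr 1
    have h1 := hrel γ z UpperHalfPlane.I
    have h2 := hrel γ w UpperHalfPlane.I
    rw [map_add] at h1 h2
    rw [map_sub, eq_sub_of_add_eq h1, eq_sub_of_add_eq h2]
    abel
  obtain ⟨C₂, hC₂⟩ := exists_isCoarselyInvariant hd₂ hF₂ fun γ z w => by
    rw [← LinearIsometryEquiv.norm_map (π γ) (F₂ z - F₂ w)]
    congr 1
    have h1 := hrel γ UpperHalfPlane.I z
    have h2 := hrel γ UpperHalfPlane.I w
    rw [map_add] at h1 h2
    rw [map_sub, eq_sub_of_add_eq' h1, eq_sub_of_add_eq' h2]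
    abel
  set B : Γ → H := fun γ => F₁ (ρ₁ γ • UpperHalfPlane.I) + F₂ (ρ₂ γ • UpperHalfPlane.I) with hB
  have hBc : ∀ γ δ, B (γ * δ) = B γ + π γ (B δ) := fun γ δ => by
    simp only [hB, map_mul, mul_smul]
    rw [hrel γ, add_comm]
  obtain ⟨L₁, hL₁, hW₁⟩ := exists_abs_le_exp hWfin ρ₁
  obtain ⟨L₂, hL₂, hW₂⟩ := exists_abs_le_exp hWfin ρ₂
  intro ε hε
  obtain ⟨M₁, hM₁⟩ := hC₁.sublinear (ε / (8 * (L₁ + 1))) (by positivity)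
  obtain ⟨M₂, hM₂⟩ := hC₂.sublinear (ε / (8 * (L₂ + 1))) (by positivity)
  obtain ⟨n, hn⟩ : ∃ n, ∀ w ∈ W, ‖(b w + π w (v n) - v n) - B w‖ ≤ ε / 4 := by
    have : ∀ᶠ n in Filter.atTop, ∀ w ∈ W, ‖(b w + π w (v n) - v n) - B w‖ ≤ ε / 4 := by
      refine (Filter.eventually_all_finite hWfin).2 fun w _ => ?_
      have h1 := (tendsto_iff_norm_sub_tendsto_zero.1 (hlim w)).eventually_lt_const
        (show (0 : ℝ) < ε / 4 by positivity)
      exact h1.mono fun n hn => hn.le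
    exact this.exists
  have hc : ∀ γ δ, (b (γ * δ) + π (γ * δ) (v n) - v n) - B (γ * δ)
      = ((b γ + π γ (v n) - v n) - B γ) + π γ ((b δ + π δ (v n) - v n) - B δ) := fun γ δ => by
    rw [hb, hBc, hπ, map_sub, map_sub, map_add (π γ) (b δ)]
    abel
  set K : ℝ := M₁ + ‖F₁ UpperHalfPlane.I‖ + (M₂ + ‖F₂ UpperHalfPlane.I‖) + 2 * ‖v n‖ with hK
  have key : ∀ γ, ‖b γ‖ ≤ ε / 2 * wordLength W γ + K := by
    intro γ
    set k := wordLength W γ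
    have hk := mem_pow_wordLength hWsymm hWgen γ
    have h1 := norm_le_of_mem_pow hc hn k γ hk
    have h2 := hM₁ (ρ₁ γ) (L₁ * k) (by positivity) (hW₁ k γ hk)
    have h3 := hM₂ (ρ₂ γ) (L₂ * k) (by positivity) (hW₂ k γ hk)
    have hs : ∀ L : ℝ, 0 ≤ L → ε / (8 * (L + 1)) * (L * k) ≤ ε / 8 * k := fun L hL => by
      have : ε / (8 * (L + 1)) * (L * k) = ε / 8 * k * (L / (L + 1)) := by field_simp
      rw [this]
      exact mul_le_of_le_one_right (by positivity) (by rw [div_le_one (by positivity)]; linarith)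
    have e : b γ = ((b γ + π γ (v n) - v n) - B γ)
        + (F₁ (ρ₁ γ • UpperHalfPlane.I) - F₁ UpperHalfPlane.I)
      + (F₂ (ρ₂ γ • UpperHalfPlane.I) - F₂ UpperHalfPlane.I) + F₁ UpperHalfPlane.I
          + F₂ UpperHalfPlane.I
      - π γ (v n) + v n := by simp only [hB]; abel
    have h4 : ‖π γ (v n)‖ = ‖v n‖ := LinearIsometryEquiv.norm_map _ _
    have n1 := norm_add_le (((b γ + π γ (v n) - v n) - B γ)
      + (F₁ (ρ₁ γ • UpperHalfPlane.I) - F₁ UpperHalfPlane.I)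
      + (F₂ (ρ₂ γ • UpperHalfPlane.I) - F₂ UpperHalfPlane.I) + F₁ UpperHalfPlane.I
      + F₂ UpperHalfPlane.I - π γ (v n)) (v n)
    have n2 := norm_sub_le (((b γ + π γ (v n) - v n) - B γ)
      + (F₁ (ρ₁ γ • UpperHalfPlane.I) - F₁ UpperHalfPlane.I)
      + (F₂ (ρ₂ γ • UpperHalfPlane.I) - F₂ UpperHalfPlane.I) + F₁ UpperHalfPlane.I
      + F₂ UpperHalfPlane.I) (π γ (v n))
    have n3 := norm_add_le (((b γ + π γ (v n) - v n) - B γ)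
      + (F₁ (ρ₁ γ • UpperHalfPlane.I) - F₁ UpperHalfPlane.I)
      + (F₂ (ρ₂ γ • UpperHalfPlane.I) - F₂ UpperHalfPlane.I) + F₁ UpperHalfPlane.I)
      (F₂ UpperHalfPlane.I)
    have n4 := norm_add_le (((b γ + π γ (v n) - v n) - B γ)
      + (F₁ (ρ₁ γ • UpperHalfPlane.I) - F₁ UpperHalfPlane.I)
      + (F₂ (ρ₂ γ • UpperHalfPlane.I) - F₂ UpperHalfPlane.I)) (F₁ UpperHalfPlane.I)
    have n5 := norm_add₃_le (a := (b γ + π γ (v n) - v n) - B γ)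
      (b := F₁ (ρ₁ γ • UpperHalfPlane.I) - F₁ UpperHalfPlane.I)
      (c := F₂ (ρ₂ γ • UpperHalfPlane.I) - F₂ UpperHalfPlane.I)
    rw [← e] at n1
    have := hs L₁ hL₁
    have := hs L₂ hL₂
    linarith
  refine ⟨⌈2 * K / ε⌉₊, fun γ hγ => (key γ).trans_lt ?_⟩
  have h1 : 2 * K / ε < wordLength W γ := Nat.lt_of_ceil_lt hγ
  rw [div_lt_iff₀ hε] at h1
  linarith

end Assembly

section Embeddings

variable {d : ℤ}

/-- The two real embeddings of `ℤ[√d]`. -/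
noncomputable def emb (hd : 0 ≤ d) : Fin 2 → (ℤ√d →+* ℝ) :=
  ![Zsqrtd.toReal hd, (Zsqrtd.toReal hd).comp (starRingEnd (ℤ√d))]

variable (hd : 0 ≤ d)

theorem emb_zero_apply (x : ℤ√d) : emb hd 0 x = x.re + x.im * √(d : ℝ) := by
  simp [emb, Zsqrtd.toReal_apply]

theorem emb_one_apply (x : ℤ√d) : emb hd 1 x = x.re - x.im * √(d : ℝ) := by
  simp [emb, Zsqrtd.toReal_apply, starRingEnd_apply, sub_eq_add_neg]

theorem emb_mul_emb (x : ℤ√d) : emb hd 0 x * emb hd 1 x = (x.norm : ℝ) := by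
  have h : √(d : ℝ) * √(d : ℝ) = d := Real.mul_self_sqrt (by exact_mod_cast hd)
  rw [emb_zero_apply, emb_one_apply, Zsqrtd.norm_def]
  push_cast
  linear_combination -(x.im : ℝ) * x.im * h

theorem one_le_sqrt (hd : 0 ≤ d) (hns : ¬IsSquare d) : 1 ≤ √(d : ℝ) := by
  have h1 : (1 : ℤ) ≤ d := by
    rcases hd.eq_or_lt with h | h
    · exact absurd (h ▸ IsSquare.zero) hns
    · exact h
  exact Real.one_le_sqrt.2 (by exact_mod_cast h1)

theorem norm_ne_zero (hns : ¬IsSquare d) {x : ℤ√d} (hx : x ≠ 0) : x.norm ≠ 0 := fun h =>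
  hx ((Zsqrtd.norm_eq_zero (fun n hn => hns ⟨n, hn⟩) x).1 h)

theorem one_le_abs_emb_mul (hns : ¬IsSquare d) {x : ℤ√d} (hx : x ≠ 0) :
    1 ≤ |emb hd 0 x| * |emb hd 1 x| := by
  rw [← abs_mul, emb_mul_emb, ← Int.cast_abs]
  exact_mod_cast Int.one_le_abs (norm_ne_zero hns hx)

theorem emb_ne_zero (hns : ¬IsSquare d) {x : ℤ√d} (hx : x ≠ 0) (j : Fin 2) : emb hd j x ≠ 0 := by
  have h := one_le_abs_emb_mul hd hns hx
  intro h0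
  fin_cases j <;> simp_all <;> linarith

theorem emb_injective (hns : ¬IsSquare d) (j : Fin 2) : Function.Injective (emb hd j) :=
  (injective_iff_map_eq_zero _).2 fun _ h => by_contra fun hx => emb_ne_zero hd hns hx j h

theorem finite_abs_emb_le (hns : ¬IsSquare d) (B : ℝ) : {x | ∀ j, |emb hd j x| ≤ B}.Finite := by
  have h1 := one_le_sqrt hd hns
  refine Set.Finite.subset (((Set.finite_Icc (-⌈B⌉) ⌈B⌉).prod (Set.finite_Icc (-⌈B⌉) ⌈B⌉)).image
    fun p => (⟨p.1, p.2⟩ : ℤ√d)) fun x hx => ?_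
  have h0 := hx 0
  have h2 := hx 1
  rw [emb_zero_apply, abs_le] at h0
  rw [emb_one_apply, abs_le] at h2
  have hre : |(x.re : ℝ)| ≤ B := abs_le.2 ⟨by linarith, by linarith⟩
  have him : |(x.im : ℝ)| ≤ B := by
    have : |(x.im : ℝ) * √(d : ℝ)| ≤ B := abs_le.2 ⟨by linarith, by linarith⟩
    rw [abs_mul, abs_of_nonneg (Real.sqrt_nonneg _)] at this
    nlinarith [abs_nonneg (x.im : ℝ)]
  refine ⟨(x.re, x.im), ⟨?_, ?_⟩, rfl⟩ <;>
  · rw [Set.mem_Icc, ← abs_le]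
    have := Int.le_ceil B
    rify
    linarith

theorem finite_matrix_abs_emb_le (hns : ¬IsSquare d) (B : ℝ) :
    {M : Matrix (Fin 2) (Fin 2) (ℤ√d) | ∀ j i k, |emb hd j (M i k)| ≤ B}.Finite := by
  refine (Set.Finite.pi' fun _ : Fin 2 => Set.Finite.pi' fun _ : Fin 2 =>
    finite_abs_emb_le hd hns B).subset fun M hM => ?_
  exact fun i k j => hM j i k

theorem exists_emb_eq (hd : 0 ≤ d) (hns : ¬IsSquare d) (s : Fin 2 → ℝ) :
    ∃ u v : ℝ, s 0 = u + v * √(d : ℝ) ∧ s 1 = u - v * √(d : ℝ) := by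
  have h1 := one_le_sqrt hd hns
  have h2 : √(d : ℝ) ≠ 0 := by linarith
  exact ⟨(s 0 + s 1) / 2, (s 0 - s 1) / (2 * √(d : ℝ)), by field_simp; ring, by field_simp; ring⟩

theorem abs_add_mul_le {u v s ε : ℝ} (hs : 0 ≤ s) (hu : |u| ≤ ε) (hv : |v| ≤ ε) :
    |u + v * s| ≤ (1 + s) * ε ∧ |u - v * s| ≤ (1 + s) * ε := by
  have h : |v * s| ≤ ε * s := by
    rw [abs_mul, abs_of_nonneg hs]
    gcongr
  exact ⟨(abs_add_le _ _).trans (by linarith), (abs_sub _ _).trans (by linarith)⟩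

theorem exists_abs_sub_emb_le (hns : ¬IsSquare d) (s : Fin 2 → ℝ) :
    ∃ t, ∀ j, |s j - emb hd j t| ≤ 1 + √(d : ℝ) := by
  obtain ⟨u, v, h0, h1⟩ := exists_emb_eq hd hns s
  have hu := (abs_sub_round u).trans (by norm_num : (1 / 2 : ℝ) ≤ 1)
  have hv := (abs_sub_round v).trans (by norm_num : (1 / 2 : ℝ) ≤ 1)
  have h := abs_add_mul_le (Real.sqrt_nonneg d) hu hv
  rw [mul_one] at h
  refine ⟨⟨round u, round v⟩, fun j => ?_⟩
  fin_cases j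
  · convert h.1 using 2
    simp only [Fin.zero_eta, emb_zero_apply, h0]
    ring
  · convert h.2 using 2
    simp only [Fin.mk_one, emb_one_apply, h1]
    ring

theorem exists_pigeonhole {ι : Type*} {s : Finset ι} {n : ℕ} (hn : 0 < n) (hs : n ^ 2 < s.card)
    (u v : ι → ℝ) : ∃ i ∈ s, ∃ j ∈ s, i ≠ j ∧ ∃ a b : ℤ,
      |u i - u j - a| ≤ 1 / n ∧ |v i - v j - b| ≤ 1 / n := by
  have hn' : (0 : ℝ) < n := by exact_mod_cast hn
  have hmem (x : ℝ) : ⌊n * Int.fract x⌋₊ < n := by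
    rw [Nat.floor_lt (by positivity)]
    nlinarith [Int.fract_lt_one x]
  obtain ⟨i, hi, j, hj, hij, h⟩ := Finset.exists_ne_map_eq_of_card_lt_of_maps_to
    (s := s) (t := Finset.range n ×ˢ Finset.range n)
    (f := fun i => (⌊n * Int.fract (u i)⌋₊, ⌊n * Int.fract (v i)⌋₊))
    (by simpa [← sq] using hs) (fun i _ => by simp [hmem])
  have key (x y : ℝ) (h : ⌊n * Int.fract x⌋₊ = ⌊n * Int.fract y⌋₊) :
      |x - y - ((⌊x⌋ - ⌊y⌋ : ℤ) : ℝ)| ≤ 1 / n := by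
    have e : x - y - ((⌊x⌋ - ⌊y⌋ : ℤ) : ℝ) = Int.fract x - Int.fract y := by
      simp only [Int.fract]
      push_cast
      ring
    have h1 := Nat.floor_le (a := n * Int.fract x) (by positivity)
    have h2 := Nat.floor_le (a := n * Int.fract y) (by positivity)
    have h3 := Nat.lt_floor_add_one (n * Int.fract x)
    have h4 := Nat.lt_floor_add_one (n * Int.fract y)
    rw [h] at h1 h3
    rw [e, abs_le, neg_le_iff_add_nonneg, le_div_iff₀ hn', ← mul_le_mul_iff_of_pos_right hn',
        add_mul, zero_mul,
      one_div_mul_cancel hn'.ne']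
    constructor <;> linarith
  rw [Prod.mk.injEq] at h
  exact ⟨i, hi, j, hj, hij, _, _, key _ _ h.1, key _ _ h.2⟩

theorem exists_abs_sub_sub_emb_le (hns : ¬IsSquare d) {ι : Type*} {s : Finset ι} {n : ℕ}
    (hn : 0 < n) (hs : n ^ 2 < s.card) (f : ι → Fin 2 → ℝ) :
    ∃ i ∈ s, ∃ j ∈ s, i ≠ j ∧ ∃ t, ∀ k, |f i k - f j k - emb hd k t| ≤
        (1 + √(d : ℝ)) * (1 / n) := by
  choose u v h0 h1 using fun i => exists_emb_eq hd hns (f i)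
  obtain ⟨i, hi, j, hj, hij, a, b, hu, hv⟩ := exists_pigeonhole hn hs u v
  have h := abs_add_mul_le (Real.sqrt_nonneg d) hu hv
  refine ⟨i, hi, j, hj, hij, ⟨a, b⟩, fun k => ?_⟩
  fin_cases k
  · convert h.1 using 2
    simp only [Fin.zero_eta, emb_zero_apply, h0]
    ring
  · convert h.2 using 2
    simp only [Fin.mk_one, emb_one_apply, h1]
    ring

theorem irrational_sqrt (hd : 0 ≤ d) (hns : ¬IsSquare d) : Irrational √(d : ℝ) :=
  (irrational_sqrt_intCast_iff_of_nonneg hd).2 hns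

theorem dense_range_emb (hns : ¬IsSquare d) (j : Fin 2) : Dense (Set.range (emb hd j)) := by
  have key : ∀ s : ℝ, Irrational s → (∀ a b : ℤ, a + b * s ∈ (emb hd j).range) →
      Dense (Set.range (emb hd j)) := fun s hs h => by
    have h1 : Dense (AddSubgroup.closure {1, s} : Set ℝ) := by
      rw [dense_addSubgroupClosure_pair_iff]
      simpa using hs
    refine h1.mono ?_
    change (AddSubgroup.closure {1, s} : Set ℝ) ⊆ ((emb hd j).range.toAddSubgroup : Set ℝ)
    rw [SetLike.coe_subset_coe, AddSubgroup.closure_le]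
    rintro x (rfl | rfl)
    · exact ⟨1, map_one _⟩
    · simpa using h 0 1
  have hirr := irrational_sqrt hd hns
  fin_cases j
  · exact key _ hirr fun a b => ⟨⟨a, b⟩, emb_zero_apply hd _⟩
  · refine key _ hirr fun a b => ⟨⟨a, -b⟩, ?_⟩
    simp [emb_one_apply hd]

/-- The action of `SL(2, ℤ[√d])` through the two embeddings. -/
noncomputable def rho (j : Fin 2) : SL(2, ℤ√d) →* SL(2, ℝ) :=
  Matrix.SpecialLinearGroup.map (emb hd j)

theorem exists_dist_rho_smul_lt (hns : ¬IsSquare d) (j : Fin 2) (g : SL(2, ℝ)) (z w : ℍ) :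
    ∃ γ, dist (rho hd j γ • z) (g • z) < 1 ∧ dist (rho hd j γ • w) (g • w) < 1 := by
  refine exists_dist_smul_lt (fun s => ?_) ⟨inversion _, ?_⟩ g z w
  · have h := (continuous_upper.range_subset_closure_image_dense (dense_range_emb hd hns j))
      ⟨s, rfl⟩
    refine closure_mono ?_ h
    rintro _ ⟨_, ⟨t, rfl⟩, rfl⟩
    refine ⟨upper t, Subtype.ext ?_⟩
    ext i k
    change emb hd j (!![1, t; 0, 1] i k) = !![1, emb hd j t; 0, 1] i k
    fin_cases i <;> fin_cases k <;> simp
  · apply Subtype.ext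
    ext i k
    change emb hd j (!![0, -1; 1, 0] i k) = (!![0, -1; 1, 0] : Matrix _ _ ℝ) i k
    fin_cases i <;> fin_cases k <;> simp

end Embeddings

section Normalization

/-- The multiple of determinant `1` of a real matrix with positive determinant. -/
noncomputable def nrm (A : Matrix (Fin 2) (Fin 2) ℝ) : SL(2, ℝ) :=
  if h : 0 < A.det then ⟨(√A.det)⁻¹ • A, by
    rw [det_smul, Fintype.card_fin, inv_pow, Real.sq_sqrt h.le, inv_mul_cancel₀ h.ne']⟩ else 1

variable {A B : Matrix (Fin 2) (Fin 2) ℝ}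

theorem coe_nrm (hA : 0 < A.det) : (nrm A).1 = (√A.det)⁻¹ • A :=
  congrArg Subtype.val (dif_pos hA)

theorem nrm_apply (hA : 0 < A.det) (i k : Fin 2) : nrm A i k = (√A.det)⁻¹ * A i k := by
  rw [coe_nrm hA, Matrix.smul_apply, smul_eq_mul]

theorem nrm_mul (hA : 0 < A.det) (hB : 0 < B.det) : nrm (A * B) = nrm A * nrm B := by
  apply Subtype.ext
  have h : 0 < (A * B).det := by
    rw [det_mul]
    positivity
  rw [Matrix.SpecialLinearGroup.coe_mul, coe_nrm hA, coe_nrm hB, coe_nrm h, det_mul,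
    Real.sqrt_mul hA.le, Matrix.smul_mul, Matrix.mul_smul, smul_smul, _root_.mul_inv]

theorem nrm_coe (g : SL(2, ℝ)) : nrm g.1 = g := by
  apply Subtype.ext
  rw [coe_nrm (by rw [g.2]; exact one_pos), g.2, Real.sqrt_one, inv_one, one_smul]

theorem nrm_smul {c : ℝ} (hc : 0 < c) (hA : 0 < A.det) : nrm (c • A) = nrm A := by
  apply Subtype.ext
  have h : (c • A).det = c ^ 2 * A.det := by rw [det_smul, Fintype.card_fin]
  rw [coe_nrm hA, coe_nrm (by rw [h]; positivity), h, Real.sqrt_mul (by positivity),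
    Real.sqrt_sq hc.le, smul_smul]
  congr 1
  field_simp

theorem im_nrm_smul (hA : 0 < A.det) (z : ℍ) : (nrm A • z).im =
    A.det * z.im / ((A 1 0 * z.re + A 1 1) ^ 2 + (A 1 0 * z.im) ^ 2) := by
  have h := Real.sq_sqrt hA.le
  have h0 : √A.det ≠ 0 := (Real.sqrt_pos.2 hA).ne'
  rw [im_smul_eq, nrm_apply hA, nrm_apply hA]
  have e : ((√A.det)⁻¹ * A 1 0 * z.re + (√A.det)⁻¹ * A 1 1) ^ 2 + ((√A.det)⁻¹ * A 1 0 * z.im) ^ 2 =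
      ((A 1 0 * z.re + A 1 1) ^ 2 + (A 1 0 * z.im) ^ 2) / A.det := by
    field_simp
    rw [h, mul_comm]
  rw [e]
  field_simp

theorem abs_apply_le {g : SL(2, ℝ)} {r : ℝ} (h : dist (g • UpperHalfPlane.I) UpperHalfPlane.I ≤ r)
    (i k : Fin 2) : |g i k| ≤ Real.exp r := by
  have hr : 0 ≤ r := dist_nonneg.trans h
  have key : ∀ g : SL(2, ℝ), dist (g • UpperHalfPlane.I) UpperHalfPlane.I ≤ r →
      ∀ k, |g 1 k| ≤ Real.exp r := fun g h k => by
    have h1 := im_div_exp_dist_le UpperHalfPlane.I (g • UpperHalfPlane.I)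
    have h0 := smul_denom_pos g UpperHalfPlane.I
    rw [dist_comm, im_smul_eq, le_div_iff₀ h0] at h1
    simp only [UpperHalfPlane.I_im, UpperHalfPlane.I_re, mul_zero, zero_add, mul_one, one_div,
      inv_mul_le_iff₀ (Real.exp_pos _)] at h1
    have h2 := Real.exp_le_exp.2 h
    have h3 : 1 ≤ Real.exp r := Real.one_le_exp hr
    refine abs_le_of_sq_le_sq ?_ (by positivity)
    have : g 1 k ^ 2 ≤ g 1 1 ^ 2 + g 1 0 ^ 2 := by
      fin_cases k <;> simp <;> positivity
    nlinarith
  fin_cases i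
  · have hI : inversion ℝ • UpperHalfPlane.I = UpperHalfPlane.I := by
      refine ext_re_im ?_ ?_
      · rw [re_smul_eq, coe_inversion]
        simp
      · rw [im_smul_eq, coe_inversion]
        simp
    have h1 := key (inversion ℝ * g) (by rwa [mul_smul, ← hI, dist_smul, hI]) k
    rw [Matrix.SpecialLinearGroup.coe_mul, coe_inversion] at h1
    simpa [Matrix.mul_apply, Fin.sum_univ_two] using h1
  · exact key g h k

theorem exists_dist_I_le (R c : ℝ) : ∃ r, ∀ z : ℍ, |z.re| ≤ R → 0 < c → c ≤ z.im → z.im ≤ R →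
    dist z UpperHalfPlane.I ≤ r := by
  refine ⟨R / c + (|Real.log c| + |Real.log R|), fun z h1 hc h2 h3 => ?_⟩
  have hy := z.im_pos
  rw [← pt_re_im z, ← pt_zero_one]
  refine (dist_triangle _ (pt 0 z.im) _).trans (add_le_add ?_ ?_)
  · refine (dist_pt_le _ _ hy).trans ?_
    rw [sub_zero]
    have : 0 ≤ R := (abs_nonneg _).trans h1
    gcongr
  · rw [dist_pt_pt 0 hy one_pos]
    have h4 := Real.log_le_log hc h2
    have h5 := Real.log_le_log hy h3
    simp only [Real.log_one, sub_zero]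
    exact abs_le.2 ⟨by linarith [neg_abs_le (Real.log c), abs_nonneg (Real.log R)],
      by linarith [le_abs_self (Real.log R), abs_nonneg (Real.log c)]⟩

end Normalization

section Integral

variable {d : ℤ} (hd : 0 ≤ d)

/-- The element of `SL(2, ℝ)` given by a matrix over `ℤ[√d]` of positive determinant. -/
noncomputable def nm (j : Fin 2) (M : Matrix (Fin 2) (Fin 2) (ℤ√d)) : SL(2, ℝ) :=
  nrm (M.map (emb hd j))

variable {M M' : Matrix (Fin 2) (Fin 2) (ℤ√d)} {m n : ℕ}

theorem det_map_emb (hM : M.det = (m : ℤ√d)) (j : Fin 2) : (M.map (emb hd j)).det = m := by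
  have h := (emb hd j).map_det M
  rw [hM, map_natCast] at h
  exact h.symm

theorem det_map_emb_pos (hM : M.det = (m : ℤ√d)) (hm : 0 < m) (j : Fin 2) :
    0 < (M.map (emb hd j)).det := by
  rw [det_map_emb hd hM]
  exact_mod_cast hm

theorem nm_mul (hM : M.det = (m : ℤ√d)) (hm : 0 < m) (hM' : M'.det = (n : ℤ√d)) (hn : 0 < n)
    (j : Fin 2) : nm hd j (M * M') = nm hd j M * nm hd j M' := by
  rw [nm, Matrix.map_mul]
  exact nrm_mul (det_map_emb_pos hd hM hm j) (det_map_emb_pos hd hM' hn j)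

theorem nm_coe (γ : SL(2, ℤ√d)) (j : Fin 2) : nm hd j γ.1 = rho hd j γ :=
  nrm_coe (rho hd j γ)

theorem nm_smul (hM : M.det = (m : ℤ√d)) (hm : 0 < m) (hn : 0 < n) (j : Fin 2) :
    nm hd j ((n : ℤ√d) • M) = nm hd j M := by
  have h : ((n : ℤ√d) • M).map (emb hd j) = (n : ℝ) • M.map (emb hd j) := by
    ext i k
    simp
  rw [nm, h]
  exact nrm_smul (by exact_mod_cast hn) (det_map_emb_pos hd hM hm j)

/-- The squared modulus of the denominator of the Moebius action of the bottom row `(c, e)`. -/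
noncomputable def den (j : Fin 2) (c e : ℤ√d) (z : ℍ) : ℝ :=
  (emb hd j c * z.re + emb hd j e) ^ 2 + (emb hd j c * z.im) ^ 2

theorem im_nm_smul (hM : M.det = (m : ℤ√d)) (hm : 0 < m) (j : Fin 2) (z : ℍ) :
    (nm hd j M • z).im = m * z.im / den hd j (M 1 0) (M 1 1) z := by
  rw [nm, im_nrm_smul (det_map_emb_pos hd hM hm j), det_map_emb hd hM]
  rfl

theorem finite_setOf_dist_le (hns : ¬IsSquare d) (hm : 0 < m) (r : ℝ) :
    {M : Matrix (Fin 2) (Fin 2) (ℤ√d) | M.det = (m : ℤ√d) ∧ ∀ j, ∃ z,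
      dist z UpperHalfPlane.I ≤ r ∧ dist (nm hd j M • z) UpperHalfPlane.I ≤ r}.Finite := by
  refine (finite_matrix_abs_emb_le hd hns (√m * Real.exp (2 * r))).subset ?_
  rintro M ⟨hM, h⟩ j i k
  obtain ⟨z, hz, hz'⟩ := h j
  have hI : dist (nm hd j M • UpperHalfPlane.I) UpperHalfPlane.I ≤ 2 * r := by
    have h1 := dist_triangle (nm hd j M • UpperHalfPlane.I) (nm hd j M • z) UpperHalfPlane.I
    rw [dist_smul, dist_comm _ z] at h1
    linarith
  have h1 := abs_apply_le hI i k
  have hm' : (0 : ℝ) < √m := Real.sqrt_pos.2 (by exact_mod_cast hm)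
  rw [nm, nrm_apply (det_map_emb_pos hd hM hm j), det_map_emb hd hM, abs_mul, abs_inv,
    abs_of_pos hm', inv_mul_le_iff₀ hm'] at h1
  exact h1

theorem isProper_rho (hns : ¬IsSquare d) : IsProper (rho hd 0) (rho hd 1) := fun r => by
  refine ((finite_setOf_dist_le hd hns one_pos r).preimage
    Subtype.val_injective.injOn).subset ?_
  rintro (γ : SL(2, ℤ√d)) ⟨z, w, hz, hw, hz', hw'⟩
  refine ⟨by rw [γ.2, Nat.cast_one], fun j => ?_⟩
  rw [nm_coe hd γ]
  fin_cases j
  exacts [⟨z, hz, hz'⟩, ⟨w, hw, hw'⟩]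

theorem le_den_mul_den (hns : ¬IsSquare d) {c : ℤ√d} (hc : c ≠ 0) (e : ℤ√d) (z w : ℍ) :
    (z.im * w.im) ^ 2 ≤ den hd 0 c e z * den hd 1 c e w := by
  have h := one_le_abs_emb_mul hd hns hc
  have h1 : (emb hd 0 c * z.im) ^ 2 ≤ den hd 0 c e z := le_add_of_nonneg_left (sq_nonneg _)
  have h2 : (emb hd 1 c * w.im) ^ 2 ≤ den hd 1 c e w := le_add_of_nonneg_left (sq_nonneg _)
  have h3 : 1 ≤ (emb hd 0 c * emb hd 1 c) ^ 2 := by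
    rw [← sq_abs, abs_mul]
    exact one_le_pow₀ h
  calc _ ≤ (emb hd 0 c * emb hd 1 c) ^ 2 * (z.im * w.im) ^ 2 :=
      le_mul_of_one_le_left (sq_nonneg _) h3
    _ = (emb hd 0 c * z.im) ^ 2 * (emb hd 1 c * w.im) ^ 2 := by ring
    _ ≤ _ := mul_le_mul h1 h2 (sq_nonneg _) ((sq_nonneg _).trans h1)

theorem one_le_den_mul_den (hns : ¬IsSquare d) {e : ℤ√d} (he : e ≠ 0) (z w : ℍ) :
    1 ≤ den hd 0 0 e z * den hd 1 0 e w := by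
  have h := one_le_abs_emb_mul hd hns he
  have e1 : den hd 0 0 e z * den hd 1 0 e w = (|emb hd 0 e| * |emb hd 1 e|) ^ 2 := by
    rw [← abs_mul, sq_abs]
    simp only [den, map_zero]
    ring
  rw [e1]
  exact one_le_pow₀ h

theorem im_mul_im_le_of_ne_zero (hns : ¬IsSquare d) (hM : M.det = (m : ℤ√d)) (hm : 0 < m)
    (hc : M 1 0 ≠ 0) (z w : ℍ) :
    (nm hd 0 M • z).im * (nm hd 1 M • w).im * (z.im * w.im) ≤ m ^ 2 := by
  have h := le_den_mul_den hd hns hc (M 1 1) z w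
  have hz := z.im_pos
  have hw := w.im_pos
  have hpos : 0 < den hd 0 (M 1 0) (M 1 1) z * den hd 1 (M 1 0) (M 1 1) w :=
      lt_of_lt_of_le (by positivity) h
  rw [im_nm_smul hd hM hm, im_nm_smul hd hM hm, div_mul_div_comm, div_mul_eq_mul_div,
    div_le_iff₀ hpos]
  calc _ = (m : ℝ) ^ 2 * (z.im * w.im) ^ 2 := by ring
    _ ≤ _ := by gcongr

theorem im_mul_im_le_of_eq_zero (hns : ¬IsSquare d) (hM : M.det = (m : ℤ√d)) (hm : 0 < m)
    (hc : M 1 0 = 0) (z w : ℍ) :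
    (nm hd 0 M • z).im * (nm hd 1 M • w).im ≤ m ^ 2 * (z.im * w.im) := by
  have he : M 1 1 ≠ 0 := fun he => by
    rw [det_fin_two, hc, he, mul_zero, mul_zero, sub_zero, eq_comm, Nat.cast_eq_zero] at hM
    exact hm.ne' hM
  have h := one_le_den_mul_den hd hns he z w
  have hz := z.im_pos
  have hw := w.im_pos
  rw [im_nm_smul hd hM hm, im_nm_smul hd hM hm, div_mul_div_comm, hc, div_le_iff₀ (by linarith)]
  calc _ = (m : ℝ) ^ 2 * (z.im * w.im) * 1 := by ring
    _ ≤ _ := by gcongr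

end Integral

section Arithmetic

variable {d : ℤ} (hd : 0 ≤ d)

theorem exists_mul_eq_mul (hd : 0 ≤ d) (hns : ¬IsSquare d) {α : ℤ√d} (hα : α ≠ 0) (β : ℤ√d) {n : ℕ}
    (hn : 1 + √(d : ℝ) < n) : ∃ (t : ℤ) (ω : ℤ√d), t ≠ 0 ∧ t.natAbs ≤ n ^ 2 ∧
      (t * β - ω * α).norm.natAbs < α.norm.natAbs := by
  have hn0 : (0 : ℝ) < n := by linarith [Real.sqrt_nonneg (d : ℝ)]
  have hn1 : 0 < n := by exact_mod_cast hn0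
  obtain ⟨i, hi, j, hj, hij, ω, h⟩ := exists_abs_sub_sub_emb_le hd hns hn1
    (s := Finset.range (n ^ 2 + 1)) (by simp) fun i k => i * emb hd k β / emb hd k α
  simp only [Finset.mem_range] at hi hj
  refine ⟨(i : ℤ) - j, ω, by omega, by omega, ?_⟩
  set θ := (1 + √(d : ℝ)) * (1 / n) with hθ
  have hθ1 : θ < 1 := by
    rw [hθ, mul_one_div, div_lt_one hn0]
    exact hn
  have hθ0 : 0 ≤ θ := by positivity
  have key (k : Fin 2) : |emb hd k ((((i : ℤ) - j : ℤ) : ℤ√d) * β - ω * α)| ≤ θ * |emb hd k α| := by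
    have h0 := emb_ne_zero hd hns hα k
    refine le_trans (le_of_eq ?_) (mul_le_mul_of_nonneg_right (h k) (abs_nonneg _))
    rw [← abs_mul]
    congr 1
    simp only [map_sub, map_mul, map_intCast]
    push_cast
    field_simp
  have hα1 := one_le_abs_emb_mul hd hns hα
  zify
  have e (x : ℤ√d) : ((|x.norm| : ℤ) : ℝ) = |emb hd 0 x| * |emb hd 1 x| := by
    rw [← abs_mul, emb_mul_emb, Int.cast_abs]
  rw [← Int.cast_lt (R := ℝ), e, e]
  calc _ ≤ θ * |emb hd 0 α| * (θ * |emb hd 1 α|) := by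
        gcongr
        exacts [key 0, key 1]
    _ = (θ * θ) * (|emb hd 0 α| * |emb hd 1 α|) := by ring
    _ < 1 * (|emb hd 0 α| * |emb hd 1 α|) := by
        gcongr
        nlinarith
    _ = _ := one_mul _

/-- Up to a bounded factor, every nonzero pair is a multiple of the bottom row of a matrix of fixed
determinant. -/
theorem exists_content (hd : 0 ≤ d) (hns : ¬IsSquare d) :
    ∃ N : ℕ, 0 < N ∧ ∀ c e : ℤ√d, (c ≠ 0 ∨ e ≠ 0) →
    ∃ α c' e' a b : ℤ√d, α ≠ 0 ∧ α * c' = N * c ∧ α * e' = N * e ∧ a * e' - b * c' = N := by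
  obtain ⟨n, hn⟩ := exists_nat_gt (1 + √(d : ℝ))
  refine ⟨(n ^ 2).factorial, Nat.factorial_pos _, fun c e hce => ?_⟩
  set N := (n ^ 2).factorial
  obtain ⟨α, ⟨⟨p, q, hpq⟩, hα⟩, hmin⟩ := (measure fun x : ℤ√d => x.norm.natAbs).wf.has_min
    {α | (∃ p q, α = p * c + q * e) ∧ α ≠ 0} (by
      rcases hce with h | h
      exacts [⟨c, ⟨1, 0, by ring⟩, h⟩, ⟨e, ⟨0, 1, by ring⟩, h⟩])
  have key : ∀ β, (∃ p q, β = p * c + q * e) → ∃ β', α * β' = N * β := by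
    rintro β ⟨p', q', rfl⟩
    obtain ⟨t, ω, ht, ht', h⟩ := exists_mul_eq_mul hd hns hα (p' * c + q' * e) hn
    have h0 : t * (p' * c + q' * e) - ω * α = 0 := by
      by_contra h0
      refine hmin _ ⟨⟨t * p' - ω * p, t * q' - ω * q, ?_⟩, h0⟩ h
      rw [hpq]
      ring
    have hdvd : t ∣ (N : ℤ) := by
      rw [← Int.natAbs_dvd, Int.natCast_dvd_natCast]
      exact Nat.dvd_factorial (Int.natAbs_pos.2 ht) ht'
    obtain ⟨m, hm⟩ := hdvd
    refine ⟨m * ω, ?_⟩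
    have hm' : (N : ℤ√d) = t * m := by exact_mod_cast congrArg (Int.cast : ℤ → ℤ√d) hm
    rw [hm']
    linear_combination -(m : ℤ√d) * h0
  obtain ⟨c', hc'⟩ := key c ⟨1, 0, by ring⟩
  obtain ⟨e', he'⟩ := key e ⟨0, 1, by ring⟩
  refine ⟨α, c', e', q, -p, hα, hc', he', ?_⟩
  have : IsDomain (ℤ√d) := (emb_injective hd hns 0).isDomain _
  refine mul_left_cancel₀ hα ?_
  linear_combination q * he' + p * hc' - N * hpq

theorem exists_unit (hns : ¬IsSquare d) {N : ℕ} (hN : 0 < N) :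
    ∃ (u : (ℤ√d)ˣ) (x x' : ℤ√d) (τ : ℕ), (u : ℤ√d) = 1 + N * x ∧
        ((u⁻¹ : (ℤ√d)ˣ) : ℤ√d) = 1 + N * x' ∧
      4 ≤ emb hd 0 u ∧ emb hd 1 u = (emb hd 0 u)⁻¹ ∧ 16 ≤ τ ∧
      (u : ℤ√d) ^ 2 + ((u⁻¹ : (ℤ√d)ˣ) : ℤ√d) ^ 2 = τ := by
  have hd0 : 0 < d := hd.lt_of_ne fun h => hns (h ▸ IsSquare.zero)
  have hs1 := one_le_sqrt hd hns
  have hN1 : (1 : ℝ) ≤ N := by exact_mod_cast hN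
  obtain ⟨x, y, h, hy⟩ := Pell.exists_of_not_isSquare (d := d * N ^ 2) (by positivity) (by
    rintro ⟨m, hm⟩
    have hdvd : (N : ℤ) ^ 2 ∣ m ^ 2 := ⟨d, by rw [sq m, ← hm]; ring⟩
    obtain ⟨k, rfl⟩ := (Int.pow_dvd_pow_iff two_ne_zero).1 hdvd
    refine hns ⟨k, ?_⟩
    have hN' : (N : ℤ) ^ 2 ≠ 0 := by positivity
    refine mul_right_cancel₀ hN' ?_
    linear_combination hm)
  wlog hx : 0 ≤ x generalizing x
  · exact this (-x) (by linear_combination h) (by omega)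
  wlog hy0 : 0 < y generalizing y
  · exact this (-y) (neg_ne_zero.2 hy) (by linear_combination h) (by omega)
  have hx1 : 1 ≤ x := by nlinarith [show 0 ≤ d * N ^ 2 * y ^ 2 by positivity]
  have hx1' : (1 : ℝ) ≤ x := by exact_mod_cast hx1
  have hy1' : (1 : ℝ) ≤ y := by exact_mod_cast hy0
  have hv : (⟨x, y * N⟩ : ℤ√d) * ⟨x, -(y * N)⟩ = 1 := by
    ext
    · simp
      linear_combination h
    · simp
      ring
  let v : (ℤ√d)ˣ := ⟨⟨x, y * N⟩, ⟨x, -(y * N)⟩, hv, by rw [mul_comm, hv]⟩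
  have hpos : 2 ≤ emb hd 0 v := by
    rw [emb_zero_apply]
    change (2 : ℝ) ≤ x + ((y * N : ℤ) : ℝ) * √(d : ℝ)
    push_cast
    have : 1 ≤ (y : ℝ) * N := one_le_mul_of_one_le_of_one_le hy1' hN1
    nlinarith
  have hinv : emb hd 1 v = (emb hd 0 v)⁻¹ := by
    have : emb hd 0 v * emb hd 1 v = 1 := by
      rw [emb_mul_emb, Zsqrtd.norm_def]
      change ((x * x - d * (y * N) * (y * N) : ℤ) : ℝ) = 1
      rw [show x * x - d * (y * N) * (y * N) = 1 by linear_combination h]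
      simp
    exact eq_inv_of_mul_eq_one_right this
  have hsum : ((v ^ 2 : (ℤ√d)ˣ) : ℤ√d) ^ 2 + (((v ^ 2)⁻¹ : (ℤ√d)ˣ) : ℤ√d) ^ 2 =
      ((2 * ((x ^ 2 + d * N ^ 2 * y ^ 2) ^ 2 + 4 * d * N ^ 2 * y ^ 2 * x ^ 2) : ℤ) : ℤ√d) := by
    rw [← inv_pow]
    simp only [Units.val_pow_eq_pow_val]
    change ((⟨x, y * N⟩ : ℤ√d) ^ 2) ^ 2 + ((⟨x, -(y * N)⟩ : ℤ√d) ^ 2) ^ 2 = _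
    ext
    · simp [pow_two]
      ring
    · simp [pow_two]
      ring
  have hge : 16 ≤ 2 * ((x ^ 2 + d * N ^ 2 * y ^ 2) ^ 2 + 4 * d * N ^ 2 * y ^ 2 * x ^ 2) := by
    have h1 : 1 ≤ d * N ^ 2 * y ^ 2 := by
      have : 0 < d * N ^ 2 * y ^ 2 := by positivity
      omega
    have h2 : 1 ≤ x ^ 2 := one_le_pow₀ hx1
    have h3 : 1 ≤ d * N ^ 2 * y ^ 2 * x ^ 2 := one_le_mul_of_one_le_of_one_le h1 h2
    nlinarith
  refine ⟨v ^ 2, ⟨2 * d * N * y ^ 2, 2 * x * y⟩, ⟨2 * d * N * y ^ 2, -(2 * x * y)⟩,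
    (2 * ((x ^ 2 + d * N ^ 2 * y ^ 2) ^ 2 + 4 * d * N ^ 2 * y ^ 2 * x ^ 2)).toNat, ?_, ?_, ?_, ?_,
        ?_, ?_⟩
  · rw [Units.val_pow_eq_pow_val]
    change (⟨x, y * N⟩ : ℤ√d) ^ 2 = _
    ext
    · simp [pow_two]
      linear_combination h
    · simp [pow_two]
      ring
  · rw [← inv_pow, Units.val_pow_eq_pow_val]
    change (⟨x, -(y * N)⟩ : ℤ√d) ^ 2 = _
    ext
    · simp [pow_two]
      linear_combination h
    · simp [pow_two]
      ring
  · rw [Units.val_pow_eq_pow_val, map_pow]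
    nlinarith
  · rw [Units.val_pow_eq_pow_val, map_pow, map_pow, hinv, inv_pow]
  · omega
  · rw [hsum]
    have := Int.toNat_of_nonneg
      (show 0 ≤ 2 * ((x ^ 2 + d * N ^ 2 * y ^ 2) ^ 2 + 4 * d * N ^ 2 * y ^ 2 * x ^ 2) by omega)
    conv_lhs => rw [← this]
    rw [Int.cast_natCast]

theorem sq_add_sq_le {K κ A B y Y : ℝ} (hy : 0 < y) (hyY : y ≤ Y) (hY : Y ≤ κ * y)
    (hA : |A| ≤ K * √y) (hB : |B| ≤ K * (2 / √y)) :
    A ^ 2 + (B * Y) ^ 2 ≤ K ^ 2 * (1 + 4 * κ) * Y := by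
  have hY0 : 0 < Y := hy.trans_le hyY
  have h1 : A ^ 2 ≤ K ^ 2 * y := by
    rw [← sq_abs A]
    refine (pow_le_pow_left₀ (abs_nonneg _) hA 2).trans (le_of_eq ?_)
    rw [mul_pow, Real.sq_sqrt hy.le]
  have h2 : B ^ 2 ≤ K ^ 2 * (4 / y) := by
    rw [← sq_abs B]
    refine (pow_le_pow_left₀ (abs_nonneg _) hB 2).trans (le_of_eq ?_)
    rw [mul_pow, div_pow, Real.sq_sqrt hy.le]
    norm_num
  have h3 : Y ^ 2 / y ≤ κ * Y := by
    rw [div_le_iff₀ hy]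
    nlinarith
  calc A ^ 2 + (B * Y) ^ 2 ≤ K ^ 2 * y + K ^ 2 * (4 / y) * Y ^ 2 := by
        rw [mul_pow]
        gcongr
    _ = K ^ 2 * y + 4 * K ^ 2 * (Y ^ 2 / y) := by ring
    _ ≤ K ^ 2 * Y + 4 * K ^ 2 * (κ * Y) := by gcongr
    _ = _ := by ring

theorem exists_den_le (hns : ¬IsSquare d) (κ : ℝ) : ∃ C, 0 < C ∧ ∀ z w : ℍ, w.im ≤ z.im →
    z.im ≤ κ * w.im → ∃ c e : ℤ√d, (c ≠ 0 ∨ e ≠ 0) ∧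
      den hd 0 c e z ≤ C * z.im ∧ den hd 1 c e w ≤ C * w.im := by
  refine ⟨1 + (1 + √(d : ℝ)) ^ 2 * (1 + 4 * |κ|), by positivity, fun z w h1 h2 => ?_⟩
  set K := 1 + √(d : ℝ) with hK
  have hK0 : 0 < K := by positivity
  have hw := w.im_pos
  have hz := z.im_pos
  have hle {Y : ℝ} (hY : 0 < Y) : K ^ 2 * (1 + 4 * |κ|) * Y ≤ (1 + K ^ 2 * (1 + 4 * |κ|)) * Y := by
    linarith
  have hκ : κ ≤ |κ| := le_abs_self _
  have hκ1 : 1 ≤ κ := by nlinarith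
  by_cases hw1 : 1 ≤ w.im
  · have hP : 0 ≤ K ^ 2 * (1 + 4 * |κ|) := by positivity
    refine ⟨0, 1, Or.inr one_ne_zero, ?_, ?_⟩ <;> simp [den] <;> nlinarith
  push Not at hw1
  have hs : 0 < √w.im := Real.sqrt_pos.2 hw
  have hs1 : √w.im < 1 := by rwa [Real.sqrt_lt' one_pos, one_pow]
  set n := ⌈1 / √w.im⌉₊ with hn
  have hn1 : 1 / √w.im ≤ n := Nat.le_ceil _
  have hn0 : (0 : ℝ) < n := lt_of_lt_of_le (by positivity) hn1
  have hn2 : (n : ℝ) ≤ 2 / √w.im := by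
    have h3 := Nat.ceil_lt_add_one (show 0 ≤ 1 / √w.im by positivity)
    have h4 : 1 ≤ 1 / √w.im := by
      rw [le_div_iff₀ hs]
      linarith
    rw [show 2 / √w.im = 1 / √w.im + 1 / √w.im by ring]
    linarith
  have hn3 : 1 / (n : ℝ) ≤ √w.im := by
    rw [one_div_le hn0 hs]
    exact hn1
  obtain ⟨i, hi, j, hj, hij, t, h⟩ := exists_abs_sub_sub_emb_le hd hns (by exact_mod_cast hn0)
    (s := Finset.range (n + 1) ×ˢ Finset.range (n + 1)) (n := n) (by simp; nlinarith)
    fun p k => emb hd k ⟨p.1, p.2⟩ * ![z.re, w.re] k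
  simp only [Finset.mem_product, Finset.mem_range] at hi hj
  set c : ℤ√d := ⟨(i.1 : ℤ) - j.1, (i.2 : ℤ) - j.2⟩ with hc
  have hce : c = ⟨i.1, i.2⟩ - ⟨j.1, j.2⟩ := rfl
  have hc0 : c ≠ 0 := fun h0 => hij <| by
    rw [Zsqrtd.ext_iff] at h0
    simp only [hc, Zsqrtd.re_zero, Zsqrtd.im_zero] at h0
    ext <;> omega
  have hcb (k : Fin 2) : |emb hd k c| ≤ K * n := by
    have e1 : |(((i.1 : ℤ) - j.1 : ℤ) : ℝ)| ≤ n := by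
      rw [← Int.cast_abs]
      exact_mod_cast (abs_le.2 ⟨by omega, by omega⟩ : |(i.1 : ℤ) - j.1| ≤ n)
    have e2 : |(((i.2 : ℤ) - j.2 : ℤ) : ℝ)| ≤ n := by
      rw [← Int.cast_abs]
      exact_mod_cast (abs_le.2 ⟨by omega, by omega⟩ : |(i.2 : ℤ) - j.2| ≤ n)
    have h := abs_add_mul_le (Real.sqrt_nonneg d) e1 e2
    fin_cases k
    · simp only [Fin.zero_eta, emb_zero_apply]
      exact h.1
    · simp only [Fin.mk_one, emb_one_apply]
      exact h.2
  have hcb' (k : Fin 2) : |emb hd k c| ≤ K * (2 / √w.im) := (hcb k).trans (by gcongr)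
  have hA (k : Fin 2) : |emb hd k c * ![z.re, w.re] k + emb hd k (-t)| ≤ K * √w.im := by
    refine le_trans (le_of_eq ?_) ((h k).trans (by gcongr))
    rw [hce, map_sub, map_neg]
    congr 1
    ring
  refine ⟨c, -t, Or.inl hc0, ?_, ?_⟩
  · exact (sq_add_sq_le hw h1 (h2.trans (by gcongr)) (hA 0) (hcb' 0)).trans (hle hz)
  · exact (sq_add_sq_le hw le_rfl (by nlinarith) (hA 1) (hcb' 1)).trans (hle hw)

/-- The diagonal matrix with entries `u`, `u⁻¹`. -/
def diagUnit (u : (ℤ√d)ˣ) : SL(2, ℤ√d) :=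
  ⟨!![(u : ℤ√d), 0; 0, ((u⁻¹ : (ℤ√d)ˣ) : ℤ√d)], by simp [det_fin_two]⟩

theorem im_rho_diagUnit_smul (u : (ℤ√d)ˣ) (j : Fin 2) (z : ℍ) :
    (rho hd j (diagUnit u) • z).im = emb hd j u ^ 2 * z.im := by
  have h : emb hd j u * emb hd j ((u⁻¹ : (ℤ√d)ˣ) : ℤ√d) = 1 := by
    rw [← map_mul, Units.mul_inv, map_one]
  have e0 : rho hd j (diagUnit u) 1 0 = 0 := map_zero (emb hd j)
  have e1 : rho hd j (diagUnit u) 1 1 = emb hd j ((u⁻¹ : (ℤ√d)ˣ) : ℤ√d) := rfl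
  rw [im_smul_eq, e0, e1, eq_inv_of_mul_eq_one_left h]
  simp [div_eq_inv_mul]

theorem exists_balanced {u : (ℤ√d)ˣ} (hu : 4 ≤ emb hd 0 u) (hu' : emb hd 1 u = (emb hd 0 u)⁻¹)
    (z w : ℍ) : ∃ γ, (rho hd 1 γ • w).im ≤ (rho hd 0 γ • z).im ∧
      (rho hd 0 γ • z).im ≤ emb hd 0 u ^ 4 * (rho hd 1 γ • w).im ∧
      (rho hd 0 γ • z).im * (rho hd 1 γ • w).im = z.im * w.im := by
  set s := emb hd 0 u with hs
  have hs0 : 0 < s := by linarith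
  have hz := z.im_pos
  have hw := w.im_pos
  obtain ⟨n, h1, h2⟩ := exists_mem_Ico_zpow (x := z.im / w.im) (y := s ^ 4) (by positivity)
    (one_lt_pow₀ (by linarith) (by norm_num))
  have e0 : emb hd 0 ((u ^ (-n) : (ℤ√d)ˣ) : ℤ√d) = (s ^ n)⁻¹ := by
    change ((Units.map (emb hd 0 : ℤ√d →* ℝ) (u ^ (-n)) : ℝˣ) : ℝ) = _
    rw [map_zpow, Units.val_zpow_eq_zpow_val, Units.coe_map, _root_.zpow_neg]
    rfl
  have e1 : emb hd 1 ((u ^ (-n) : (ℤ√d)ˣ) : ℤ√d) = s ^ n := by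
    change ((Units.map (emb hd 1 : ℤ√d →* ℝ) (u ^ (-n)) : ℝˣ) : ℝ) = _
    rw [map_zpow, Units.val_zpow_eq_zpow_val, Units.coe_map]
    change (emb hd 1 u) ^ (-n) = _
    rw [hu', _root_.inv_zpow', neg_neg]
  refine ⟨diagUnit (u ^ (-n)), ?_⟩
  rw [im_rho_diagUnit_smul, im_rho_diagUnit_smul, e0, e1]
  have hp : 0 < s ^ n := by positivity
  have h4 : (s ^ 4) ^ n = (s ^ n) ^ 4 := by
    rw [← _root_.zpow_natCast, ← _root_.zpow_natCast, ← _root_.zpow_mul, ← _root_.zpow_mul,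
        mul_comm]
  rw [_root_.zpow_add_one₀ (by positivity), h4, div_lt_iff₀ hw] at h2
  rw [h4, le_div_iff₀ hw] at h1
  refine ⟨?_, ?_, ?_⟩
  · rw [inv_pow, le_inv_mul_iff₀ (by positivity)]
    linarith
  · rw [inv_pow, inv_mul_le_iff₀ (by positivity)]
    linarith
  · field_simp

end Arithmetic

section SiegelSet

variable {d : ℤ} (hd : 0 ≤ d) {C κ c₀ : ℝ}

theorem rho_upper (t : ℤ√d) (j : Fin 2) : rho hd j (upper t) = upper (emb hd j t) := by
  apply Subtype.ext
  ext i k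
  change emb hd j (!![1, t; 0, 1] i k) = !![1, emb hd j t; 0, 1] i k
  fin_cases i <;> fin_cases k <;> simp

theorem im_upper_smul (s : ℝ) (z : ℍ) : (upper s • z).im = z.im := by
  rw [im_smul_eq, coe_upper]
  simp

theorem re_upper_smul (s : ℝ) (z : ℍ) : (upper s • z).re = z.re + s := by
  rw [re_smul_eq, coe_upper]
  simp

/-- The action on pairs of points of a matrix over `ℤ[√d]` of positive determinant. -/
noncomputable def ma (M : Matrix (Fin 2) (Fin 2) (ℤ√d)) (z : ℍ × ℍ) : ℍ × ℍ :=
  (nm hd 0 M • z.1, nm hd 1 M • z.2)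

variable {M M' : Matrix (Fin 2) (Fin 2) (ℤ√d)} {m n : ℕ}

theorem ma_mul (hM : M.det = (m : ℤ√d)) (hm : 0 < m) (hM' : M'.det = (n : ℤ√d)) (hn : 0 < n)
    (z : ℍ × ℍ) : ma hd (M * M') z = ma hd M (ma hd M' z) := by
  simp only [ma, nm_mul hd hM hm hM' hn, mul_smul]

theorem ma_coe (γ : SL(2, ℤ√d)) (z : ℍ × ℍ) : ma hd γ.1 z = act (rho hd 0) (rho hd 1) γ z := by
  simp only [ma, act, nm_coe]

theorem det_coe_eq (γ : SL(2, ℤ√d)) : γ.1.det = ((1 : ℕ) : ℤ√d) := by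
  rw [γ.2, Nat.cast_one]

theorem dist_ma (M : Matrix (Fin 2) (Fin 2) (ℤ√d)) (z w : ℍ × ℍ) :
    dist (ma hd M z) (ma hd M w) = dist z w := by
  simp [ma, Prod.dist_eq, dist_smul]

theorem measurable_ma (M : Matrix (Fin 2) (Fin 2) (ℤ√d)) : Measurable (ma hd M) := by
  have h (g : SL(2, ℝ)) : Measurable fun z : ℍ => g • z := measurable_const_smul g
  exact ((h _).comp measurable_fst).prodMk ((h _).comp measurable_snd)

/-- A Siegel set at infinity. -/
def siegel (C κ c₀ : ℝ) : Set (ℍ × ℍ) :=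
  {p | |p.1.re| ≤ C ∧ |p.2.re| ≤ C ∧ c₀ ≤ p.1.im * p.2.im ∧ p.2.im ≤ p.1.im ∧ p.1.im ≤ κ * p.2.im}

theorem measurableSet_siegel : MeasurableSet (siegel C κ c₀) := by
  have h1 : Continuous fun p : ℍ × ℍ => p.1.re := continuous_re.comp continuous_fst
  have h2 : Continuous fun p : ℍ × ℍ => p.2.re := continuous_re.comp continuous_snd
  have h3 : Continuous fun p : ℍ × ℍ => p.1.im := continuous_im.comp continuous_fst
  have h4 : Continuous fun p : ℍ × ℍ => p.2.im := continuous_im.comp continuous_snd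
  exact ((isClosed_le h1.abs continuous_const).inter ((isClosed_le h2.abs continuous_const).inter
    ((isClosed_le continuous_const (h3.mul h4)).inter ((isClosed_le h4 h3).inter
      (isClosed_le h3 (continuous_const.mul h4)))))).measurableSet

theorem im_bounds (hc : 0 < c₀) {p : ℍ × ℍ} (hp : p ∈ siegel C κ c₀) : 0 < κ ∧ c₀ / κ ≤ p.2.im ^ 2 ∧
    p.1.im ^ 2 ≤ κ * (p.1.im * p.2.im) := by
  obtain ⟨-, -, h1, h2, h3⟩ := hp
  have hp1 := p.1.im_pos
  have hp2 := p.2.im_pos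
  have hκ : 0 < κ := by
    by_contra! h
    nlinarith
  refine ⟨hκ, ?_, by nlinarith⟩
  rw [div_le_iff₀ hκ]
  nlinarith

theorem exists_dist_le_of_mem_siegel (hc : 0 < c₀) (C κ B : ℝ) : ∃ r, ∀ p ∈ siegel C κ c₀,
    p.1.im * p.2.im ≤ B → dist p.1 UpperHalfPlane.I ≤ r ∧ dist p.2 UpperHalfPlane.I ≤ r := by
  obtain ⟨r, hr⟩ := exists_dist_I_le (max C √(κ * B)) √(c₀ / κ)
  refine ⟨r, fun p hp hB => ?_⟩
  obtain ⟨hκ, h1, h2⟩ := im_bounds hc hp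
  obtain ⟨h3, h4, -, h5, -⟩ := hp
  have hp1 := p.1.im_pos
  have hp2 := p.2.im_pos
  have h6 : √(c₀ / κ) ≤ p.2.im := (Real.sqrt_le_left hp2.le).2 h1
  have h7 : p.1.im ≤ max C √(κ * B) :=
    (Real.le_sqrt_of_sq_le (h2.trans (by gcongr))).trans (le_max_right _ _)
  have h8 : 0 < √(c₀ / κ) := Real.sqrt_pos.2 (by positivity)
  exact ⟨hr _ (h3.trans (le_max_left _ _)) h8 (h6.trans h5) h7,
    hr _ (h4.trans (le_max_left _ _)) h8 h6 (h5.trans h7)⟩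

theorem exists_ma_mem_siegel (hns : ¬IsSquare d) : ∃ N : ℕ, 0 < N ∧ ∀ u : (ℤ√d)ˣ, 4 ≤ emb hd 0 u →
    emb hd 1 u = (emb hd 0 u)⁻¹ → ∃ c₀, 0 < c₀ ∧ ∀ z, ∃ M : Matrix (Fin 2) (Fin 2) (ℤ√d),
      M.det = (N : ℤ√d) ∧ ma hd M z ∈ siegel (1 + √(d : ℝ)) (emb hd 0 u ^ 4) c₀ := by
  obtain ⟨N, hN, hcontent⟩ := exists_content hd hns
  refine ⟨N, hN, fun u hu hu' => ?_⟩
  obtain ⟨C, hC, hden⟩ := exists_den_le hd hns (emb hd 0 u ^ 4)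
  have hN' : (0 : ℝ) < N := by exact_mod_cast hN
  refine ⟨1 / (N ^ 2 * C ^ 2), by positivity, fun z => ?_⟩
  obtain ⟨γ₁, h1, h2, -⟩ := exists_balanced hd hu hu' z.1 z.2
  obtain ⟨c, e, hce, hc1, hc2⟩ := hden _ _ h1 h2
  obtain ⟨α, c', e', a, b, hα, hc', he', hdet⟩ := hcontent c e hce
  set z₁ := rho hd 0 γ₁ • z.1
  set z₂ := rho hd 1 γ₁ • z.2
  have hM₀ : (!![a, b; c', e'] : Matrix (Fin 2) (Fin 2) (ℤ√d)).det = (N : ℤ√d) := by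
    rw [det_fin_two_of, hdet]
  set M₀ : Matrix (Fin 2) (Fin 2) (ℤ√d) := !![a, b; c', e'] with hM₀e
  have hq (j : Fin 2) (x : ℍ) : emb hd j α ^ 2 * den hd j c' e' x = N ^ 2 * den hd j c e x := by
    have e1 := congrArg (emb hd j) hc'
    have e2 := congrArg (emb hd j) he'
    simp only [map_mul, map_natCast] at e1 e2
    simp only [den]
    calc _ = (emb hd j α * emb hd j c' * x.re + emb hd j α * emb hd j e') ^ 2 +
        (emb hd j α * emb hd j c' * x.im) ^ 2 := by ring
      _ = _ := by
        rw [e1, e2]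
        ring
  have hi1 := im_nm_smul hd hM₀ hN 0 z₁
  have hi2 := im_nm_smul hd hM₀ hN 1 z₂
  change (nm hd 0 M₀ • z₁).im = N * z₁.im / den hd 0 c' e' z₁ at hi1
  change (nm hd 1 M₀ • z₂).im = N * z₂.im / den hd 1 c' e' z₂ at hi2
  have hz1 := z₁.im_pos
  have hz2 := z₂.im_pos
  have hd1 : 0 < den hd 0 c' e' z₁ := by
    have h := (nm hd 0 M₀ • z₁).im_pos
    rw [hi1] at h
    exact (div_pos_iff_of_pos_left (by positivity)).1 h
  have hd2 : 0 < den hd 1 c' e' z₂ := by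
    have h := (nm hd 1 M₀ • z₂).im_pos
    rw [hi2] at h
    exact (div_pos_iff_of_pos_left (by positivity)).1 h
  have hprod : 1 / (N ^ 2 * C ^ 2) ≤ (nm hd 0 M₀ • z₁).im * (nm hd 1 M₀ • z₂).im := by
    rw [hi1, hi2, div_mul_div_comm, div_le_div_iff₀ (by positivity) (by positivity), one_mul]
    have hα1 : 1 ≤ emb hd 0 α ^ 2 * emb hd 1 α ^ 2 := by
      rw [← mul_pow, ← sq_abs, abs_mul]
      exact one_le_pow₀ (one_le_abs_emb_mul hd hns hα)
    have hdd : 0 < den hd 0 c' e' z₁ * den hd 1 c' e' z₂ := by positivity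
    calc den hd 0 c' e' z₁ * den hd 1 c' e' z₂
        ≤ (emb hd 0 α ^ 2 * emb hd 1 α ^ 2) * (den hd 0 c' e' z₁ * den hd 1 c' e' z₂) :=
          le_mul_of_one_le_left hdd.le hα1
      _ = (emb hd 0 α ^ 2 * den hd 0 c' e' z₁) * (emb hd 1 α ^ 2 * den hd 1 c' e' z₂) := by ring
      _ = (N ^ 2 * den hd 0 c e z₁) * (N ^ 2 * den hd 1 c e z₂) := by rw [hq, hq]
      _ ≤ (N ^ 2 * (C * z₁.im)) * (N ^ 2 * (C * z₂.im)) := by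
        have : 0 ≤ den hd 1 c e z₂ := by
          unfold den
          positivity
        gcongr
      _ = _ := by ring
  obtain ⟨γ₂, h3, h4, h5⟩ := exists_balanced hd hu hu' (nm hd 0 M₀ • z₁) (nm hd 1 M₀ • z₂)
  obtain ⟨t, ht⟩ := exists_abs_sub_emb_le hd hns
    ![(rho hd 0 γ₂ • nm hd 0 M₀ • z₁).re, (rho hd 1 γ₂ • nm hd 1 M₀ • z₂).re]
  have h0 := ht 0
  have h1 := ht 1
  have hM₁ : (M₀ * γ₁.1).det = (N : ℤ√d) := by rw [det_mul, hM₀, γ₁.2, mul_one]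
  refine ⟨(upper (-t)).1 * (γ₂.1 * (M₀ * γ₁.1)), ?_, ?_⟩
  · rw [det_mul, det_mul, hM₁, γ₂.2, (upper (-t)).2, one_mul, one_mul]
  have hM₂ : (γ₂.1 * (M₀ * γ₁.1)).det = (N : ℤ√d) := by rw [det_mul, hM₁, γ₂.2, one_mul]
  rw [ma_mul hd (det_coe_eq _) one_pos hM₂ hN, ma_mul hd (det_coe_eq _) one_pos hM₁ hN,
    ma_mul hd hM₀ hN (det_coe_eq _) one_pos, ma_coe, ma_coe, ma_coe]
  simp only [act, ma, rho_upper, siegel, Set.mem_ofPred_eq, re_upper_smul, im_upper_smul, map_neg,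
    ← sub_eq_add_neg]
  exact ⟨h0, h1, h5 ▸ hprod, h3, h4⟩

theorem exists_coe_eq (hd : 0 ≤ d) (hns : ¬IsSquare d) (hm : 0 < m) (hM : M.det = (m : ℤ√d))
    (hM' : M'.det = (m : ℤ√d)) {X : Matrix (Fin 2) (Fin 2) (ℤ√d)} (h : M' = M + (m : ℤ√d) • X) :
    ∃ γ : SL(2, ℤ√d), M' = M * γ.1 := by
  have : IsDomain (ℤ√d) := (emb_injective hd hns 0).isDomain _
  have h1 : M' = M * (1 + M.adjugate * X) := by
    rw [mul_add, mul_one, ← Matrix.mul_assoc, mul_adjugate, hM, Matrix.smul_mul, Matrix.one_mul, h]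
  refine ⟨⟨1 + M.adjugate * X, ?_⟩, h1⟩
  have h2 := congrArg det h1
  rw [det_mul, hM, hM'] at h2
  have hm' : (m : ℤ√d) ≠ 0 := by exact_mod_cast hm.ne'
  exact mul_left_cancel₀ hm' (by rw [← h2, mul_one])

theorem coe_injective_of_mul (hd : 0 ≤ d) (hns : ¬IsSquare d) (hm : 0 < m) (hM : M.det = (m : ℤ√d))
    {γ γ' : SL(2, ℤ√d)} (h : M * γ.1 = M * γ'.1) : γ = γ' := by
  have : IsDomain (ℤ√d) := (emb_injective hd hns 0).isDomain _
  have h1 := congrArg (M.adjugate * ·) h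
  simp only [← Matrix.mul_assoc, adjugate_mul, hM, Matrix.smul_mul, Matrix.one_mul] at h1
  have hm' : (m : ℤ√d) ≠ 0 := by exact_mod_cast hm.ne'
  exact Subtype.ext (smul_right_injective _ hm' h1)

/-- Matrices of determinant `m` form finitely many classes modulo `SL(2, ℤ[√d])`. -/
theorem exists_finite_representatives (hd : 0 ≤ d) (hns : ¬IsSquare d) (hm : 0 < m) :
    ∃ R : Finset (Matrix (Fin 2) (Fin 2) (ℤ√d)), (∀ M ∈ R, M.det = (m : ℤ√d)) ∧
      ∀ M : Matrix (Fin 2) (Fin 2) (ℤ√d), M.det = (m : ℤ√d) →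
        ∃ M' ∈ R, ∃ γ : SL(2, ℤ√d), M = M' * γ.1 := by
  have : NeZero m := ⟨hm.ne'⟩
  let f : Matrix (Fin 2) (Fin 2) (ℤ√d) → Fin 2 → Fin 2 → ZMod m × ZMod m :=
    fun M i k => ((M i k).re, (M i k).im)
  obtain ⟨R, hRS, hbij⟩ := Set.exists_subset_bijOn {M | M.det = (m : ℤ√d)} f
  have hfin : R.Finite := Set.Finite.of_finite_image (Set.toFinite _) hbij.injOn
  refine ⟨hfin.toFinset, fun M hM => hRS (hfin.mem_toFinset.1 hM), fun M hM => ?_⟩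
  obtain ⟨M', hM', hf⟩ := hbij.surjOn ⟨M, hM, rfl⟩
  refine ⟨M', hfin.mem_toFinset.2 hM', ?_⟩
  have key (i k) : ∃ x : ℤ√d, M i k = M' i k + m * x := by
    have h := congrFun (congrFun hf i) k
    rw [Prod.mk.injEq, ZMod.intCast_eq_intCast_iff_dvd_sub,
        ZMod.intCast_eq_intCast_iff_dvd_sub] at h
    obtain ⟨⟨a, ha⟩, ⟨b, hb⟩⟩ := h
    refine ⟨⟨a, b⟩, ?_⟩
    ext
    · simp
      linear_combination ha
    · simp
      linear_combination hb
  choose X hX using key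
  exact exists_coe_eq hd hns hm (hRS hM') hM (X := of X)
    (Matrix.ext fun i k => by simpa using hX i k)

/-- The union of the translates of a Siegel set by the inverses of finitely many matrices. -/
def siegelUnion (R : Finset (Matrix (Fin 2) (Fin 2) (ℤ√d))) (C κ c₀ : ℝ) : Set (ℍ × ℍ) :=
  {z | ∃ M ∈ R, ma hd M z ∈ siegel C κ c₀}

variable {R : Finset (Matrix (Fin 2) (Fin 2) (ℤ√d))}

theorem measurableSet_siegelUnion : MeasurableSet (siegelUnion hd R C κ c₀) := by
  have h : siegelUnion hd R C κ c₀ = ⋃ M ∈ R, ma hd M ⁻¹' siegel C κ c₀ := by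
    ext z
    simp [siegelUnion]
  rw [h]
  exact R.measurableSet_biUnion fun M _ => measurable_ma hd M measurableSet_siegel

theorem ma_mul_coe (hM : M.det = (m : ℤ√d)) (hm : 0 < m) (γ : SL(2, ℤ√d)) (z : ℍ × ℍ) :
    ma hd (M * γ.1) z = ma hd M (act (rho hd 0) (rho hd 1) γ z) := by
  rw [ma_mul hd hM hm (det_coe_eq γ) one_pos, ma_coe]

theorem finite_act_mem_siegelUnion (hns : ¬IsSquare d) (hm : 0 < m) (hc : 0 < c₀)
    (hR : ∀ M ∈ R, M.det = (m : ℤ√d)) (z : ℍ × ℍ) :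
    {γ | act (rho hd 0) (rho hd 1) γ z ∈ siegelUnion hd R C κ c₀}.Finite := by
  have hz1 := z.1.im_pos
  have hz2 := z.2.im_pos
  set Y := z.1.im * z.2.im with hY
  have hY0 : 0 < Y := by positivity
  obtain ⟨r, hr⟩ := exists_dist_le_of_mem_siegel hc C κ (m ^ 2 / Y + m ^ 2 * Y)
  have hfin := finite_setOf_dist_le hd hns hm
    (max r (max (dist z.1 UpperHalfPlane.I) (dist z.2 UpperHalfPlane.I)))
  refine (R.finite_toSet.biUnion fun M hM => hfin.preimage
      (f := fun γ : SL(2, ℤ√d) => M * γ.1) ?_).subset ?_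
  · exact fun γ _ γ' _ h => coe_injective_of_mul hd hns hm (hR M hM) h
  · rintro γ ⟨M, hM, h⟩
    have hdet : (M * γ.1).det = (m : ℤ√d) := by rw [det_mul, hR M hM, γ.2, mul_one]
    rw [← ma_mul_coe hd (hR M hM) hm] at h
    simp only [Set.mem_iUnion]
    have hB : (nm hd 0 (M * γ.1) • z.1).im * (nm hd 1 (M * γ.1) • z.2).im
        ≤ m ^ 2 / Y + m ^ 2 * Y := by
      by_cases h0 : (M * γ.1) 1 0 = 0
      · have := im_mul_im_le_of_eq_zero hd hns hdet hm h0 z.1 z.2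
        have h1 : 0 ≤ m ^ 2 / Y := by positivity
        linarith
      · have := im_mul_im_le_of_ne_zero hd hns hdet hm h0 z.1 z.2
        rw [← le_div_iff₀ hY0] at this
        have h1 : 0 ≤ m ^ 2 * Y := by positivity
        linarith
    obtain ⟨h1, h2⟩ := hr _ h hB
    refine ⟨M, hM, hdet, fun j => ?_⟩
    fin_cases j
    · exact ⟨z.1, le_max_of_le_right (le_max_left _ _), h1.trans (le_max_left _ _)⟩
    · exact ⟨z.2, le_max_of_le_right (le_max_right _ _), h2.trans (le_max_left _ _)⟩

end SiegelSet

section Unipotent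

/-- A length function on a group. -/
structure IsLength {Γ : Type*} [Group Γ] (ℓ : Γ → ℝ) : Prop where
  nonneg : ∀ γ, 0 ≤ ℓ γ
  mul_le : ∀ γ δ, ℓ (γ * δ) ≤ ℓ γ + ℓ δ
  inv : ∀ γ, ℓ γ⁻¹ = ℓ γ

theorem isLength_norm {Γ H : Type*} [Group Γ] [NormedAddCommGroup H] [InnerProductSpace ℝ H]
    {π : Γ → H ≃ₗᵢ[ℝ] H} {b : Γ → H} (hb : ∀ γ δ, b (γ * δ) = b γ + π γ (b δ)) :
    IsLength fun γ => ‖b γ‖ := by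
  have h1 : b 1 = 0 := by
    have h := hb 1 1
    rw [mul_one, left_eq_add] at h
    exact (π 1).map_eq_zero_iff.1 h
  refine ⟨fun γ => norm_nonneg _, fun γ δ => ?_, fun γ => ?_⟩
  · rw [hb]
    exact (norm_add_le _ _).trans_eq (by rw [LinearIsometryEquiv.norm_map])
  · have h := hb γ γ⁻¹
    rw [mul_inv_cancel, h1] at h
    rw [eq_neg_of_add_eq_zero_left h.symm, norm_neg, LinearIsometryEquiv.norm_map]

theorem exists_le_sqrt {f : ℕ → ℝ} (h0 : ∀ n, 0 ≤ f n) (hadd : ∀ m n, f (m + n) ≤ f m + f n)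
    {τ : ℕ} (hτ : 16 ≤ τ) {K : ℝ} (hK : 0 ≤ K) (hmul : ∀ n, f (τ * n) ≤ 2 * f n + K) :
    ∃ A, 0 ≤ A ∧ ∀ n : ℕ, f n ≤ A * √(n + 1) := by
  set P := ∑ i ∈ Finset.range τ, f i with hP
  have hP0 : 0 ≤ P := Finset.sum_nonneg fun i _ => h0 i
  have hle (i : ℕ) (hi : i < τ) : f i ≤ P :=
    Finset.single_le_sum (fun i _ => h0 i) (Finset.mem_range.2 hi)
  have key : ∀ n : ℕ, f n + (K + P) ≤ (P + (K + P)) * √(n + 1) := fun n => by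
    induction n using Nat.strong_induction_on with
    | _ n ih =>
      rcases lt_or_ge n τ with h | h
      · have h1 : 1 ≤ √((n : ℝ) + 1) := Real.one_le_sqrt.2 (by linarith [n.cast_nonneg (α := ℝ)])
        have := hle n h
        nlinarith
      · have hτ0 : 0 < τ := by omega
        have hq := ih (n / τ) (Nat.div_lt_self (by omega) (by omega))
        have h1 := hadd (τ * (n / τ)) (n % τ)
        rw [Nat.div_add_mod] at h1
        have h2 := hmul (n / τ)
        have h3 := hle _ (Nat.mod_lt n hτ0)
        have h4 : 2 * √(((n / τ : ℕ) : ℝ) + 1) ≤ √((n : ℝ) + 1) := by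
          refine Real.le_sqrt_of_sq_le ?_
          rw [mul_pow, Real.sq_sqrt (by positivity)]
          have h5 : 1 ≤ n / τ := (Nat.one_le_div_iff hτ0).2 h
          have h6 : 16 * (n / τ) ≤ n := (Nat.mul_le_mul_right _ hτ).trans (Nat.mul_div_le n τ)
          have : 4 * (n / τ + 1) ≤ n + 1 := by omega
          have : (4 : ℝ) * (((n / τ : ℕ) : ℝ) + 1) ≤ n + 1 := by exact_mod_cast this
          linarith
        have h7 : 0 ≤ P + (K + P) := by positivity
        nlinarith
  exact ⟨P + (K + P), by positivity, fun n => by linarith [key n]⟩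

variable {d : ℤ}

/-- The unipotent matrix conjugate to `upper` by a matrix with bottom row `(c, e)`. -/
def unip (c e t : ℤ√d) : SL(2, ℤ√d) :=
  ⟨!![1 + t * c * e, t * e ^ 2; -(t * c ^ 2), 1 - t * c * e], by rw [det_fin_two_of]; ring⟩

theorem unip_add (c e t t' : ℤ√d) : unip c e (t + t') = unip c e t * unip c e t' := by
  apply Subtype.ext
  rw [Matrix.SpecialLinearGroup.coe_mul]
  change !![_, _; _, _] = !![_, _; _, _] * !![_, _; _, _]
  rw [mul_fin_two]
  ext i k : 1
  fin_cases i <;> fin_cases k <;> simp <;> ring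

theorem unip_zero (c e : ℤ√d) : unip c e 0 = 1 := by
  have h := unip_add c e 0 0
  rw [add_zero] at h
  exact left_eq_mul.1 h

theorem unip_neg (c e t : ℤ√d) : unip c e (-t) = (unip c e t)⁻¹ := by
  refine eq_inv_of_mul_eq_one_left ?_
  rw [← unip_add, neg_add_cancel, unip_zero]

variable {M : Matrix (Fin 2) (Fin 2) (ℤ√d)} {N : ℕ}

theorem mul_unip (hM : M.det = (N : ℤ√d)) (t : ℤ√d) :
    M * (unip (M 1 0) (M 1 1) t).1 = (upper (N * t)).1 * M := by
  rw [det_fin_two] at hM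
  rw [coe_upper, ← hM]
  change M * !![_, _; _, _] = _
  ext i k : 1
  fin_cases i <;> fin_cases k <;> simp [mul_apply, Fin.sum_univ_two] <;> ring

variable (hd : 0 ≤ d) {u : (ℤ√d)ˣ} {x x' : ℤ√d} {τ : ℕ} {ℓ : SL(2, ℤ√d) → ℝ}

theorem diagUnit_mul_upper (u : (ℤ√d)ˣ) (t : ℤ√d) :
    diagUnit u * upper t = upper ((u : ℤ√d) ^ 2 * t) * diagUnit u := by
  apply Subtype.ext
  rw [Matrix.SpecialLinearGroup.coe_mul, Matrix.SpecialLinearGroup.coe_mul, coe_upper, coe_upper]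
  change !![(u : ℤ√d), 0; 0, ((u⁻¹ : (ℤ√d)ˣ) : ℤ√d)] * _ =
    _ * !![(u : ℤ√d), 0; 0, ((u⁻¹ : (ℤ√d)ˣ) : ℤ√d)]
  rw [mul_fin_two, mul_fin_two]
  have h := u.mul_inv
  ext i k : 1
  fin_cases i <;> fin_cases k <;> simp
  linear_combination -(u : ℤ√d) * t * h

theorem exists_conj_unip (hd : 0 ≤ d) (hns : ¬IsSquare d) (hN : 0 < N) (hM : M.det = (N : ℤ√d))
    (hx : (u : ℤ√d) = 1 + N * x) (hx' : ((u⁻¹ : (ℤ√d)ˣ) : ℤ√d) = 1 + N * x') :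
    ∃ γ, ∀ t, γ * unip (M 1 0) (M 1 1) t = unip (M 1 0) (M 1 1) ((u : ℤ√d) ^ 2 * t) * γ := by
  have hdet : ((diagUnit u).1 * M).det = (N : ℤ√d) := by rw [det_mul, (diagUnit u).2, one_mul, hM]
  have hD : (diagUnit u).1 * M = M + (N : ℤ√d) • (!![x, 0; 0, x'] * M) := by
    have e : (diagUnit u).1 = 1 + (N : ℤ√d) • !![x, 0; 0, x'] := by
      change !![(u : ℤ√d), 0; 0, ((u⁻¹ : (ℤ√d)ˣ) : ℤ√d)] = _
      rw [hx, hx']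
      ext i k : 1
      fin_cases i <;> fin_cases k <;> simp
    rw [e, add_mul, one_mul, Matrix.smul_mul]
  obtain ⟨γ, hγ⟩ := exists_coe_eq hd hns hN hM hdet hD
  refine ⟨γ, fun t => coe_injective_of_mul hd hns hN hM ?_⟩
  rw [Matrix.SpecialLinearGroup.coe_mul, Matrix.SpecialLinearGroup.coe_mul, ← Matrix.mul_assoc,
      ← hγ,
    ← Matrix.mul_assoc, mul_unip hM, Matrix.mul_assoc, Matrix.mul_assoc, mul_unip hM, ← hγ,
    ← Matrix.mul_assoc, ← Matrix.mul_assoc, ← Matrix.SpecialLinearGroup.coe_mul,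
    ← Matrix.SpecialLinearGroup.coe_mul, diagUnit_mul_upper]
  congr 4
  ring

theorem exists_unip_le (hd : 0 ≤ d) (hns : ¬IsSquare d) (hN : 0 < N) (hM : M.det = (N : ℤ√d))
    (hx : (u : ℤ√d) = 1 + N * x) (hx' : ((u⁻¹ : (ℤ√d)ˣ) : ℤ√d) = 1 + N * x') (hτ : 16 ≤ τ)
    (huτ : (u : ℤ√d) ^ 2 + ((u⁻¹ : (ℤ√d)ˣ) : ℤ√d) ^ 2 = τ) (hℓ : IsLength ℓ) :
    ∃ A, 0 ≤ A ∧ ∀ (t : ℤ√d) (s : ℝ), (∀ j, |emb hd j t| ≤ s) →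
      ℓ (unip (M 1 0) (M 1 1) t) ≤ A * √(s + 1) := by
  obtain ⟨γ, hγ⟩ := exists_conj_unip hd hns hN hM hx hx'
  set β : ℤ√d → ℝ := fun t => ℓ (unip (M 1 0) (M 1 1) t) with hβ
  have hadd (t t') : β (t + t') ≤ β t + β t' := by
    simp only [hβ, unip_add]
    exact hℓ.mul_le _ _
  have h1 (t) : β ((u : ℤ√d) ^ 2 * t) ≤ β t + 2 * ℓ γ := by
    have h := hℓ.mul_le (γ * unip (M 1 0) (M 1 1) t) γ⁻¹
    rw [hγ, mul_inv_cancel_right, hℓ.inv, ← hγ] at h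
    have h' := hℓ.mul_le γ (unip (M 1 0) (M 1 1) t)
    simp only [hβ]
    linarith
  have h2 (t) : β (((u⁻¹ : (ℤ√d)ˣ) : ℤ√d) ^ 2 * t) ≤ β t + 2 * ℓ γ := by
    have e := hγ (((u⁻¹ : (ℤ√d)ˣ) : ℤ√d) ^ 2 * t)
    rw [← mul_assoc, ← mul_pow, Units.mul_inv, one_pow, one_mul] at e
    have h := hℓ.mul_le γ⁻¹ (γ * unip (M 1 0) (M 1 1) (((u⁻¹ : (ℤ√d)ˣ) : ℤ√d) ^ 2 * t))
    rw [inv_mul_cancel_left, e, hℓ.inv] at h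
    have h' := hℓ.mul_le (unip (M 1 0) (M 1 1) t) γ
    simp only [hβ]
    linarith
  have key (e : ℤ√d) : ∃ A, 0 ≤ A ∧ ∀ n : ℕ, β (n * e) ≤ A * √(n + 1) := by
    refine exists_le_sqrt (fun n => hℓ.nonneg _) (fun m n => ?_) hτ
      (K := 4 * ℓ γ) (by linarith [hℓ.nonneg γ]) fun n => ?_
    · rw [Nat.cast_add, add_mul]
      exact hadd _ _
    · have e1 : ((τ * n : ℕ) : ℤ√d) * e =
          (u : ℤ√d) ^ 2 * (n * e) + ((u⁻¹ : (ℤ√d)ˣ) : ℤ√d) ^ 2 * (n * e) := by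
        rw [← add_mul, huτ]
        push_cast
        ring
      rw [e1]
      linarith [hadd ((u : ℤ√d) ^ 2 * (n * e)) (((u⁻¹ : (ℤ√d)ˣ) : ℤ√d) ^ 2 * (n * e)),
        h1 (n * e), h2 (n * e)]
  have hneg (t) : β (-t) = β t := by
    simp only [hβ, unip_neg, hℓ.inv]
  have key' (e : ℤ√d) : ∃ A, 0 ≤ A ∧ ∀ (a : ℤ) (s : ℝ),
      |(a : ℝ)| ≤ s → β (a * e) ≤ A * √(s + 1) := by
    obtain ⟨A, hA, h⟩ := key e
    refine ⟨A, hA, fun a s has => ?_⟩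
    have e1 : β (a * e) = β ((a.natAbs : ℕ) * e) := by
      rcases Int.natAbs_eq a with h | h
      · conv_lhs => rw [h, Int.cast_natCast]
      · conv_lhs => rw [h, Int.cast_neg, Int.cast_natCast, neg_mul, hneg]
    rw [e1]
    refine (h _).trans ?_
    rw [Nat.cast_natAbs, Int.cast_abs]
    gcongr
  obtain ⟨A, hA, h⟩ := key' 1
  obtain ⟨A', hA', h'⟩ := key' ⟨0, 1⟩
  have hs1 := one_le_sqrt hd hns
  refine ⟨A + A', by positivity, fun t s hts => ?_⟩
  have e0 := abs_le.1 (hts 0)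
  have e1 := abs_le.1 (hts 1)
  rw [emb_zero_apply] at e0
  rw [emb_one_apply] at e1
  have hre : |(t.re : ℝ)| ≤ s := abs_le.2 ⟨by linarith, by linarith⟩
  have him : |(t.im : ℝ)| ≤ s := by
    have : |(t.im : ℝ) * √(d : ℝ)| ≤ s := abs_le.2 ⟨by linarith, by linarith⟩
    rw [abs_mul, abs_of_nonneg (Real.sqrt_nonneg _)] at this
    nlinarith [abs_nonneg (t.im : ℝ)]
  have et : t = t.re * 1 + t.im * ⟨0, 1⟩ := by
    ext <;> simp
  have h3 := hadd (t.re * 1) (t.im * ⟨0, 1⟩)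
  rw [← et] at h3
  change β t ≤ _
  linarith [h _ _ hre, h' _ _ him]

end Unipotent

section Cusp

theorem le_mul_of_le_mul {p₁ p₂ q₁ q₂ A₁ A₂ m E κ : ℝ} (hq₁ : 0 < q₁) (hq₂ : 0 < q₂) (hA₁ : 0 < A₁)
    (hA₂ : 0 < A₂) (hm : 0 < m) (hE : 0 < E) (hκ : 0 < κ) (hp : p₂ ≤ p₁) (hp' : p₁ ≤ κ * p₂)
    (hq : q₂ ≤ q₁) (hq' : q₁ ≤ κ * q₂) (h₁ : m * p₁ ≤ q₁ * E * A₁) (h₁' : q₁ * A₁ ≤ m * p₁ * E)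
    (h₂ : m * p₂ ≤ q₂ * E * A₂) (h₂' : q₂ * A₂ ≤ m * p₂ * E) :
    A₁ ≤ κ * E ^ 2 * A₂ ∧ A₂ ≤ κ * E ^ 2 * A₁ := by
  constructor
  · refine le_of_mul_le_mul_left ?_ hq₁
    calc q₁ * A₁ ≤ m * p₁ * E := h₁'
      _ ≤ m * (κ * p₂) * E := by gcongr
      _ = κ * E * (m * p₂) := by ring
      _ ≤ κ * E * (q₂ * E * A₂) := by gcongr
      _ ≤ κ * E * (q₁ * E * A₂) := by gcongr
      _ = q₁ * (κ * E ^ 2 * A₂) := by ring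
  · refine le_of_mul_le_mul_left ?_ hq₂
    calc q₂ * A₂ ≤ m * p₂ * E := h₂'
      _ ≤ m * p₁ * E := by gcongr
      _ ≤ q₁ * E * A₁ * E := by gcongr
      _ ≤ (κ * q₂) * E * A₁ * E := by gcongr
      _ = q₂ * (κ * E ^ 2 * A₁) := by ring

/-- Real numbers whose squares are comparable and whose product is bounded are bounded. -/
theorem abs_le_of_sq_le {x y K m : ℝ} (hK : 0 ≤ K) (h : x ^ 2 ≤ K * y ^ 2) (hxy : |x| * |y| ≤ m) :
    |x| ≤ 1 + K * m ^ 2 := by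
  by_contra! hlt
  have h1 : 1 < |x| := by nlinarith [sq_nonneg m]
  rw [← sq_abs x, ← sq_abs y] at h
  have h2 : |x| ^ 4 ≤ K * m ^ 2 := by
    have h3 : (|x| * |y|) ^ 2 ≤ m ^ 2 := by gcongr
    nlinarith [sq_nonneg |x|]
  have h4 : |x| ≤ |x| ^ 4 := by
    nlinarith [mul_pos (zero_lt_one.trans h1) (zero_lt_one.trans h1),
        one_lt_pow₀ h1 (n := 3) (by norm_num)]
  linarith

variable {d : ℤ} (hd : 0 ≤ d) {L : Matrix (Fin 2) (Fin 2) (ℤ√d)} {m : ℕ} {C κ c₀ r : ℝ}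

theorem emb_mul_emb_of_eq_zero (hL : L.det = (m : ℤ√d)) (h0 : L 1 0 = 0) (j : Fin 2) :
    emb hd j (L 0 0) * emb hd j (L 1 1) = m := by
  rw [det_fin_two, h0, mul_zero, sub_zero] at hL
  rw [← map_mul, hL, map_natCast]

theorem ne_zero_of_eq_zero (hL : L.det = (m : ℤ√d)) (hm : 0 < m) (h0 : L 1 0 = 0) :
    L 1 1 ≠ 0 := fun h => by
  rw [det_fin_two, h0, h, mul_zero, mul_zero, sub_zero, eq_comm, Nat.cast_eq_zero] at hL
  exact hm.ne' hL

theorem im_nm_smul_mul (hns : ¬IsSquare d) (hL : L.det = (m : ℤ√d)) (hm : 0 < m) (h0 : L 1 0 = 0)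
    (j : Fin 2)
    (z : ℍ) : (nm hd j L • z).im * emb hd j (L 1 1) ^ 2 = m * z.im := by
  have he := emb_ne_zero hd hns (ne_zero_of_eq_zero hL hm h0) j
  rw [im_nm_smul hd hL hm, h0, den, map_zero, zero_mul, zero_mul, zero_add, zero_pow two_ne_zero,
      add_zero]
  field_simp

theorem re_nm_smul (hns : ¬IsSquare d) (hL : L.det = (m : ℤ√d)) (hm : 0 < m) (h0 : L 1 0 = 0)
    (j : Fin 2)
    (z : ℍ) : (nm hd j L • z).re =
      emb hd j (L 0 1) / emb hd j (L 1 1) + m / emb hd j (L 1 1) ^ 2 * z.re := by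
  have he := emb_ne_zero hd hns (ne_zero_of_eq_zero hL hm h0) j
  have hpos := det_map_emb_pos hd hL hm j
  have hs : (√(L.map (emb hd j)).det)⁻¹ ≠ 0 := (inv_pos.2 (Real.sqrt_pos.2 hpos)).ne'
  rw [re_smul_eq, nm, nrm_apply hpos, nrm_apply hpos, nrm_apply hpos, nrm_apply hpos,
    ← emb_mul_emb_of_eq_zero hd hL h0 j]
  simp only [map_apply, h0, map_zero, mul_zero, zero_mul, zero_add, add_zero, zero_pow two_ne_zero]
  field_simp
  ring

theorem abs_emb_div_emb_le (hns : ¬IsSquare d) (hL : L.det = (m : ℤ√d)) (hm : 0 < m)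
    (h0 : L 1 0 = 0)
    (j : Fin 2) {z w : ℍ} (hz : |z.re| ≤ C) (hw : |w.re| ≤ C) (h : dist (nm hd j L • z) w ≤ r) :
    |emb hd j (L 0 1) / emb hd j (L 1 1)| ≤
      C + m / emb hd j (L 1 1) ^ 2 * (C + Real.exp r ^ 2 * z.im) := by
  have he := emb_ne_zero hd hns (ne_zero_of_eq_zero hL hm h0) j
  have hre := re_nm_smul hd hns hL hm h0 j z
  have him := im_nm_smul_mul hd hns hL hm h0 j z
  set p := nm hd j L • z
  have hm' : (0 : ℝ) ≤ m / emb hd j (L 1 1) ^ 2 := by positivity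
  have him' : p.im = m / emb hd j (L 1 1) ^ 2 * z.im := by
    field_simp
    exact him
  have h1 : |p.re - w.re| ≤ dist (p : ℂ) w := by
    rw [Complex.dist_eq]
    exact Complex.abs_re_le_norm ((p : ℂ) - w)
  have hE : Real.exp (dist p w) ≤ Real.exp r := Real.exp_le_exp.2 h
  have h2 := dist_coe_le p w
  have h3 := im_le_im_mul_exp_dist w p
  rw [dist_comm] at h3
  have hw0 := w.im_pos
  have hp0 := p.im_pos
  have h4 : |p.re - w.re| ≤ p.im * Real.exp r ^ 2 := by
    calc _ ≤ w.im * (Real.exp (dist p w) - 1) := h1.trans h2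
      _ ≤ w.im * Real.exp r := by gcongr; linarith
      _ ≤ p.im * Real.exp r * Real.exp r := by
        gcongr
        exact h3.trans (by gcongr)
      _ = _ := by ring
  have e : emb hd j (L 0 1) / emb hd j (L 1 1) =
      (p.re - w.re) + w.re - m / emb hd j (L 1 1) ^ 2 * z.re := by
    rw [hre]
    ring
  rw [e]
  refine (abs_sub _ _).trans ?_
  rw [abs_mul, abs_of_nonneg hm']
  have h5 := abs_add_le (p.re - w.re) w.re
  have h6 := mul_le_mul_of_nonneg_left hz hm'
  rw [him'] at h4
  linarith

/-- Upper triangular matrices which nearly preserve a Siegel set have bounded diagonal and slope. -/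
theorem exists_abs_emb_le (hns : ¬IsSquare d) (hm : 0 < m) (C κ r : ℝ) (hc : 0 < c₀) : ∃ B, 0 ≤ B ∧
    ∀ p ∈ siegel C κ c₀, ∀ q ∈ siegel C κ c₀, ∀ L, L.det = (m : ℤ√d) → L 1 0 = 0 →
      dist (ma hd L p).1 q.1 ≤ r → dist (ma hd L p).2 q.2 ≤ r → ∀ j,
        |emb hd j (L 0 0)| ≤ B ∧ |emb hd j (L 1 1)| ≤ B ∧
          |emb hd j (L 0 1) / emb hd j (L 1 1)| ≤ B * (1 + √(p.1.im * p.2.im)) := by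
  set E := Real.exp r with hE
  have hE0 : 0 < E := Real.exp_pos r
  set B := 1 + |κ| * E ^ 2 * ((m : ℝ) ^ 2) ^ 2 with hB
  have hB1 : 1 ≤ B := by
    have : 0 ≤ |κ| * E ^ 2 * ((m : ℝ) ^ 2) ^ 2 := by positivity
    linarith
  have hm' : (0 : ℝ) < m := by exact_mod_cast hm
  refine ⟨m * B + |C| + m * B ^ 2 * (|C| + E ^ 2 * |κ|), by positivity, ?_⟩
  intro p hp q hq L hL h0 h1 h2
  have hκ := (im_bounds hc hp).1
  rw [abs_of_pos hκ] at hB ⊢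
  have hpim := (im_bounds hc hp).2.2
  obtain ⟨hpC, hpC', -, hp1, hp2⟩ := hp
  obtain ⟨hqC, hqC', -, hq1, hq2⟩ := hq
  have hC : C = |C| := (abs_of_nonneg ((abs_nonneg _).trans hpC)).symm
  have he := emb_ne_zero hd hns (ne_zero_of_eq_zero hL hm h0)
  have hae := emb_mul_emb_of_eq_zero hd hL h0
  have ha0 : L 0 0 ≠ 0 := fun h => by
    have := hae 0
    rw [h, map_zero, zero_mul] at this
    exact hm'.ne this
  have hE1 (z w : ℍ) (h : dist z w ≤ r) : z.im ≤ w.im * E :=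
    (im_le_im_mul_exp_dist z w).trans (mul_le_mul_of_nonneg_left (Real.exp_le_exp.2 h) w.im_pos.le)
  have hE2 (z w : ℍ) (h : dist z w ≤ r) : w.im ≤ z.im * E := hE1 w z (dist_comm w z ▸ h)
  have hi (j : Fin 2) (z w : ℍ) (h : dist (nm hd j L • z) w ≤ r) :
      m * z.im ≤ w.im * E * emb hd j (L 1 1) ^ 2 ∧ w.im * emb hd j (L 1 1) ^ 2 ≤ m * z.im * E := by
    have e := im_nm_smul_mul hd hns hL hm h0 j z
    have e0 := sq_nonneg (emb hd j (L 1 1))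
    constructor
    · rw [← e]
      exact mul_le_mul_of_nonneg_right (hE1 _ _ h) e0
    · rw [← e]
      linarith [mul_le_mul_of_nonneg_right (hE2 _ _ h) e0]
  obtain ⟨k1, k1'⟩ := hi 0 p.1 q.1 h1
  obtain ⟨k2, k2'⟩ := hi 1 p.2 q.2 h2
  obtain ⟨hA, hA'⟩ := le_mul_of_le_mul q.1.im_pos q.2.im_pos
    (pow_pos (abs_pos.2 (he 0)) 2 |>.trans_eq (sq_abs _))
    (pow_pos (abs_pos.2 (he 1)) 2 |>.trans_eq (sq_abs _)) hm' hE0 hκ hp1 hp2 hq1 hq2 k1 k1' k2 k2'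
  have hprod : |emb hd 0 (L 1 1)| * |emb hd 1 (L 1 1)| ≤ (m : ℝ) ^ 2 := by
    have h3 := one_le_abs_emb_mul hd hns ha0
    have h4 : |emb hd 0 (L 0 0)| * |emb hd 1 (L 0 0)| * (|emb hd 0 (L 1 1)| * |emb hd 1 (L 1 1)|) =
        (m : ℝ) ^ 2 := by
      calc _ = |emb hd 0 (L 0 0) * emb hd 0 (L 1 1)| * |emb hd 1 (L 0 0) * emb hd 1 (L 1 1)| := by
            rw [abs_mul, abs_mul]
            ring
        _ = _ := by rw [hae, hae, Nat.abs_cast, sq]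
    rw [← h4]
    exact le_mul_of_one_le_left (by positivity) h3
  have hprod' := one_le_abs_emb_mul hd hns (ne_zero_of_eq_zero hL hm h0)
  have hK : 0 ≤ κ * E ^ 2 := by positivity
  have hb0 := abs_le_of_sq_le hK hA hprod
  have hb1 := abs_le_of_sq_le hK hA' (mul_comm |emb hd 0 (L 1 1)| _ ▸ hprod)
  have hbB (j) : |emb hd j (L 1 1)| ≤ B := by
    rw [hB]
    fin_cases j
    exacts [hb0, hb1]
  have hinv (j) : |emb hd j (L 1 1)|⁻¹ ≤ B := by
    rw [inv_le_comm₀ (abs_pos.2 (he j)) (by linarith), inv_le_iff_one_le_mul₀ (by linarith)]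
    fin_cases j
    · exact hprod'.trans (mul_le_mul_of_nonneg_left (hbB 1) (abs_nonneg _))
    · rw [mul_comm] at hprod'
      exact hprod'.trans (mul_le_mul_of_nonneg_left (hbB 0) (abs_nonneg _))
  have hinv2 (j) : (m : ℝ) / emb hd j (L 1 1) ^ 2 ≤ m * B ^ 2 := by
    rw [div_eq_mul_inv, ← sq_abs, ← inv_pow]
    have := hinv j
    gcongr
  have ha (j) : |emb hd j (L 0 0)| ≤ m * B := by
    rw [eq_div_of_mul_eq (he j) (hae j), abs_div, Nat.abs_cast, div_eq_mul_inv]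
    have := hinv j
    gcongr
  have hY0 := Real.sqrt_nonneg (p.1.im * p.2.im)
  have hp10 := p.1.im_pos
  have hp20 := p.2.im_pos
  have hκ1 : 1 ≤ κ := by
    by_contra! h
    nlinarith
  have hY1 : p.1.im ≤ κ * √(p.1.im * p.2.im) := by
    refine (pow_le_pow_iff_left₀ hp10.le (by positivity) two_ne_zero).1 ?_
    rw [mul_pow, Real.sq_sqrt (by positivity)]
    have : 0 < p.1.im * p.2.im := by positivity
    nlinarith
  have hβ (j : Fin 2) {z w : ℍ} (hz : |z.re| ≤ C) (hw : |w.re| ≤ C) (h : dist (nm hd j L • z) w ≤ r)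
      (hzim : z.im ≤ κ * √(p.1.im * p.2.im)) : |emb hd j (L 0 1) / emb hd j (L 1 1)| ≤
      (m * B + |C| + m * B ^ 2 * (|C| + E ^ 2 * κ)) * (1 + √(p.1.im * p.2.im)) := by
    have h3 := abs_emb_div_emb_le hd hns hL hm h0 j hz hw h
    rw [← hE, hC] at h3
    have hz0 := z.im_pos
    have h4 : (m : ℝ) / emb hd j (L 1 1) ^ 2 * (|C| + E ^ 2 * z.im) ≤
        m * B ^ 2 * (|C| + E ^ 2 * (κ * √(p.1.im * p.2.im))) := by
      have := hinv2 j
      gcongr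
    have h5 : 0 ≤ m * B + m * B * √(p.1.im * p.2.im) + |C| * √(p.1.im * p.2.im) +
        m * B ^ 2 * |C| * √(p.1.im * p.2.im) + m * B ^ 2 * E ^ 2 * κ := by positivity
    linarith
  have hm2 : 0 ≤ m * B ^ 2 * (|C| + E ^ 2 * κ) := by positivity
  have hmB : B ≤ m * B := le_mul_of_one_le_left (by linarith) (by exact_mod_cast hm)
  have hC0 := abs_nonneg C
  intro j
  refine ⟨(ha j).trans (by linarith), (hbB j).trans (by linarith), ?_⟩
  fin_cases j
  · exact hβ 0 hpC hqC h1 hY1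
  · exact hβ 1 hpC' hqC' h2 (hp1.trans hY1)

end Cusp

section LengthBound

variable {d : ℤ} (hd : 0 ≤ d) {M M' : Matrix (Fin 2) (Fin 2) (ℤ√d)} {N : ℕ} {C κ c₀ r : ℝ}
  {ℓ : SL(2, ℤ√d) → ℝ}

theorem det_mul_adjugate (hM : M.det = (N : ℤ√d)) (hM' : M'.det = (N : ℤ√d)) (δ : SL(2, ℤ√d)) :
    (M' * δ.1 * M.adjugate).det = ((N * N : ℕ) : ℤ√d) := by
  rw [det_mul, det_mul, det_adjugate, hM, hM', δ.2, Fintype.card_fin, pow_one, mul_one,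
      Nat.cast_mul]

theorem mul_adjugate_mul (hM : M.det = (N : ℤ√d)) (δ : SL(2, ℤ√d)) :
    M' * δ.1 * M.adjugate * M = (N : ℤ√d) • (M' * δ.1) := by
  rw [Matrix.mul_assoc, adjugate_mul, hM, Matrix.mul_smul, Matrix.mul_one]

theorem mul_adjugate_injective (hd : 0 ≤ d) (hns : ¬IsSquare d) (hN : 0 < N)
    (hM : M.det = (N : ℤ√d))
    (hM' : M'.det = (N : ℤ√d)) :
    Function.Injective fun δ : SL(2, ℤ√d) => M' * δ.1 * M.adjugate := fun δ δ' h => by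
  have : IsDomain (ℤ√d) := (emb_injective hd hns 0).isDomain _
  have h1 := congrArg (· * M) h
  simp only [mul_adjugate_mul hM] at h1
  have hN' : (N : ℤ√d) ≠ 0 := by exact_mod_cast hN.ne'
  exact coe_injective_of_mul hd hns hN hM' (smul_right_injective _ hN' h1)

theorem exists_length_le_of_finite {S : Set SL(2, ℤ√d)} (hS : S.Finite) :
    ∃ B, 0 ≤ B ∧ ∀ δ ∈ S, ℓ δ ≤ B := by
  obtain ⟨B, hB⟩ := (hS.image ℓ).bddAbove
  exact ⟨max B 0, le_max_right _ _, fun δ hδ => (hB ⟨δ, hδ, rfl⟩).trans (le_max_left _ _)⟩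

theorem exists_length_le_of_ne_zero (hns : ¬IsSquare d) (hN : 0 < N) (hM : M.det = (N : ℤ√d))
    (hM' : M'.det = (N : ℤ√d)) (C κ r : ℝ) (hc : 0 < c₀) : ∃ B, 0 ≤ B ∧
    ∀ p ∈ siegel C κ c₀, ∀ q ∈ siegel C κ c₀, ∀ δ : SL(2, ℤ√d), (M' * δ.1 * M.adjugate) 1 0 ≠ 0 →
      dist (ma hd (M' * δ.1 * M.adjugate) p).1 q.1 ≤ r →
      dist (ma hd (M' * δ.1 * M.adjugate) p).2 q.2 ≤ r → ℓ δ ≤ B := by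
  have hNN : 0 < N * N := Nat.mul_pos hN hN
  set E := Real.exp r with hE
  have hE0 : 0 < E := Real.exp_pos r
  obtain ⟨s, hs⟩ := exists_dist_le_of_mem_siegel hc C κ (((N * N : ℕ) : ℝ) ^ 2 * E ^ 2 / c₀)
  obtain ⟨B, hB, h⟩ := exists_length_le_of_finite (ℓ := ℓ)
    ((finite_setOf_dist_le hd hns hNN (r + s)).preimage
      (mul_adjugate_injective hd hns hN hM hM').injOn)
  refine ⟨B, hB, fun p hp q hq δ h0 h1 h2 => h δ ?_⟩
  have hdet := det_mul_adjugate hM hM' δ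
  change _ = _ ∧ _
  refine ⟨hdet, ?_⟩
  set L := M' * δ.1 * M.adjugate
  have hE1 (z w : ℍ) (h : dist z w ≤ r) : w.im ≤ z.im * E := by
    rw [dist_comm] at h
    exact (im_le_im_mul_exp_dist w z).trans
      (mul_le_mul_of_nonneg_left (Real.exp_le_exp.2 h) z.im_pos.le)
  have k1 : q.1.im ≤ (nm hd 0 L • p.1).im * E := hE1 _ _ h1
  have k2 : q.2.im ≤ (nm hd 1 L • p.2).im * E := hE1 _ _ h2
  have hprod := im_mul_im_le_of_ne_zero hd hns hdet hNN h0 p.1 p.2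
  have hp1 := p.1.im_pos
  have hp2 := p.2.im_pos
  have hq1 := q.1.im_pos
  have hq2 := q.2.im_pos
  have h3 : q.1.im * q.2.im * (p.1.im * p.2.im) ≤ ((N * N : ℕ) : ℝ) ^ 2 * E ^ 2 := by
    have h4 : q.1.im * q.2.im ≤ (nm hd 0 L • p.1).im * E * ((nm hd 1 L • p.2).im * E) := by gcongr
    calc _ ≤ (nm hd 0 L • p.1).im * E * ((nm hd 1 L • p.2).im * E) * (p.1.im * p.2.im) := by gcongr
      _ = (nm hd 0 L • p.1).im * (nm hd 1 L • p.2).im * (p.1.im * p.2.im) * E ^ 2 := by ring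
      _ ≤ _ := by gcongr
  have hps := hs p hp (by
    rw [le_div_iff₀ hc]
    refine (mul_le_mul_of_nonneg_left hq.2.2.1 (by positivity)).trans (le_trans (le_of_eq ?_) h3)
    ring)
  have hqs := hs q hq (by
    rw [le_div_iff₀ hc]
    exact (mul_le_mul_of_nonneg_left hp.2.2.1 (by positivity)).trans h3)
  have hr : 0 ≤ r := dist_nonneg.trans h1
  intro j
  fin_cases j
  · exact ⟨p.1, by linarith [hps.1], (dist_triangle _ q.1 _).trans (add_le_add h1 hqs.1)⟩
  · exact ⟨p.2, by linarith [hps.2], (dist_triangle _ q.2 _).trans (add_le_add h2 hqs.2)⟩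

variable {u : (ℤ√d)ˣ} {x x' : ℤ√d} {τ : ℕ}

theorem exists_length_le_of_eq_zero (hns : ¬IsSquare d) (hN : 0 < N) (hM : M.det = (N : ℤ√d))
    (hM' : M'.det = (N : ℤ√d)) (hx : (u : ℤ√d) = 1 + N * x)
    (hx' : ((u⁻¹ : (ℤ√d)ˣ) : ℤ√d) = 1 + N * x')
    (hτ : 16 ≤ τ) (huτ : (u : ℤ√d) ^ 2 + ((u⁻¹ : (ℤ√d)ˣ) : ℤ√d) ^ 2 = τ) (hℓ : IsLength ℓ)
    (C κ r : ℝ) (hc : 0 < c₀) : ∃ B, 0 ≤ B ∧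
    ∀ p ∈ siegel C κ c₀, ∀ q ∈ siegel C κ c₀, ∀ δ : SL(2, ℤ√d), (M' * δ.1 * M.adjugate) 1 0 = 0 →
      dist (ma hd (M' * δ.1 * M.adjugate) p).1 q.1 ≤ r →
      dist (ma hd (M' * δ.1 * M.adjugate) p).2 q.2 ≤ r → ℓ δ ≤ B * √(1 + √(p.1.im * p.2.im)) := by
  have hNN : 0 < N * N := Nat.mul_pos hN hN
  have hN1 : (1 : ℝ) ≤ N := by exact_mod_cast hN
  obtain ⟨A, hA, hunip⟩ := exists_unip_le hd hns hN hM' hx hx' hτ huτ hℓ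
  obtain ⟨B, hB, hB'⟩ := exists_abs_emb_le hd hns hNN C κ r hc
  have hs0 := Real.sqrt_nonneg (d : ℝ)
  obtain ⟨B₁, hB₁, hfin⟩ := exists_length_le_of_finite (ℓ := ℓ)
    ((finite_matrix_abs_emb_le hd hns (N * B * (1 + √(d : ℝ)) + B)).preimage
      (mul_adjugate_injective hd hns hN hM hM').injOn)
  refine ⟨A * √(2 + √(d : ℝ) + B) + B₁, by positivity, fun p hp q hq δ h0 h1 h2 => ?_⟩
  have hdet := det_mul_adjugate hM hM' δ
  have hb := hB' p hp q hq _ hdet h0 h1 h2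
  set L := M' * δ.1 * M.adjugate with hL
  set Y := √(p.1.im * p.2.im)
  have hY : 0 ≤ Y := Real.sqrt_nonneg _
  have he := emb_ne_zero hd hns (ne_zero_of_eq_zero hdet hNN h0)
  obtain ⟨t, ht⟩ := exists_abs_sub_emb_le hd hns fun j => emb hd j (L 0 1) / emb hd j (L 1 1) / N
  set υ := unip (M' 1 0) (M' 1 1) t with hυ
  have hδ : M' * (υ⁻¹ * δ).1 * M.adjugate = (upper (N * -t)).1 * L := by
    rw [Matrix.SpecialLinearGroup.coe_mul, hυ, ← unip_neg, ← Matrix.mul_assoc, mul_unip hM', hL,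
      Matrix.mul_assoc, Matrix.mul_assoc, Matrix.mul_assoc]
  have hmem : ℓ (υ⁻¹ * δ) ≤ B₁ := by
    refine hfin _ fun j i k => ?_
    change |emb hd j ((M' * (υ⁻¹ * δ).1 * M.adjugate) i k)| ≤ _
    obtain ⟨b1, b2, -⟩ := hb j
    have hle : B ≤ N * B * (1 + √(d : ℝ)) + B := le_add_of_nonneg_left (by positivity)
    rw [hδ, coe_upper, eta_fin_two L, mul_fin_two, h0]
    have e : L 0 1 + N * -t * L 1 1 = L 0 1 - N * t * L 1 1 := by ring
    fin_cases i <;> fin_cases k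
    · simpa using b1.trans hle
    · have h3 : emb hd j (L 0 1 - N * t * L 1 1) =
          N * emb hd j (L 1 1) * (emb hd j (L 0 1) / emb hd j (L 1 1) / N - emb hd j t) := by
        rw [map_sub, map_mul, map_mul, map_natCast]
        have := he j
        field_simp
      have h4 : |emb hd j (L 0 1 - N * t * L 1 1)| ≤ N * B * (1 + √(d : ℝ)) := by
        rw [h3, abs_mul, abs_mul, Nat.abs_cast]
        have := ht j
        gcongr
      rw [← e] at h4
      simpa using h4.trans (le_add_of_nonneg_right hB)
    · simpa using hB.trans hle
    · simpa using b2.trans hle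
  have hts : ∀ j, |emb hd j t| ≤ 1 + √(d : ℝ) + B * (1 + Y) := fun j => by
    have h3 : |emb hd j (L 0 1) / emb hd j (L 1 1) / N| ≤ B * (1 + Y) := by
      rw [abs_div, Nat.abs_cast]
      exact (div_le_self (abs_nonneg _) hN1).trans (hb j).2.2
    have h4 := ht j
    rw [abs_sub_comm] at h4
    have h5 := abs_sub_abs_le_abs_sub (emb hd j t) (emb hd j (L 0 1) / emb hd j (L 1 1) / N)
    linarith
  have h3 := hunip t _ hts
  have h4 := hℓ.mul_le υ (υ⁻¹ * δ)
  rw [mul_inv_cancel_left] at h4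
  have h5 : √(1 + √(d : ℝ) + B * (1 + Y) + 1) ≤ √(2 + √(d : ℝ) + B) * √(1 + Y) := by
    rw [← Real.sqrt_mul (by positivity)]
    refine Real.sqrt_le_sqrt ?_
    nlinarith
  have h6 : 1 ≤ √(1 + Y) := Real.one_le_sqrt.2 (by linarith)
  have h7 := mul_le_mul_of_nonneg_left h5 hA
  have h8 := mul_le_mul_of_nonneg_left h6 hB₁
  linarith

theorem exists_length_le (hns : ¬IsSquare d) (hN : 0 < N) (hM : M.det = (N : ℤ√d))
    (hM' : M'.det = (N : ℤ√d)) (hx : (u : ℤ√d) = 1 + N * x)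
    (hx' : ((u⁻¹ : (ℤ√d)ˣ) : ℤ√d) = 1 + N * x')
    (hτ : 16 ≤ τ) (huτ : (u : ℤ√d) ^ 2 + ((u⁻¹ : (ℤ√d)ˣ) : ℤ√d) ^ 2 = τ) (hℓ : IsLength ℓ)
    (C κ r : ℝ) (hc : 0 < c₀) : ∃ B, 0 ≤ B ∧
    ∀ z, ma hd M z ∈ siegel C κ c₀ → ∀ w, dist w z ≤ r → ∀ δ : SL(2, ℤ√d),
      ma hd M' (act (rho hd 0) (rho hd 1) δ w) ∈ siegel C κ c₀ →
        ℓ δ ≤ B * √√((ma hd M z).1.im * (ma hd M z).2.im) := by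
  have hNN : 0 < N * N := Nat.mul_pos hN hN
  obtain ⟨B₁, hB₁, h1⟩ := exists_length_le_of_ne_zero (ℓ := ℓ) hd hns hN hM hM' C κ r hc
  obtain ⟨B₂, hB₂, h2⟩ := exists_length_le_of_eq_zero hd hns hN hM hM' hx hx' hτ huτ hℓ C κ r hc
  refine ⟨(B₁ + B₂) * √((√c₀)⁻¹ + 1), by positivity, fun z hz w hwz δ hδ => ?_⟩
  have hdet := det_mul_adjugate hM hM' δ
  have hdet' : (M' * δ.1).det = (N : ℤ√d) := by rw [det_mul, hM', δ.2, mul_one]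
  have e : ma hd (M' * δ.1 * M.adjugate) (ma hd M z) = ma hd (M' * δ.1) z := by
    rw [← ma_mul hd hdet hNN hM hN, mul_adjugate_mul hM]
    simp only [ma, nm_smul hd hdet' hN hN]
  have hdist : dist (ma hd (M' * δ.1) z) (ma hd M' (act (rho hd 0) (rho hd 1) δ w)) ≤ r := by
    rw [← ma_mul_coe hd hM' hN, dist_ma, dist_comm]
    exact hwz
  rw [← e, Prod.dist_eq, max_le_iff] at hdist
  set p := ma hd M z
  have hp := hz.2.2.1
  have hY : 0 < √(p.1.im * p.2.im) := Real.sqrt_pos.2 (hc.trans_le hp)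
  have hc' : 0 < √c₀ := Real.sqrt_pos.2 hc
  set Y := √(p.1.im * p.2.im)
  have h3 : √(1 + Y) ≤ √((√c₀)⁻¹ + 1) * √Y := by
    rw [← Real.sqrt_mul (by positivity)]
    refine Real.sqrt_le_sqrt ?_
    have : 1 ≤ (√c₀)⁻¹ * Y := by
      rw [← inv_mul_cancel₀ hc'.ne']
      exact mul_le_mul_of_nonneg_left (Real.sqrt_le_sqrt hp) (by positivity)
    linarith
  have h4 : 1 ≤ √(1 + Y) := Real.one_le_sqrt.2 (by linarith)
  have h5 : ℓ δ ≤ (B₁ + B₂) * √(1 + Y) := by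
    by_cases h0 : (M' * δ.1 * M.adjugate) 1 0 = 0
    · have := h2 p hz _ hδ δ h0 hdist.1 hdist.2
      have : 0 ≤ B₁ * √(1 + Y) := by positivity
      linarith
    · have := h1 p hz _ hδ δ h0 hdist.1 hdist.2
      have : 0 ≤ B₂ * √(1 + Y) := by positivity
      have := mul_le_mul_of_nonneg_left h4 hB₁
      linarith
  calc ℓ δ ≤ (B₁ + B₂) * √(1 + Y) := h5
    _ ≤ (B₁ + B₂) * (√((√c₀)⁻¹ + 1) * √Y) := by gcongr
    _ = _ := by ring

end LengthBound

section Integral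

theorem lintegral_upperHalfPlane_le {f : ℍ → ℝ≥0∞} {F : ℝ × ℝ → ℝ≥0∞} (hf : Measurable f)
    (hF : Measurable F)
    (h : ∀ z : ℍ, ENNReal.ofReal (z.im ^ 2)⁻¹ * f z ≤ F (z.re, z.im)) : ∫⁻ z, f z ≤ ∫⁻ x, F x := by
  have hD : Measurable fun z : ℍ => ENNReal.ofReal (z.im ^ 2)⁻¹ := by fun_prop
  have e : (volume : Measure ℍ) =
      (volume.comap UpperHalfPlane.coe).withDensity fun z => ENNReal.ofReal (z.im ^ 2)⁻¹ := by
    rw [UpperHalfPlane.volume_def]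
    congr 1
    ext z : 1
    rw [ENNReal.ofReal, ENNReal.coe_inj]
    ext
    simp [sq_nonneg]
  have hG : Measurable fun z : ℂ => F (z.re, z.im) :=
    hF.comp Complex.measurableEquivRealProd.measurable
  rw [e, lintegral_withDensity_eq_lintegral_mul _ hD hf]
  calc _ ≤ ∫⁻ z : ℍ, F ((z : ℂ).re, (z : ℂ).im) ∂volume.comap UpperHalfPlane.coe := lintegral_mono h
    _ = ∫⁻ z : ℂ, F (z.re, z.im) ∂(volume.comap UpperHalfPlane.coe).map UpperHalfPlane.coe :=
      (lintegral_map hG measurable_coe).symm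
    _ ≤ ∫⁻ z : ℂ, F (z.re, z.im) := by
      rw [measurableEmbedding_coe.map_comap]
      exact setLIntegral_le_lintegral _ _
    _ = _ := Complex.volume_preserving_equiv_real_prod.lintegral_comp_emb
      Complex.measurableEquivRealProd.measurableEmbedding F

/-- A vertical strip bounded away from the real axis. -/
def strip (C c : ℝ) : Set ℍ := {z | |z.re| ≤ C ∧ c ≤ z.im}

theorem measurableSet_strip (C c : ℝ) : MeasurableSet (strip C c) := by
  have h1 : Measurable fun z : ℍ => |z.re| := by fun_prop
  have h2 : Measurable fun z : ℍ => z.im := by fun_prop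
  exact (measurableSet_le h1 measurable_const).inter (measurableSet_le measurable_const h2)

theorem setLIntegral_strip_sqrt_im_ne_top (C : ℝ) {c : ℝ} (hc : 0 < c) :
    ∫⁻ z in strip C c, ENNReal.ofReal √z.im ≠ ∞ := by
  have hm : Measurable fun z : ℍ => ENNReal.ofReal √z.im := by fun_prop
  have hm1 : Measurable ((Set.Icc (-C) C).indicator (1 : ℝ → ℝ≥0∞)) :=
    measurable_one.indicator measurableSet_Icc
  have hm2 : Measurable
      ((Set.Ioi (c / 2)).indicator fun y : ℝ => ENNReal.ofReal (y ^ (-(3 / 2) : ℝ))) :=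
    Measurable.indicator (by fun_prop) measurableSet_Ioi
  rw [← lintegral_indicator (measurableSet_strip C c)]
  refine ne_top_of_le_ne_top ?_ (lintegral_upperHalfPlane_le
    (F := fun x => (Set.Icc (-C) C).indicator 1 x.1 *
      (Set.Ioi (c / 2)).indicator (fun y : ℝ => ENNReal.ofReal (y ^ (-(3 / 2) : ℝ))) x.2)
    (hm.indicator (measurableSet_strip C c))
      ((hm1.comp measurable_fst).mul (hm2.comp measurable_snd)) fun z => ?_)
  · rw [Measure.volume_eq_prod, lintegral_prod_mul hm1.aemeasurable hm2.aemeasurable]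
    refine ENNReal.mul_ne_top ?_ ?_
    · rw [lintegral_indicator_one measurableSet_Icc, Real.volume_Icc]
      exact ENNReal.ofReal_ne_top
    · rw [lintegral_indicator measurableSet_Ioi]
      exact (integrableOn_Ioi_rpow_of_lt (by norm_num) (half_pos hc)).lintegral_lt_top.ne
  · by_cases hz : z ∈ strip C c
    · have h1 : z.re ∈ Set.Icc (-C) C := abs_le.1 hz.1
      have h2 : z.im ∈ Set.Ioi (c / 2) := lt_of_lt_of_le (half_lt_self hc) hz.2
      have h3 := z.im_pos
      simp only [Set.indicator_of_mem hz, Set.indicator_of_mem h1, Set.indicator_of_mem h2,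
          Pi.one_apply, one_mul]
      rw [← ENNReal.ofReal_mul (by positivity), Real.sqrt_eq_rpow, ← Real.rpow_natCast,
          ← Real.rpow_neg h3.le,
        ← Real.rpow_add h3]
      norm_num
    · rw [Set.indicator_of_notMem hz, mul_zero]
      exact zero_le

variable {d : ℤ} (hd : 0 ≤ d) {R : Finset (Matrix (Fin 2) (Fin 2) (ℤ√d))} {C κ c₀ : ℝ}

theorem lintegral_comp_ma {F : ℍ × ℍ → ℝ≥0∞} (hF : Measurable F)
    (M : Matrix (Fin 2) (Fin 2) (ℤ√d)) :
    ∫⁻ z, F (ma hd M z) = ∫⁻ z, F z :=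
  ((measurePreserving_smul (nm hd 0 M) volume).prod
    (measurePreserving_smul (nm hd 1 M) volume)).lintegral_comp
    hF

/-- The square root of the height on a Siegel set. -/
noncomputable def sqrtHeight (C κ c₀ : ℝ) : ℍ × ℍ → ℝ :=
  (siegel C κ c₀).indicator fun p => √(p.1.im * p.2.im)

theorem sqrtHeight_nonneg (C κ c₀ : ℝ) (p : ℍ × ℍ) : 0 ≤ sqrtHeight C κ c₀ p :=
  Set.indicator_nonneg (fun _ _ => Real.sqrt_nonneg _) p

theorem measurable_sqrtHeight (C κ c₀ : ℝ) : Measurable (sqrtHeight C κ c₀) :=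
  Measurable.indicator (by fun_prop) measurableSet_siegel

theorem lintegral_sqrtHeight_ne_top (hc : 0 < c₀) (C : ℝ) (hκ : 0 < κ) :
    ∫⁻ p, ENNReal.ofReal (sqrtHeight C κ c₀ p) ≠ ∞ := by
  set c := √(c₀ / κ)
  have hc0 : 0 < c := by positivity
  have hm : Measurable ((strip C c).indicator fun z => ENNReal.ofReal √z.im) :=
    Measurable.indicator (by fun_prop) (measurableSet_strip C c)
  have hfin : ∫⁻ z, (strip C c).indicator (fun z => ENNReal.ofReal √z.im) z ≠ ∞ := by
    rw [lintegral_indicator (measurableSet_strip C c)]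
    exact setLIntegral_strip_sqrt_im_ne_top C hc0
  have h := lintegral_prod_mul (μ := (volume : Measure ℍ)) (ν := (volume : Measure ℍ))
    hm.aemeasurable hm.aemeasurable
  refine ne_top_of_le_ne_top (h ▸ ENNReal.mul_ne_top hfin hfin) ?_
  rw [Measure.volume_eq_prod]
  refine lintegral_mono fun p => ?_
  by_cases hp : p ∈ siegel C κ c₀
  · obtain ⟨-, h1, -⟩ := im_bounds hc hp
    have h2 := p.2.im_pos
    have h3 : c ≤ p.2.im := (Real.sqrt_le_left h2.le).2 h1
    have h4 := hp.1
    have h5 := hp.2.1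
    have h6 := hp.2.2.2.1
    have m1 : p.1 ∈ strip C c := ⟨h4, h3.trans h6⟩
    have m2 : p.2 ∈ strip C c := ⟨h5, h3⟩
    rw [Set.indicator_of_mem m1, Set.indicator_of_mem m2, ← ENNReal.ofReal_mul (Real.sqrt_nonneg _),
      ← Real.sqrt_mul p.1.im_pos.le, sqrtHeight, Set.indicator_of_mem hp]
  · rw [sqrtHeight, Set.indicator_of_notMem hp, ENNReal.ofReal_zero]
    exact zero_le

theorem lintegral_sum_sqrtHeight_ne_top (R : Finset (Matrix (Fin 2) (Fin 2) (ℤ√d))) (hc : 0 < c₀)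
    (C : ℝ)
    (hκ : 0 < κ) : ∫⁻ z, ENNReal.ofReal (√(∑ M ∈ R, sqrtHeight C κ c₀ (ma hd M z))) ^ 2 ≠ ∞ := by
  have hm : Measurable fun p => ENNReal.ofReal (sqrtHeight C κ c₀ p) :=
    (measurable_sqrtHeight C κ c₀).ennreal_ofReal
  have e (z : ℍ × ℍ) : ENNReal.ofReal (√(∑ M ∈ R, sqrtHeight C κ c₀ (ma hd M z))) ^ 2 =
      ∑ M ∈ R, ENNReal.ofReal (sqrtHeight C κ c₀ (ma hd M z)) := by
    have h0 : ∀ M ∈ R, 0 ≤ sqrtHeight C κ c₀ (ma hd M z) := fun M _ => sqrtHeight_nonneg ..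
    rw [← ENNReal.ofReal_pow (Real.sqrt_nonneg _), Real.sq_sqrt (Finset.sum_nonneg h0),
        ENNReal.ofReal_sum_of_nonneg h0]
  simp only [e]
  have hm' (M : Matrix (Fin 2) (Fin 2) (ℤ√d)) :
      Measurable fun z => ENNReal.ofReal (sqrtHeight C κ c₀ (ma hd M z)) :=
          hm.comp (measurable_ma hd M)
  rw [lintegral_finsetSum R fun M _ => hm' M]
  simp only [lintegral_comp_ma hd hm]
  exact ENNReal.sum_ne_top.2 fun _ _ => lintegral_sqrtHeight_ne_top hc C hκ

theorem sqrt_im_mul_im_le {M : Matrix (Fin 2) (Fin 2) (ℤ√d)} (hM : M ∈ R) {z : ℍ × ℍ}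
    (hz : ma hd M z ∈ siegel C κ c₀) :
    √((ma hd M z).1.im * (ma hd M z).2.im) ≤ ∑ M ∈ R, sqrtHeight C κ c₀ (ma hd M z) := by
  have h := Finset.single_le_sum (f := fun M => sqrtHeight C κ c₀ (ma hd M z))
    (fun M _ => sqrtHeight_nonneg ..) hM
  refine le_trans (le_of_eq ?_) h
  simp only [sqrtHeight, Set.indicator_of_mem hz]

end Integral

section Reduction

theorem exists_isReducedBy {d : ℤ} (hd : 0 ≤ d) (hns : ¬IsSquare d)
    {H : Type*} [NormedAddCommGroup H]
    [InnerProductSpace ℝ H] {π : SL(2, ℤ√d) → H ≃ₗᵢ[ℝ] H} {b : SL(2, ℤ√d) → H}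
    (hb : ∀ γ δ, b (γ * δ) = b γ + π γ (b δ)) : ∃ 𝓢 h, IsReducedBy (rho hd 0) (rho hd 1) b 𝓢 h := by
  obtain ⟨N, hN, hred⟩ := exists_ma_mem_siegel hd hns
  obtain ⟨u, x, x', τ, hx, hx', hu, hu', hτ, huτ⟩ := exists_unit hd hns hN
  obtain ⟨c₀, hc, hred⟩ := hred u hu hu'
  obtain ⟨R, hR, hrep⟩ := exists_finite_representatives hd hns hN
  set C := 1 + √(d : ℝ)
  set κ := emb hd 0 u ^ 4
  have hκ : 0 < κ := by positivity
  refine ⟨siegelUnion hd R C κ c₀, fun z => √(∑ M ∈ R, sqrtHeight C κ c₀ (ma hd M z)),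
    measurableSet_siegelUnion hd, fun z => ?_, fun z => Real.sqrt_nonneg _,
    finite_act_mem_siegelUnion hd hns hN hc hR, fun r => ?_, ?_⟩
  · obtain ⟨M, hM, hz⟩ := hred z
    obtain ⟨M', hM', γ, rfl⟩ := hrep M hM
    rw [ma_mul_coe hd (hR M' hM') hN] at hz
    exact ⟨γ, M', hM', hz⟩
  · have hℓ := isLength_norm hb
    have key (M M' : Matrix (Fin 2) (Fin 2) (ℤ√d)) : ∃ B, 0 ≤ B ∧ (M ∈ R → M' ∈ R →
        ∀ z, ma hd M z ∈ siegel C κ c₀ → ∀ w, dist w z ≤ r → ∀ δ : SL(2, ℤ√d),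
        ma hd M' (act (rho hd 0) (rho hd 1) δ w) ∈ siegel C κ c₀ →
          ‖b δ‖ ≤ B * √√((ma hd M z).1.im * (ma hd M z).2.im)) := by
      by_cases h : M ∈ R ∧ M' ∈ R
      · obtain ⟨B, hB, hB'⟩ :=
          exists_length_le hd hns hN (hR M h.1) (hR M' h.2) hx hx' hτ huτ hℓ C κ r hc
        exact ⟨B, hB, fun _ _ => hB'⟩
      · exact ⟨0, le_rfl, fun h1 h2 => absurd ⟨h1, h2⟩ h⟩
    choose B hB0 hB using key
    refine ⟨∑ M ∈ R, ∑ M' ∈ R, B M M', ?_⟩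
    rintro z ⟨M, hM, hz⟩ w hwz δ ⟨M', hM', hδ⟩
    have h1 := hB M M' hM hM' z hz w hwz δ⁻¹ hδ
    have h2 : B M M' ≤ ∑ M ∈ R, ∑ M' ∈ R, B M M' :=
      (Finset.single_le_sum (f := fun M' => B M M') (fun _ _ => hB0 _ _) hM').trans
        (Finset.single_le_sum (f := fun M => ∑ M' ∈ R, B M M')
          (fun _ _ => Finset.sum_nonneg fun _ _ => hB0 _ _) hM)
    rw [hℓ.inv] at h1
    exact h1.trans (mul_le_mul h2
      (Real.sqrt_le_sqrt (sqrt_im_mul_im_le hd hM hz)) (Real.sqrt_nonneg _)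
      ((hB0 _ _).trans h2))
  · exact ne_top_of_le_ne_top (lintegral_sum_sqrtHeight_ne_top hd R hc C hκ)
      (setLIntegral_le_lintegral _ _)

end Reduction

section Transfer

theorem wordLength_preimage {G G' : Type*} [Group G] [Group G'] (e : G ≃* G') (W : Set G') (g : G) :
    wordLength (e ⁻¹' W) g = wordLength W (e g) := by
  have h (n : ℕ) : e g ∈ W ^ n ↔ g ∈ (e ⁻¹' W) ^ n := by
    rw [← Set.image_preimage_eq W e.surjective, ← Set.image_pow,
        Set.preimage_image_eq _ e.injective]
    exact e.injective.mem_set_image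
  simp only [wordLength, h]

theorem hasSublinearGrowth_of_preimage {G G' H : Type*} [Group G] [Group G'] [NormedAddCommGroup H]
    (e : G ≃* G') {W : Set G'} {b : G' → H} (h : HasSublinearGrowth (e ⁻¹' W) (b ∘ e)) :
    HasSublinearGrowth W b := fun ε hε => by
  obtain ⟨N, hN⟩ := h ε hε
  refine ⟨N, e.surjective.forall.2 fun g hg => ?_⟩
  rw [← wordLength_preimage] at hg ⊢
  exact hN g hg

theorem not_isSquare_of_squarefree {d : ℤ} (hd : 2 ≤ d) (hsf : Squarefree d) : ¬IsSquare d := by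
  rintro ⟨r, rfl⟩
  rcases Int.isUnit_iff.1 (hsf r dvd_rfl) with rfl | rfl <;> norm_num at hd

theorem sl2GaloisEmbedding_injective {d : ℤ} (hd : 0 ≤ d) (hns : ¬IsSquare d) :
    Function.Injective (sl2GaloisEmbedding d hd) := fun γ δ h => by
  have h0 : rho hd 0 γ = rho hd 0 δ := congrArg Prod.fst h
  refine Subtype.ext (Matrix.ext fun i k => emb_injective hd hns 0 ?_)
  exact congrFun (congrFun (congrArg Subtype.val h0) i) k

instance (d : ℤ) : Countable (ℤ√d) :=
  Function.Injective.countable (f := fun x : ℤ√d => (x.re, x.im)) fun _ _ h =>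
    Zsqrtd.ext (congrArg Prod.fst h) (congrArg Prod.snd h)

instance (d : ℤ) : Countable SL(2, ℤ√d) :=
  Function.Injective.countable (f := fun (γ : SL(2, ℤ√d)) i k => γ.1 i k) fun _ _ h => Subtype.ext h

theorem hasSublinearGrowth_sl2 {d : ℤ} (hd : 0 ≤ d) (hns : ¬IsSquare d)
    {H : Type*} [NormedAddCommGroup H]
    [InnerProductSpace ℝ H] [CompleteSpace H] {π : SL(2, ℤ√d) → H ≃ₗᵢ[ℝ] H} {b : SL(2, ℤ√d) → H}
    (hπ : ∀ γ δ x, π (γ * δ) x = π γ (π δ x)) (hb : ∀ γ δ, b (γ * δ) = b γ + π γ (b δ))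
    {W : Set SL(2, ℤ√d)} (hWfin : W.Finite) (hWsymm : W⁻¹ = W) (hWgen : Subgroup.closure W = ⊤) :
    HasSublinearGrowth W b := by
  obtain ⟨𝓢, h, hS⟩ := exists_isReducedBy hd hns hb
  exact hasSublinearGrowth_of_isReducedBy (isProper_rho hd hns) (exists_dist_rho_smul_lt hd hns 0)
    (exists_dist_rho_smul_lt hd hns 1) hπ hb hS hWfin hWsymm hWgen

end Transfer

end SL2Cocycle

/-- For the weakly irreducible lattice
`Γ = {(σ₁ A, σ₂ A) : A ∈ SL(2, ℤ[√d])} ≤ SL(2, ℝ) × SL(2, ℝ)` (with `d ≥ 2` squarefree),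
every 1-cocycle over every unitary representation of `Γ` has sublinear growth with respect
to the word length of any finite symmetric generating set `W ∋ 1` of `Γ`. -/
theorem sublinearGrowth_cocycles_of_sl2_zsqrtd_lattice
    (d : ℤ) (hd2 : 2 ≤ d) (hdsf : Squarefree d)
    (W : Set (sl2GaloisEmbedding d (zero_le_two.trans hd2)).range)
    (hWfin : W.Finite) (hWsymm : W⁻¹ = W)
    (hWone : (1 : (sl2GaloisEmbedding d (zero_le_two.trans hd2)).range) ∈ W)
    (hWgen : Subgroup.closure W = ⊤)
    {H : Type*} [NormedAddCommGroup H] [InnerProductSpace ℂ H] [CompleteSpace H]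
    (π : (sl2GaloisEmbedding d (zero_le_two.trans hd2)).range →* (H ≃ₗᵢ[ℂ] H))
    (b : (sl2GaloisEmbedding d (zero_le_two.trans hd2)).range → H)
    (hbcoc : ∀ g h : (sl2GaloisEmbedding d (zero_le_two.trans hd2)).range,
      b (g * h) = b g + π g (b h)) :
    HasSublinearGrowth W b := by
  have hd : 0 ≤ d := zero_le_two.trans hd2
  have hns := SL2Cocycle.not_isSquare_of_squarefree hd2 hdsf
  let e := MonoidHom.ofInjective (SL2Cocycle.sl2GaloisEmbedding_injective hd hns)
  let _ : InnerProductSpace ℝ H := InnerProductSpace.complexToReal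
  let π' (γ : Matrix.SpecialLinearGroup (Fin 2) (ℤ√d)) : H ≃ₗᵢ[ℝ] H :=
    { toLinearEquiv := (π (e γ)).toLinearEquiv.restrictScalars ℝ
      norm_map' := (π (e γ)).norm_map }
  refine SL2Cocycle.hasSublinearGrowth_of_preimage e
    (SL2Cocycle.hasSublinearGrowth_sl2 hd hns (π := π') (fun γ δ x => ?_) (fun γ δ => ?_)
      (hWfin.preimage e.injective.injOn) ?_ ?_)
  · change π (e (γ * δ)) x = π (e γ) (π (e δ) x)
    rw [map_mul, map_mul]
    rfl
  · change b (e (γ * δ)) = b (e γ) + π (e γ) (b (e δ))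
    rw [map_mul, hbcoc]
  · ext γ
    rw [Set.mem_inv, Set.mem_preimage, Set.mem_preimage, map_inv, ← Set.mem_inv, hWsymm]
  · have h : e ⁻¹' W = e.symm.toMonoidHom '' W := (e.toEquiv.image_symm_eq_preimage W).symm
    rw [h, ← MonoidHom.map_closure, hWgen]
    exact Subgroup.map_top_of_surjective _ e.symm.surjective
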